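/- Let p, q be coprime integers with 1 ≤ p < q, and let k ≥ 2 be an integer that is not a q-th power of an integer. Then as l → ∞ over positive reals, ∑_{0 ≤ d ≤ l} {k^{d + p/q}} = l/2 − (1/(2πi)) ∑_{0 < |n| ≤ k^l} ζ(2nπi/log k) e^{2nπi p/q} / n + o(l), where the sum over n runs over nonzero integers with |n| ≤ k^l. -/

import Mathlib

open Complex Filter Asymptotics

namespace MvPolynomial

@[elab_as_elim]
theorem multiindex_induction {n : ℕ} {p : (Fin n →₀ ℕ) → Prop} (e : Fin n →₀ ℕ) (zero : p 0)
    (succ : ∀ e h, p e → p (e + Finsupp.single h 1)) : p e := by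
  induction e using Finsupp.induction with
  | zero => exact zero
  | single_add a b f _ _ ih =>
    clear * - ih succ
    induction b with
    | zero => simpa using ih
    | succ b hb =>
      have := succ _ a hb
      rwa [add_right_comm, ← Finsupp.single_add] at this

section Hasse

variable {n : ℕ} {R : Type*} [CommRing R]

/-- The product of binomial coefficients `∏ h, (i h).choose (j h)`. -/
def multiChoose (i j : Fin n →₀ ℕ) : ℕ := ∏ h, (i h).choose (j h)

/-- The Hasse derivative of order `e`, sending `x ^ i` to `(i choose e) x ^ (i - e)`. -/
noncomputable def hasse (e : Fin n →₀ ℕ) :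
    MvPolynomial (Fin n) R →ₗ[R] MvPolynomial (Fin n) R :=
  (basisMonomials (Fin n) R).constr R fun i => monomial (i - e) (multiChoose i e : R)

theorem hasse_monomial (e i : Fin n →₀ ℕ) (c : R) :
    hasse e (monomial i c) = monomial (i - e) ((multiChoose i e : R) * c) := by
  have h := (basisMonomials (Fin n) R).constr_basis R
    (fun i => monomial (i - e) (multiChoose i e : R)) i
  rw [coe_basisMonomials] at h
  have h2 : (monomial i c : MvPolynomial (Fin n) R) = c • monomial i 1 := by
    simp [smul_monomial]
  rw [h2, map_smul, hasse, h, smul_monomial, smul_eq_mul, mul_comm]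

theorem multiChoose_eq_zero {i e : Fin n →₀ ℕ} (h : ¬ e ≤ i) : multiChoose i e = 0 := by
  rw [Finsupp.le_def] at h
  push Not at h
  obtain ⟨a, ha⟩ := h
  exact Finset.prod_eq_zero (Finset.mem_univ a) (Nat.choose_eq_zero_of_lt ha)

theorem coeff_hasse (e i : Fin n →₀ ℕ) (P : MvPolynomial (Fin n) R) :
    coeff i (hasse e P) = (multiChoose (i + e) e : R) * coeff (i + e) P := by
  induction P using MvPolynomial.induction_on' with
  | monomial u a =>
    rw [hasse_monomial, coeff_monomial, coeff_monomial]
    by_cases h : e ≤ u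
    · have : u - e = i ↔ u = i + e := by
        constructor
        · rintro rfl; exact (tsub_add_cancel_of_le h).symm
        · rintro rfl; simp
      simp only [this]
      split_ifs with h2
      · rw [h2]
      · simp
    · have h1 : ¬ (u = i + e) := by
        rintro rfl; exact h (by simp)
      rw [if_neg h1, multiChoose_eq_zero h]; simp
  | add p q hp hq => simp [hp, hq, mul_add]

theorem hasse_zero (P : MvPolynomial (Fin n) R) : hasse 0 P = P := by
  ext i; simp [coeff_hasse, multiChoose]

theorem map_hasse {S : Type*} [CommRing S] (f : R →+* S) (e : Fin n →₀ ℕ)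
    (P : MvPolynomial (Fin n) R) : map f (hasse e P) = hasse e (map f P) := by
  ext i; simp [coeff_hasse, coeff_map]

theorem multiChoose_le {i e : Fin n →₀ ℕ} {r : Fin n → ℕ} (h : ∀ a, i a ≤ r a) :
    multiChoose i e ≤ 2 ^ (∑ a, r a) := by
  rw [← Finset.prod_pow_eq_pow_sum]
  exact Finset.prod_le_prod' fun a _ =>
    (Nat.choose_le_two_pow _ _).trans (Nat.pow_le_pow_right (by norm_num) (h a))

theorem degreeOf_hasse_le (e : Fin n →₀ ℕ) (P : MvPolynomial (Fin n) R) (h : Fin n) :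
    degreeOf h (hasse e P) ≤ degreeOf h P := by
  rw [degreeOf_le_iff]
  intro i hi
  rw [mem_support_iff, coeff_hasse] at hi
  have : i + e ∈ P.support := by
    rw [mem_support_iff]; intro h0; simp [h0] at hi
  have := monomial_le_degreeOf h this
  simp at this; omega

theorem pderiv_hasse (e : Fin n →₀ ℕ) (h : Fin n) (P : MvPolynomial (Fin n) R) :
    pderiv h (hasse e P) = ((e h + 1 : ℕ) : R) • hasse (e + Finsupp.single h 1) P := by
  have key : ∀ (i : Fin n →₀ ℕ), multiChoose (i + Finsupp.single h 1 + e) e * (i h + 1)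
      = (e h + 1) * multiChoose (i + (e + Finsupp.single h 1)) (e + Finsupp.single h 1) := by
    intro i
    rw [multiChoose, multiChoose, ← Finset.mul_prod_erase _ _ (Finset.mem_univ h),
      ← Finset.mul_prod_erase Finset.univ (fun a => (((i + (e + Finsupp.single h 1) :
        Fin n →₀ ℕ)) a).choose ((e + Finsupp.single h 1 : Fin n →₀ ℕ) a)) (Finset.mem_univ h)]
    have h1 : ∏ x ∈ Finset.univ.erase h, ((i + Finsupp.single h 1 + e : Fin n →₀ ℕ) x).choose (e x)
        = ∏ x ∈ Finset.univ.erase h, ((i + (e + Finsupp.single h 1) : Fin n →₀ ℕ) x).choose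
        ((e + Finsupp.single h 1 : Fin n →₀ ℕ) x) := by
      refine Finset.prod_congr rfl fun x hx => ?_
      have : x ≠ h := Finset.ne_of_mem_erase hx
      simp [this]
    obtain ⟨Q, hQ⟩ : ∃ Q, Q = ∏ x ∈ Finset.univ.erase h,
      ((i + (e + Finsupp.single h 1) : Fin n →₀ ℕ) x).choose
        ((e + Finsupp.single h 1 : Fin n →₀ ℕ) x) := ⟨_, rfl⟩
    rw [h1, ← hQ]
    have h2 := Nat.choose_succ_right_eq (i h + 1 + e h) (e h)
    have h3 : i h + 1 + e h - e h = i h + 1 := by omega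
    rw [h3] at h2
    simp only [Finsupp.add_apply, Finsupp.single_eq_same]
    rw [show i h + (e h + 1) = i h + 1 + e h by ring]
    linear_combination Q * (-h2)
  ext i
  rw [coeff_pderiv, coeff_hasse, coeff_smul, coeff_hasse, smul_eq_mul, ← mul_assoc]
  have := congrArg (Nat.cast (R := R)) (key i)
  push_cast at this ⊢
  rw [← this, add_assoc i, add_comm e]
  ring

/-- Translation `P(x) ↦ P(x + b)`. -/
noncomputable def shift (b : Fin n → R) : MvPolynomial (Fin n) R →ₐ[R] MvPolynomial (Fin n) R :=
  aeval fun h => X h + C (b h)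

theorem pderiv_shift (b : Fin n → R) (h : Fin n) (P : MvPolynomial (Fin n) R) :
    pderiv h (shift b P) = shift b (pderiv h P) := by
  induction P using MvPolynomial.induction_on with
  | C a => simp [shift]
  | add p q hp hq => simp [hp, hq]
  | mul_X p i hp =>
    rw [map_mul, Derivation.leibniz, hp, Derivation.leibniz, map_add, smul_eq_mul, smul_eq_mul,
      smul_eq_mul, smul_eq_mul, map_mul, map_mul]
    congr 2
    simp only [shift, aeval_X, map_add, pderiv_X, pderiv_C, add_zero]
    by_cases hi : i = h
    · subst hi; simp
    · simp [hi]

theorem constantCoeff_shift (b : Fin n → R) (P : MvPolynomial (Fin n) R) :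
    coeff 0 (shift b P) = eval b P := by
  rw [← constantCoeff_eq]
  induction P using MvPolynomial.induction_on with
  | C a => simp [shift]
  | add p q hp hq => simp [hp, hq]
  | mul_X p i hp => rw [map_mul, map_mul, hp]; simp [shift]

theorem shift_neg_shift (b : Fin n → R) (P : MvPolynomial (Fin n) R) :
    shift (fun h => - b h) (shift b P) = P := by
  induction P using MvPolynomial.induction_on with
  | C a => simp [shift]
  | add p q hp hq => simp [hp, hq]
  | mul_X p i hp => rw [map_mul, map_mul, hp]; simp [shift]

theorem shift_ne_zero (b : Fin n → R) {P : MvPolynomial (Fin n) R} (hP : P ≠ 0) :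
    shift b P ≠ 0 := by
  intro h
  apply hP
  rw [← shift_neg_shift b P, h, map_zero]

end Hasse

section Field

variable {n : ℕ} {K : Type*} [Field K] [CharZero K]

theorem hasse_shift (b : Fin n → K) (e : Fin n →₀ ℕ) (P : MvPolynomial (Fin n) K) :
    hasse e (shift b P) = shift b (hasse e P) := by
  induction e using multiindex_induction with
  | zero => simp [hasse_zero]
  | succ e h ih =>
    have h1 := pderiv_hasse e h (shift b P)
    have h2 := pderiv_hasse e h P
    rw [ih, pderiv_shift, h2, map_smul] at h1
    have h0 : ((e h + 1 : ℕ) : K) ≠ 0 := Nat.cast_ne_zero.mpr (Nat.succ_ne_zero (e h))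
    exact (smul_right_injective _ h0 h1).symm

theorem coeff_shift (b : Fin n → K) (e : Fin n →₀ ℕ) (P : MvPolynomial (Fin n) K) :
    coeff e (shift b P) = eval b (hasse e P) := by
  rw [← constantCoeff_shift, ← hasse_shift, coeff_hasse]
  simp [multiChoose]

end Field
end MvPolynomial

section Wronskian

open Matrix

/-- Vectors closed up to nonzero factors under derivations, on which no nonzero linear form
vanishes, contain a basis of order less than the dimension. -/
theorem exists_det_ne_zero_of_derivations {R A I H : Type*} [CommRing R] [CommRing A] [IsDomain A]
    [Algebra R A] (ord : I → ℕ) (zero : I) (succ : H → I → I) (D : H → Derivation R A A) {s : ℕ}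
    (v : I → Fin s → A) (c : H → I → A) (h0 : ord zero = 0)
    (hsucc : ∀ h i, ord (succ h i) ≤ ord i + 1) (hc : ∀ h i, c h i ≠ 0)
    (hD : ∀ h i b, D h (v i b) = c h i * v (succ h i) b)
    (hind : ∀ p : I → Prop, p zero → (∀ h i, p i → p (succ h i)) → ∀ i, p i)
    (hrank : ∀ l : Fin s → A, l ≠ 0 → ∃ i, ∑ b, l b * v i b ≠ 0) :
    ∃ e : Fin s → I, (∀ a, ord (e a) < s) ∧ (Matrix.of fun a b => v (e a) b).det ≠ 0 := by
  have main : ∀ t ≤ s, ∃ e : Fin t → I, (∀ a, ord (e a) < t) ∧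
      LinearIndependent A (fun a => v (e a)) := by
    intro t
    induction t with
    | zero => exact fun _ => ⟨Fin.elim0, fun a => a.elim0, linearIndependent_empty_type⟩
    | succ t ih =>
      intro ht
      obtain ⟨e, he, hli⟩ := ih (by omega)
      by_contra hcon
      push Not at hcon
      have hsat : ∀ i, ord i ≤ t → ∃ a : A, a ≠ 0 ∧ ∃ g : Fin t → A,
          ∀ b, a * v i b = ∑ j, g j * v (e j) b := by
        intro i hi
        have hn := hcon (Fin.snoc e i) (by
          intro a
          refine Fin.lastCases ?_ (fun a => ?_) a
          · simpa using Nat.lt_succ_of_le hi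
          · simpa using (he a).trans (Nat.lt_succ_self t))
        rw [Fintype.not_linearIndependent_iff] at hn
        obtain ⟨g, hg, k, hk⟩ := hn
        rw [Fin.sum_univ_castSucc] at hg
        simp only [Fin.snoc_castSucc, Fin.snoc_last] at hg
        refine ⟨g (Fin.last t), ?_, fun j => - g j.castSucc, fun b => ?_⟩
        · intro h
          rw [h, zero_smul, add_zero] at hg
          have h3 := Fintype.linearIndependent_iff.mp hli _ hg
          refine hk ?_
          refine Fin.lastCases ?_ (fun a => ?_) k
          · exact h
          · exact h3 a
        · have := congrFun hg b
          simp only [Pi.add_apply, Finset.sum_apply, Pi.smul_apply, smul_eq_mul,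
            Pi.zero_apply] at this
          simp only [neg_mul, Finset.sum_neg_distrib]
          linear_combination this
      -- a nonzero linear form vanishing on the chosen vectors
      obtain ⟨l, hl0, hl⟩ : ∃ l : Fin s → A, l ≠ 0 ∧ ∀ j, ∑ b, l b * v (e j) b = 0 := by
        let M : Matrix (Fin s) (Fin s) A :=
          Matrix.of fun a b => if h : (a : ℕ) < t then v (e ⟨a, h⟩) b else 0
        have hM : M.det = 0 := Matrix.det_eq_zero_of_row_eq_zero ⟨t, by omega⟩ (by simp [M])
        obtain ⟨l, hl0, hl⟩ := exists_mulVec_eq_zero_iff.mpr hM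
        refine ⟨l, hl0, fun j => ?_⟩
        have := congrFun hl ⟨j, by omega⟩
        simp only [mulVec, dotProduct, M, Matrix.of_apply, j.2, dite_true, Pi.zero_apply] at this
        simpa [mul_comm] using this
      have hall : ∀ i, ∃ a : A, a ≠ 0 ∧ ∃ g : Fin t → A,
          ∀ b, a * v i b = ∑ j, g j * v (e j) b := by
        refine hind _ (hsat _ (by omega)) ?_
        rintro h i ⟨a, ha, g, hg⟩
        choose a' ha' g' hg' using fun j => hsat (succ h (e j))
          ((hsucc h (e j)).trans (Nat.succ_le_of_lt (he j)))
        -- `a * D v = ∑ D g * v_j + ∑ g * D v_j - D a * v`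
        let Pr := ∏ j, a' j
        have hPr : Pr ≠ 0 := Finset.prod_ne_zero_iff.mpr fun j _ => ha' j
        have hdv : ∀ j, Pr = a' j * ∏ k ∈ Finset.univ.erase j, a' k := fun j =>
          (Finset.mul_prod_erase _ _ (Finset.mem_univ j)).symm
        refine ⟨a * a * Pr * c h i, by simp [ha, hPr, hc], fun k => a * Pr * D h (g k)
          - D h a * Pr * g k + ∑ j, a * g j * c h (e j) *
            (∏ k ∈ Finset.univ.erase j, a' k) * g' j k, fun b => ?_⟩
        have h1 := congrArg (D h) (hg b)
        rw [Derivation.leibniz, map_sum] at h1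
        simp only [Derivation.leibniz, smul_eq_mul, hD, Finset.sum_add_distrib] at h1
        have h2 : a * Pr * ∑ j, g j * (c h (e j) * v (succ h (e j)) b) =
            ∑ k, (∑ j, a * g j * c h (e j) *
            (∏ k ∈ Finset.univ.erase j, a' k) * g' j k) * v (e k) b := by
          simp only [Finset.sum_mul]
          rw [Finset.sum_comm, Finset.mul_sum]
          refine Finset.sum_congr rfl fun j _ => ?_
          have h3 : ∀ k, a * g j * c h (e j) * (∏ k ∈ Finset.univ.erase j, a' k) * g' j k *
            v (e k) b = (a * g j * c h (e j) * (∏ k ∈ Finset.univ.erase j, a' k)) *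
              (g' j k * v (e k) b) := fun k => by ring
          simp only [h3]
          rw [← Finset.mul_sum, ← hg' j b]
          conv_lhs => rw [hdv j]
          ring
        simp only [add_mul, sub_mul, Finset.sum_add_distrib, Finset.sum_sub_distrib]
        rw [← h2]
        have h4 : ∑ k, a * Pr * D h (g k) * v (e k) b = a * Pr * ∑ k, v (e k) b * D h (g k) := by
          rw [Finset.mul_sum]; exact Finset.sum_congr rfl fun k _ => by ring
        have h5 : ∑ k, D h a * Pr * g k * v (e k) b = D h a * Pr * ∑ k, g k * v (e k) b := by
          rw [Finset.mul_sum]; exact Finset.sum_congr rfl fun k _ => by ring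
        rw [h4, h5, ← hg b]
        linear_combination (a * Pr) * h1
      obtain ⟨i, hi⟩ := hrank l hl0
      obtain ⟨a, ha, g, hg⟩ := hall i
      refine mul_ne_zero ha hi ?_
      rw [Finset.mul_sum]
      have : ∀ b, a * (l b * v i b) = ∑ j, g j * (l b * v (e j) b) := by
        intro b
        rw [mul_left_comm, hg b, Finset.mul_sum]
        exact Finset.sum_congr rfl fun k _ => by ring
      simp only [this]
      rw [Finset.sum_comm]
      simp [← Finset.mul_sum, hl]
  obtain ⟨e, he, hli⟩ := main s le_rfl
  refine ⟨e, he, fun hdet => ?_⟩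
  obtain ⟨w, hw0, hw⟩ := exists_vecMul_eq_zero_iff.mpr hdet
  refine hw0 (funext (Fintype.linearIndependent_iff.mp hli w ?_))
  ext b
  simpa [vecMul, dotProduct] using congrFun hw b

namespace MvPolynomial

/-- Nonvanishing of a generalised Wronskian of linearly independent polynomials. -/
theorem exists_det_hasse_ne_zero {n s : ℕ} (f : Fin s → MvPolynomial (Fin n) ℝ)
    (hf : LinearIndependent ℝ f) :
    ∃ e : Fin s → (Fin n →₀ ℕ), (∀ a, (e a).degree < s) ∧
      (Matrix.of fun a b => hasse (e a) (f b)).det ≠ 0 := by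
  refine exists_det_ne_zero_of_derivations (R := ℝ) (fun i : Fin n →₀ ℕ => i.degree) 0
    (fun h i => i + Finsupp.single h 1) (fun h => pderiv h) (fun i b => hasse i (f b))
    (fun h i => ((i h + 1 : ℕ) : MvPolynomial (Fin n) ℝ)) (by simp) ?_ ?_ ?_ ?_ ?_
  · intro h i; simp
  · intro h i; exact Nat.cast_ne_zero.mpr (Nat.succ_ne_zero (i h))
  · intro h i b
    rw [pderiv_hasse, smul_eq_C_mul]; simp
  · intro p h0 hs i
    induction i using multiindex_induction with
    | zero => exact h0
    | succ e h ih => exact hs h e ih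
  · intro l hl
    obtain ⟨b, hb⟩ := Function.ne_iff.mp hl
    obtain ⟨x, hx⟩ : ∃ x, eval x (l b) ≠ 0 := by
      by_contra! hcon
      exact hb (MvPolynomial.funext fun x => by simpa using hcon x)
    have hΦ : ∑ b, (eval x (l b)) • f b ≠ 0 := by
      intro h
      exact hx (Fintype.linearIndependent_iff.mp hf _ h b)
    obtain ⟨i, hi⟩ := ne_zero_iff.mp (shift_ne_zero x hΦ)
    refine ⟨i, fun h => hi ?_⟩
    have := congrArg (eval x) h
    rw [coeff_shift]
    simpa [smul_eval] using this

end MvPolynomial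

namespace Polynomial

/-- Nonvanishing of the Wronskian of linearly independent polynomials. -/
theorem exists_det_hasseDeriv_ne_zero {s : ℕ} (f : Fin s → ℝ[X])
    (hf : LinearIndependent ℝ f) :
    ∃ e : Fin s → ℕ, (∀ a, e a < s) ∧
      (Matrix.of fun a b => hasseDeriv (e a) (f b)).det ≠ 0 := by
  refine exists_det_ne_zero_of_derivations (R := ℝ) (fun i : ℕ => i) 0
    (fun (_ : Unit) i => i + 1) (fun _ => derivative') (fun i b => hasseDeriv i (f b))
    (fun _ i => ((i + 1 : ℕ) : ℝ[X])) (by simp) ?_ ?_ ?_ ?_ ?_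
  · intro h i; simp
  · intro h i; exact Nat.cast_ne_zero.mpr (Nat.succ_ne_zero i)
  · intro _ i b
    have := hasseDeriv_comp (R := ℝ) 1 i
    have h2 := congrArg (fun F => F (f b)) this
    simp only [LinearMap.comp_apply, hasseDeriv_one, LinearMap.smul_apply] at h2
    simp only [derivative'_apply]
    rw [h2, add_comm 1 i]
    simp
  · intro p h0 hs i
    induction i with
    | zero => exact h0
    | succ e ih => exact hs () e ih
  · intro l hl
    obtain ⟨b, hb⟩ := Function.ne_iff.mp hl
    obtain ⟨x, hx⟩ : ∃ x, eval x (l b) ≠ 0 := by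
      by_contra! hcon
      exact hb (Polynomial.funext fun x => by simpa using hcon x)
    have hΦ : ∑ b, (eval x (l b)) • f b ≠ 0 := by
      intro h
      exact hx (Fintype.linearIndependent_iff.mp hf _ h b)
    obtain ⟨i, hi⟩ : ∃ i, (taylor x (∑ b, (eval x (l b)) • f b)).coeff i ≠ 0 := by
      by_contra! hcon
      exact hΦ (taylor_injective x (by ext i; simpa using hcon i))
    refine ⟨i, fun h => hi ?_⟩
    have := congrArg (eval x) h
    rw [taylor_coeff]
    simpa [eval_finsetSum] using this

end Polynomial

end Wronskian

namespace MvPolynomial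

section CoeffNorm

variable {σ : Type*}

/-- The sum of the absolute values of the coefficients. -/
noncomputable def l1 (P : MvPolynomial σ ℝ) : ℝ := ∑ i ∈ P.support, |coeff i P|

theorem l1_eq_sum {P : MvPolynomial σ ℝ} {s : Finset (σ →₀ ℕ)} (h : P.support ⊆ s) :
    l1 P = ∑ i ∈ s, |coeff i P| := by
  refine Finset.sum_subset h fun i _ hi => ?_
  rw [notMem_support_iff.mp hi, abs_zero]

theorem l1_nonneg (P : MvPolynomial σ ℝ) : 0 ≤ l1 P := Finset.sum_nonneg fun _ _ => abs_nonneg _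

theorem l1_zero : l1 (0 : MvPolynomial σ ℝ) = 0 := by simp [l1]

theorem l1_monomial_le (i : σ →₀ ℕ) (c : ℝ) : l1 (monomial i c) ≤ |c| := by
  classical
  rw [l1_eq_sum (support_monomial_subset (s := i) (a := c))]
  simp

theorem l1_add_le (P Q : MvPolynomial σ ℝ) : l1 (P + Q) ≤ l1 P + l1 Q := by
  classical
  rw [l1_eq_sum (support_add (p := P) (q := Q)), l1_eq_sum Finset.subset_union_left,
    l1_eq_sum (P := Q) Finset.subset_union_right, ← Finset.sum_add_distrib]
  exact Finset.sum_le_sum fun i _ => by rw [coeff_add]; exact abs_add_le _ _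

theorem l1_sum_le {ι : Type*} (s : Finset ι) (f : ι → MvPolynomial σ ℝ) :
    l1 (∑ a ∈ s, f a) ≤ ∑ a ∈ s, l1 (f a) :=
  Finset.le_sum_of_subadditive _ l1_zero.le l1_add_le s f

theorem l1_mul_le (P Q : MvPolynomial σ ℝ) : l1 (P * Q) ≤ l1 P * l1 Q := by
  have h : P * Q = ∑ i ∈ P.support, ∑ j ∈ Q.support, monomial (i + j) (coeff i P * coeff j Q) := by
    conv_lhs => rw [P.as_sum, Q.as_sum, Finset.sum_mul_sum]
    simp [monomial_mul]
  rw [h, show l1 P * l1 Q = ∑ i ∈ P.support, ∑ j ∈ Q.support, |coeff i P| * |coeff j Q| from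
    Finset.sum_mul_sum _ _ _ _]
  refine (l1_sum_le _ _).trans (Finset.sum_le_sum fun i _ => (l1_sum_le _ _).trans
    (Finset.sum_le_sum fun j _ => (l1_monomial_le _ _).trans (abs_mul _ _).le))

theorem l1_one_le : l1 (1 : MvPolynomial σ ℝ) ≤ 1 := by
  simpa using l1_monomial_le (0 : σ →₀ ℕ) 1

theorem l1_prod_le {ι : Type*} (s : Finset ι) (f : ι → MvPolynomial σ ℝ) :
    l1 (∏ a ∈ s, f a) ≤ ∏ a ∈ s, l1 (f a) := by
  classical
  induction s using Finset.induction_on with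
  | empty => simpa using l1_one_le
  | insert a s ha ih =>
    rw [Finset.prod_insert ha, Finset.prod_insert ha]
    exact (l1_mul_le _ _).trans (mul_le_mul_of_nonneg_left ih (l1_nonneg _))

theorem l1_pow_le (P : MvPolynomial σ ℝ) (m : ℕ) : l1 (P ^ m) ≤ l1 P ^ m := by
  simpa using l1_prod_le (Finset.range m) (fun _ => P)

theorem l1_neg (P : MvPolynomial σ ℝ) : l1 (-P) = l1 P := by
  simp [l1, support_neg]

theorem l1_det_le {s : ℕ} (M : Matrix (Fin s) (Fin s) (MvPolynomial σ ℝ)) {B : ℝ}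
    (hB : ∀ i j, l1 (M i j) ≤ B) : l1 M.det ≤ s.factorial * B ^ s := by
  rw [Matrix.det_apply]
  refine (l1_sum_le _ _).trans ?_
  have : ∀ g ∈ (Finset.univ : Finset (Equiv.Perm (Fin s))),
      l1 (Equiv.Perm.sign g • ∏ i, M (g i) i) ≤ B ^ s := by
    intro g _
    have h1 : l1 (Equiv.Perm.sign g • ∏ i, M (g i) i) = l1 (∏ i, M (g i) i) := by
      rcases Int.units_eq_one_or (Equiv.Perm.sign g) with h | h <;> rw [h] <;> simp [l1_neg]
    rw [h1]
    refine (l1_prod_le _ _).trans ?_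
    refine (Finset.prod_le_prod (fun _ _ => l1_nonneg _) fun i _ => hB _ _).trans ?_
    simp
  refine (Finset.sum_le_card_nsmul _ _ _ this).trans ?_
  simp [Finset.card_univ, Fintype.card_perm]

theorem abs_coeff_le_l1 (P : MvPolynomial σ ℝ) (i : σ →₀ ℕ) : |coeff i P| ≤ l1 P := by
  by_cases h : i ∈ P.support
  · exact Finset.single_le_sum (f := fun i => |coeff i P|) (fun _ _ => abs_nonneg _) h
  · rw [notMem_support_iff.mp h, abs_zero]; exact l1_nonneg _

theorem one_le_l1_map {P : MvPolynomial σ ℤ} (hP : P ≠ 0) :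
    1 ≤ l1 (map (Int.castRingHom ℝ) P) := by
  obtain ⟨i, hi⟩ := ne_zero_iff.mp hP
  refine le_trans ?_ (abs_coeff_le_l1 _ i)
  rw [coeff_map, eq_intCast]
  exact_mod_cast Int.one_le_abs hi

theorem abs_eval_le_l1 [Fintype σ] (P : MvPolynomial σ ℝ) (x : σ → ℝ) {B : ℝ}
    (h : ∀ i, coeff i P ≠ 0 → ∏ a, |x a| ^ (i a) ≤ B) : |eval x P| ≤ l1 P * B := by
  rw [eval_eq', l1, Finset.sum_mul]
  refine (Finset.abs_sum_le_sum_abs _ _).trans (Finset.sum_le_sum fun i hi => ?_)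
  rw [abs_mul, Finset.abs_prod]
  refine mul_le_mul_of_nonneg_left ?_ (abs_nonneg _)
  simpa [abs_pow] using h i (mem_support_iff.mp hi)

variable {n : ℕ}

theorem l1_map_le {τ : Type*} (F : MvPolynomial σ ℝ →ₗ[ℝ] MvPolynomial τ ℝ) {B : ℝ}
    (P : MvPolynomial σ ℝ) (h : ∀ i ∈ P.support, l1 (F (monomial i (coeff i P))) ≤
        B * |coeff i P|) :
    l1 (F P) ≤ B * l1 P := by
  conv_lhs => rw [P.as_sum, map_sum]
  rw [l1.eq_1 P, Finset.mul_sum]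
  exact (l1_sum_le _ _).trans (Finset.sum_le_sum h)

theorem l1_hasse_le {r : Fin n → ℕ} (e : Fin n →₀ ℕ) {P : MvPolynomial (Fin n) ℝ}
    (h : ∀ a, degreeOf a P ≤ r a) : l1 (hasse e P) ≤ 2 ^ (∑ a, r a) * l1 P := by
  refine l1_map_le (hasse e) P fun i hi => ?_
  rw [hasse_monomial]
  refine (l1_monomial_le _ _).trans ?_
  rw [abs_mul, Nat.abs_cast]
  refine mul_le_mul_of_nonneg_right ?_ (abs_nonneg _)
  exact_mod_cast multiChoose_le fun a => (monomial_le_degreeOf a hi).trans (h a)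

theorem l1_shift_le {r : Fin n → ℕ} (b : Fin n → ℝ) {P : MvPolynomial (Fin n) ℝ}
    (h : ∀ a, degreeOf a P ≤ r a) : l1 (shift b P) ≤ (∏ a, (1 + |b a|) ^ r a) * l1 P := by
  refine l1_map_le (shift b).toLinearMap P fun i hi => ?_
  rw [AlgHom.toLinearMap_apply, shift, aeval_monomial, mul_comm, Finsupp.prod_fintype _ _ (by simp)]
  refine (l1_mul_le _ _).trans (mul_le_mul ?_ ?_ (l1_nonneg _) (by positivity))
  · refine (l1_prod_le _ _).trans (Finset.prod_le_prod (fun _ _ => l1_nonneg _) fun a _ => ?_)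
    refine (l1_pow_le _ _).trans ?_
    have h1 : l1 (X a + C (b a) : MvPolynomial (Fin n) ℝ) ≤ 1 + |b a| :=
      (l1_add_le _ _).trans (add_le_add (by simpa [X] using l1_monomial_le (Finsupp.single a 1) 1)
        (l1_monomial_le 0 (b a)))
    refine (pow_le_pow_left₀ (l1_nonneg _) h1 _).trans ?_
    exact pow_le_pow_right₀ (by linarith [abs_nonneg (b a)])
      ((monomial_le_degreeOf a hi).trans (h a))
  · exact l1_monomial_le 0 _

end CoeffNorm

section Order

variable {σ : Type*} [Fintype σ]

/-- Every monomial of `Q` has weight at least `θ` with respect to `w`. -/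
def HasOrder (w : σ → ℝ) (θ : ℝ) (Q : MvPolynomial σ ℝ) : Prop :=
  ∀ i, coeff i Q ≠ 0 → θ ≤ ∑ h, w h * i h

variable {w : σ → ℝ} {θ θ' : ℝ} {P Q : MvPolynomial σ ℝ}

theorem HasOrder.mono (h : HasOrder w θ P) (hle : θ' ≤ θ) : HasOrder w θ' P :=
  fun i hi => hle.trans (h i hi)

theorem hasOrder_zero_right (hw : ∀ h, 0 ≤ w h) : HasOrder w 0 P :=
  fun _ _ => Finset.sum_nonneg fun h _ => mul_nonneg (hw h) (Nat.cast_nonneg _)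

theorem HasOrder.zero : HasOrder w θ 0 := fun _ hi => by simp at hi

theorem HasOrder.add (hP : HasOrder w θ P) (hQ : HasOrder w θ Q) : HasOrder w θ (P + Q) := by
  intro i hi
  by_cases h : coeff i P = 0
  · exact hQ i fun h' => hi (by simp [h, h'])
  · exact hP i h

theorem HasOrder.sum {ι : Type*} (s : Finset ι) (f : ι → MvPolynomial σ ℝ)
    (hf : ∀ a ∈ s, HasOrder w θ (f a)) : HasOrder w θ (∑ a ∈ s, f a) :=
  Finset.sum_induction _ _ (fun _ _ => HasOrder.add) HasOrder.zero hf

theorem HasOrder.mul (hP : HasOrder w θ P) (hQ : HasOrder w θ' Q) :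
    HasOrder w (θ + θ') (P * Q) := by
  classical
  intro i hi
  rw [coeff_mul] at hi
  obtain ⟨x, hx, hne⟩ := Finset.exists_ne_zero_of_sum_ne_zero hi
  have hx := Finset.HasAntidiagonal.mem_antidiagonal.mp hx
  have h1 := hP _ (left_ne_zero_of_mul hne)
  have h2 := hQ _ (right_ne_zero_of_mul hne)
  rw [← hx]
  simp only [Finsupp.add_apply, Nat.cast_add, mul_add, Finset.sum_add_distrib]
  exact add_le_add h1 h2

theorem HasOrder.prod {ι : Type*} (s : Finset ι) (f : ι → MvPolynomial σ ℝ) (t : ι → ℝ)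
    (hf : ∀ a ∈ s, HasOrder w (t a) (f a)) : HasOrder w (∑ a ∈ s, t a) (∏ a ∈ s, f a) := by
  classical
  induction s using Finset.induction_on with
  | empty =>
    intro i hi
    rw [Finset.prod_empty, coeff_one] at hi
    have : i = 0 := by by_contra h; exact hi (if_neg (Ne.symm h))
    simp [this]
  | insert a s ha ih =>
    rw [Finset.sum_insert ha, Finset.prod_insert ha]
    exact (hf a (Finset.mem_insert_self _ _)).mul
      (ih fun b hb => hf b (Finset.mem_insert_of_mem hb))

theorem HasOrder.det {s : ℕ} (M : Matrix (Fin s) (Fin s) (MvPolynomial σ ℝ)) (t : Fin s → ℝ)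
    (h : ∀ i j, HasOrder w (t j) (M i j)) : HasOrder w (∑ j, t j) M.det := by
  rw [Matrix.det_apply]
  refine HasOrder.sum _ _ fun g _ => ?_
  have h1 : HasOrder w (∑ j, t j) (∏ i, M (g i) i) := HasOrder.prod _ _ _ fun i _ => h _ _
  rcases Int.units_eq_one_or (Equiv.Perm.sign g) with hg | hg <;> rw [hg]
  · simpa using h1
  · intro i hi
    exact h1 i (by simpa using hi)

theorem HasOrder.hasse {n : ℕ} {w : Fin n → ℝ} {θ : ℝ} {P : MvPolynomial (Fin n) ℝ}
    (h : HasOrder w θ P) (e : Fin n →₀ ℕ) :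
    HasOrder w (θ - ∑ a, w a * e a) (hasse e P) := by
  intro i hi
  rw [coeff_hasse] at hi
  have := h _ (right_ne_zero_of_mul hi)
  simp only [Finsupp.add_apply, Nat.cast_add, mul_add, Finset.sum_add_distrib] at this
  linarith

end Order

section Split

variable {n : ℕ}

/-- The product of a polynomial in the last `n` variables and one in the first variable. -/
noncomputable def tensor (U : MvPolynomial (Fin n) ℝ) (W : Polynomial ℝ) :
    MvPolynomial (Fin (n + 1)) ℝ :=
  rename Fin.succ U * Polynomial.aeval (X 0) W

theorem coeff_tensor (U : MvPolynomial (Fin n) ℝ) (W : Polynomial ℝ) (j : ℕ) (i : Fin n →₀ ℕ) :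
    coeff (i.cons j) (tensor U W) = coeff i U * W.coeff j := by
  rw [← finSuccEquiv_coeff_coeff, tensor, map_mul]
  have h1 : finSuccEquiv ℝ n (rename Fin.succ U) = Polynomial.C U := by
    induction U using MvPolynomial.induction_on with
    | C a => simp [finSuccEquiv_apply]
    | add p q hp hq => rw [map_add, map_add, hp, hq, map_add]
    | mul_X p i hp => rw [map_mul, map_mul, hp, rename_X, finSuccEquiv_X_succ, map_mul]
  have h2 : finSuccEquiv ℝ n (Polynomial.aeval (X 0) W) = W.map C := by
    rw [← AlgEquiv.coe_toAlgHom, ← Polynomial.aeval_algHom_apply, AlgEquiv.coe_toAlgHom,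
      finSuccEquiv_X_zero, Polynomial.aeval_X_left_eq_map, algebraMap_eq]
  rw [h1, h2, Polynomial.coeff_C_mul, Polynomial.coeff_map, mul_comm, coeff_C_mul, mul_comm]

theorem hasse_tensor (U : MvPolynomial (Fin n) ℝ) (W : Polynomial ℝ) (e : ℕ) (d : Fin n →₀ ℕ) :
    hasse (d.cons e) (tensor U W) = tensor (hasse d U) (Polynomial.hasseDeriv e W) := by
  ext m
  obtain ⟨j, i, rfl⟩ : ∃ j, ∃ i : Fin n →₀ ℕ, m = i.cons j :=
      ⟨m 0, m.tail, (Finsupp.cons_tail m).symm⟩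
  have h1 : i.cons j + d.cons e = (i + d).cons (j + e) := by
    ext a; refine Fin.cases ?_ (fun a => ?_) a <;> simp
  have h2 : multiChoose ((i + d).cons (j + e)) (d.cons e) =
      (j + e).choose e * multiChoose (i + d) d := by
    simp [multiChoose, Fin.prod_univ_succ]
  rw [coeff_hasse, h1, h2, coeff_tensor, coeff_tensor, coeff_hasse, Polynomial.hasseDeriv_coeff]
  push_cast
  ring

theorem shift_tensor (U : MvPolynomial (Fin n) ℝ) (W : Polynomial ℝ) (b : Fin (n + 1) → ℝ) :
    shift b (tensor U W) = tensor (shift (fun h => b h.succ) U)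
        (W.comp (Polynomial.X + Polynomial.C (b 0))) := by
  have h1 : (shift b).comp (rename Fin.succ) =
      (rename (R := ℝ) Fin.succ).comp (shift fun h => b h.succ) := by
    ext a; simp [shift]
  have h2 : shift b (Polynomial.aeval (X 0) W) =
      Polynomial.aeval (X 0) (W.comp (Polynomial.X + Polynomial.C (b 0))) := by
    rw [Polynomial.aeval_comp, ← Polynomial.aeval_algHom_apply]
    simp [shift, algebraMap_eq]
  rw [tensor, map_mul, h2, tensor]
  congr 1
  exact DFunLike.congr_fun h1 U

theorem tensor_ne_zero {U : MvPolynomial (Fin n) ℝ} {W : Polynomial ℝ} (hU : U ≠ 0) (hW : W ≠ 0) :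
    tensor U W ≠ 0 := by
  obtain ⟨i, hi⟩ := ne_zero_iff.mp hU
  obtain ⟨j, hj⟩ := Polynomial.support_nonempty.mpr hW
  rw [Polynomial.mem_support_iff] at hj
  exact ne_zero_iff.mpr ⟨i.cons j, by rw [coeff_tensor]; exact mul_ne_zero hi hj⟩

theorem det_sum_tensor {s : ℕ} (A : Matrix (Fin s) (Fin s) (MvPolynomial (Fin n) ℝ))
    (B : Matrix (Fin s) (Fin s) (Polynomial ℝ)) :
    (Matrix.of fun i j => ∑ b, tensor (A i b) (B j b)).det = tensor A.det B.det := by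
  have : (Matrix.of fun i j => ∑ b, tensor (A i b) (B j b)) =
      (rename (R := ℝ) Fin.succ).toRingHom.mapMatrix A *
        ((Polynomial.aeval (R := ℝ) (X (R := ℝ) (0 : Fin (n + 1)))).toRingHom.mapMatrix
            B).transpose := by
    ext1 i j
    simp [Matrix.mul_apply, tensor]
  rw [this, Matrix.det_mul, Matrix.det_transpose, ← RingHom.map_det, ← RingHom.map_det]
  rfl

/-- A polynomial is a sum of products of functions of the last variables and of the first one,
both families being linearly independent. -/
theorem exists_eq_sum_tensor (P : MvPolynomial (Fin (n + 1)) ℝ) {r : ℕ} (h : degreeOf 0 P ≤ r) :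
    ∃ s ≤ r + 1, ∃ (f : Fin s → MvPolynomial (Fin n) ℝ) (g : Fin s → Polynomial ℝ),
      LinearIndependent ℝ f ∧ LinearIndependent ℝ g ∧ P = ∑ b, tensor (f b) (g b) := by
  let c : Fin (r + 1) → MvPolynomial (Fin n) ℝ := fun t => (finSuccEquiv ℝ n P).coeff t
  let S := Submodule.span ℝ (Set.range c)
  have hfin : FiniteDimensional ℝ S := FiniteDimensional.span_of_finite ℝ (Set.finite_range c)
  let B := Module.finBasis ℝ S
  let cS : Fin (r + 1) → S := fun t => ⟨c t, Submodule.subset_span ⟨t, rfl⟩⟩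
  refine ⟨Module.finrank ℝ S, by
      simpa [Set.finrank] using finrank_range_le_card (R := ℝ) c, fun b => (B b : S),
    fun b => ∑ t : Fin (r + 1), Polynomial.monomial (t : ℕ) (B.repr (cS t) b), ?_, ?_, ?_⟩
  · exact B.linearIndependent.map' S.subtype (Submodule.ker_subtype S)
  · rw [Fintype.linearIndependent_iff]
    intro l hl
    let F : S →ₗ[ℝ] ℝ := B.constr ℝ l
    have hF : ∀ t, F (cS t) = 0 := by
      intro t
      have h1 := congrArg (fun p => Polynomial.coeff p (t : ℕ)) hl
      simp only [Polynomial.finsetSum_coeff, Polynomial.coeff_smul, Polynomial.coeff_monomial,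
        Polynomial.coeff_zero, Fin.val_inj, Finset.sum_ite_eq', Finset.mem_univ, if_true] at h1
      rw [Module.Basis.constr_apply_fintype]
      simpa [mul_comm] using h1
    have hspan : F = 0 := by
      ext ⟨x, hx⟩
      induction hx using Submodule.span_induction with
      | mem x hx => obtain ⟨t, rfl⟩ := hx; exact hF t
      | zero => exact map_zero F
      | add x y hx hy h1 h2 =>
        have := map_add F ⟨x, hx⟩ ⟨y, hy⟩
        rw [h1, h2] at this; simpa using this
      | smul a x hx h1 =>
        have := map_smul F a ⟨x, hx⟩
        rw [h1] at this; simpa using this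
    intro b
    have := B.constr_basis ℝ l b
    rw [show B.constr ℝ l = 0 from hspan] at this
    simpa using this.symm
  · ext m
    obtain ⟨j, i, rfl⟩ : ∃ j, ∃ i : Fin n →₀ ℕ, m = i.cons j :=
        ⟨m 0, m.tail, (Finsupp.cons_tail m).symm⟩
    rw [coeff_sum, ← finSuccEquiv_coeff_coeff]
    simp only [coeff_tensor, Polynomial.finsetSum_coeff, Polynomial.coeff_monomial]
    by_cases hj : j < r + 1
    · have h1 := congrArg (fun x : S => coeff i (x : MvPolynomial (Fin n) ℝ))
          (B.sum_repr (cS ⟨j, hj⟩))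
      simp only [AddSubmonoidClass.coe_finsetSum, SetLike.val_smul, coeff_sum, coeff_smul] at h1
      rw [show coeff i ((finSuccEquiv ℝ n P).coeff j) =
          coeff i (cS ⟨j, hj⟩ : MvPolynomial (Fin n) ℝ) from rfl, ← h1]
      refine Finset.sum_congr rfl fun b _ => ?_
      rw [Finset.sum_eq_single_of_mem (⟨j, hj⟩ : Fin (r + 1)) (Finset.mem_univ _)]
      · rw [if_pos rfl, smul_eq_mul]
        exact mul_comm _ _
      · intro t _ ht
        exact if_neg fun h' => ht (Fin.ext h')
    · rw [Polynomial.coeff_eq_zero_of_natDegree_lt, coeff_zero]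
      · symm
        refine Finset.sum_eq_zero fun b _ => ?_
        rw [Finset.sum_eq_zero, mul_zero]
        intro t _
        rw [if_neg]; have := t.2; omega
      · rw [natDegree_finSuccEquiv]; omega

end Split
end MvPolynomial

namespace Polynomial

/-- Gauss's lemma: a rational root of multiplicity `e` of an integer polynomial forces the `e`-th
power of its denominator to divide the leading coefficient. -/
theorem exists_taylor_coeff_ne_zero_and_den_pow_le {W : ℤ[X]} (hW : W ≠ 0) (β : ℚ) :
    ∃ e, ((W.map (Int.castRingHom ℝ)).comp (X + C (β : ℝ))).coeff e ≠ 0 ∧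
      (β.den : ℝ) ^ e ≤ |(W.leadingCoeff : ℝ)| := by
  have hW0 : W.map (Int.castRingHom ℚ) ≠ 0 :=
    (Polynomial.map_ne_zero_iff (RingHom.injective_int _)).mpr hW
  obtain ⟨Q, hQ, hnd⟩ := exists_eq_pow_rootMultiplicity_mul_and_not_dvd _ hW0 β
  generalize rootMultiplicity β (W.map (Int.castRingHom ℚ)) = e at hQ
  refine ⟨e, ?_, ?_⟩
  · have h1 : W.map (Int.castRingHom ℝ) =
        (W.map (Int.castRingHom ℚ)).map (algebraMap ℚ ℝ) := by
      rw [Polynomial.map_map]; congr 1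
    rw [h1, hQ, Polynomial.map_mul, mul_comp, Polynomial.map_pow, pow_comp]
    simp only [Polynomial.map_sub, map_X, map_C, sub_comp, X_comp, C_comp]
    rw [show (X + C (β : ℝ) - C ((algebraMap ℚ ℝ) β) : ℝ[X]) = X by simp, coeff_X_pow_mul',
      if_pos le_rfl, Nat.sub_self, coeff_zero_eq_eval_zero, eval_comp]
    simp only [eval_add, eval_X, eval_C, zero_add]
    rw [show (β : ℝ) = algebraMap ℚ ℝ β from rfl, eval_map_algebraMap, aeval_algebraMap_apply]
    simp only [coe_aeval_eq_eval, eq_ratCast, ne_eq, Rat.cast_eq_zero]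
    rwa [dvd_iff_isRoot, IsRoot.def] at hnd
  · set L : ℤ[X] := C (β.den : ℤ) * X - C β.num with hL
    have hLprim : L.IsPrimitive := by
      rw [isPrimitive_iff_isUnit_of_C_dvd]
      intro r hr
      rw [C_dvd_iff_dvd_coeff] at hr
      have h0 := hr 0
      have h1 := hr 1
      simp only [hL, coeff_sub, mul_coeff_zero, coeff_X_zero, mul_zero, coeff_C_zero, zero_sub,
        dvd_neg] at h0
      simp only [hL, coeff_sub, coeff_C_mul, coeff_X_one, mul_one, coeff_C_succ, sub_zero] at h1
      have hc := β.reduced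
      have hc' : IsCoprime β.num (β.den : ℤ) := by
        rw [Int.isCoprime_iff_gcd_eq_one]; simpa [Int.gcd] using hc
      exact hc'.isUnit_of_dvd' h0 h1
    have hmap : (L ^ e).map (Int.castRingHom ℚ) = C ((β.den : ℚ) ^ e) * (X - C β) ^ e := by
      have hb : (β.den : ℚ) ≠ 0 := by exact_mod_cast β.den_nz
      have : L.map (Int.castRingHom ℚ) = C (β.den : ℚ) * (X - C β) := by
        rw [hL, Polynomial.map_sub, Polynomial.map_mul, map_C, map_C, map_X, mul_sub, ← C_mul,
          eq_intCast, eq_intCast, Int.cast_natCast, mul_comm (β.den : ℚ) β, Rat.mul_den_eq_num]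
      rw [Polynomial.map_pow, this, mul_pow, C_pow]
    have hLe : (L ^ e).IsPrimitive := by
      clear hmap hQ
      induction e with
      | zero => rw [pow_zero]; exact isPrimitive_one
      | succ m ih => rw [pow_succ]; exact ih.mul hLprim
    have hdiv : L ^ e ∣ W := by
      refine Dvd.dvd.trans ?_ (Dvd.intro_left _ W.eq_C_content_mul_primPart.symm)
      rw [IsPrimitive.Int.dvd_iff_map_cast_dvd_map_cast _ _ hLe,
        hmap]
      have h2 : W.map (Int.castRingHom ℚ) =
          C (W.content : ℚ) * W.primPart.map (Int.castRingHom ℚ) := by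
        conv_lhs => rw [W.eq_C_content_mul_primPart, Polynomial.map_mul, map_C]
        simp
      have hcont : (W.content : ℚ) ≠ 0 := by
        exact_mod_cast fun h => hW (content_eq_zero_iff.mp h)
      have hb : IsUnit (C ((β.den : ℚ) ^ e)) := by
        rw [isUnit_C]; exact (isUnit_iff_ne_zero.mpr (by exact_mod_cast β.den_nz)).pow e
      rw [hb.mul_left_dvd]
      have hc : IsUnit (C (W.content : ℚ)) := isUnit_C.mpr (isUnit_iff_ne_zero.mpr hcont)
      rw [← hc.dvd_mul_left, ← h2, hQ]
      exact Dvd.intro _ rfl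
    obtain ⟨M, hM⟩ := hdiv
    have hlead : W.leadingCoeff = (β.den : ℤ) ^ e * M.leadingCoeff := by
      rw [hM, leadingCoeff_mul, leadingCoeff_pow]
      congr 2
      have : L.natDegree = 1 := by
        rw [hL, sub_eq_add_neg, ← C_neg]
        exact natDegree_linear (by exact_mod_cast β.den_nz)
      rw [leadingCoeff, this, hL, coeff_sub, coeff_C_mul, coeff_X_one, coeff_C_succ, mul_one,
        sub_zero]
    have hne : M.leadingCoeff ≠ 0 := by
      intro h
      rw [h, mul_zero, leadingCoeff_eq_zero] at hlead
      exact hW hlead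
    rw [hlead]
    push_cast
    rw [abs_mul, abs_of_nonneg (by positivity : (0 : ℝ) ≤ (β.den : ℝ) ^ e)]
    refine le_mul_of_one_le_right (by positivity) ?_
    exact_mod_cast Int.one_le_abs hne

end Polynomial

namespace MvPolynomial

variable {n : ℕ}

theorem degreeOf_det_le {σ R : Type*} [CommRing R] {s m : ℕ} (a : σ)
    (M : Matrix (Fin s) (Fin s) (MvPolynomial σ R)) (h : ∀ i j, degreeOf a (M i j) ≤ m) :
    degreeOf a M.det ≤ s * m := by
  rw [Matrix.det_apply]
  refine (degreeOf_sum_le _ _ _).trans (Finset.sup_le fun g _ => ?_)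
  have h1 : degreeOf a (∏ i, M (g i) i) ≤ s * m := by
    refine (degreeOf_prod_le _ _ _).trans
        ((Finset.sum_le_card_nsmul _ _ m fun i _ => h _ _).trans ?_)
    simp
  rcases Int.units_eq_one_or (Equiv.Perm.sign g) with hg | hg <;> rw [hg]
  · simpa using h1
  · simpa [degreeOf_neg] using h1

theorem exists_det_hasse_eq_tensor {P : MvPolynomial (Fin (n + 1)) ℝ} (hP : P ≠ 0) {r : ℕ}
    (h : degreeOf 0 P ≤ r) :
    ∃ s, 0 < s ∧ s ≤ r + 1 ∧ ∃ (d : Fin s → Fin n →₀ ℕ) (e : Fin s → ℕ)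
      (U : MvPolynomial (Fin n) ℝ) (W : Polynomial ℝ), (∀ a, (d a).degree < s) ∧ (∀ a, e a < s) ∧
      Function.Injective e ∧ U ≠ 0 ∧ W ≠ 0 ∧
      (Matrix.of fun i j => hasse ((d i).cons (e j)) P).det = tensor U W := by
  obtain ⟨s, hs, f, g, hf, hg, hfg⟩ := exists_eq_sum_tensor P h
  obtain ⟨d, hd, hdet⟩ := exists_det_hasse_ne_zero f hf
  obtain ⟨e, he, hdet'⟩ := Polynomial.exists_det_hasseDeriv_ne_zero g hg
  refine ⟨s, ?_, hs, d, e, _, _, hd, he, ?_, hdet, hdet', ?_⟩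
  · rcases Nat.eq_zero_or_pos s with rfl | h
    · simp at hfg; exact absurd hfg hP
    · exact h
  · intro i j hij
    by_contra hne
    exact hdet' (Matrix.det_zero_of_row_eq hne (by ext1 b; simp [hij]))
  · rw [← det_sum_tensor]
    congr 1
    ext1 i j
    simp only [Matrix.of_apply]
    conv_lhs => rw [hfg, map_sum]
    exact Finset.sum_congr rfl fun b _ => hasse_tensor _ _ _ _

theorem exists_int_left_factor {V : MvPolynomial (Fin (n + 1)) ℤ} {U : MvPolynomial (Fin n) ℝ}
    {W : Polynomial ℝ} (hU : U ≠ 0) (hW : W ≠ 0) (h : map (Int.castRingHom ℝ) V = tensor U W) :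
    ∃ U' : MvPolynomial (Fin n) ℤ, U' ≠ 0 ∧ (∃ c : ℝ, map (Int.castRingHom ℝ) U' = c • U) ∧
      l1 (map (Int.castRingHom ℝ) U') ≤ l1 (map (Int.castRingHom ℝ) V) ∧
      ∀ a, degreeOf a U' ≤ degreeOf a.succ V := by
  obtain ⟨t, ht⟩ := Polynomial.support_nonempty.mpr hW
  rw [Polynomial.mem_support_iff] at ht
  have hco : ∀ i, coeff i (map (Int.castRingHom ℝ) ((finSuccEquiv ℤ n V).coeff t)) =
      coeff (i.cons t) (map (Int.castRingHom ℝ) V) := fun i => by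
    rw [coeff_map, finSuccEquiv_coeff_coeff, coeff_map]
  have heq : map (Int.castRingHom ℝ) ((finSuccEquiv ℤ n V).coeff t) = W.coeff t • U := by
    ext i
    rw [hco, h, coeff_tensor, coeff_smul, smul_eq_mul, mul_comm]
  refine ⟨(finSuccEquiv ℤ n V).coeff t, ?_, ⟨_, heq⟩, ?_,
      fun a => degreeOf_coeff_finSuccEquiv _ _ _⟩
  · intro h0
    rw [h0, map_zero] at heq
    exact (smul_ne_zero ht hU) heq.symm
  · rw [l1]
    simp only [hco]
    rw [← Finset.sum_image (f := fun m => |coeff m (map (Int.castRingHom ℝ) V)|)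
      (g := fun i : Fin n →₀ ℕ => i.cons t) (fun a _ b _ hab => Finsupp.cons_right_injective t hab)]
    refine Finset.sum_le_sum_of_subset_of_nonneg ?_ fun _ _ _ => abs_nonneg _
    intro m hm
    obtain ⟨i, hi, rfl⟩ := Finset.mem_image.mp hm
    rw [mem_support_iff, ← hco]
    exact mem_support_iff.mp hi

theorem exists_int_right_factor {V : MvPolynomial (Fin (n + 1)) ℤ} {U : MvPolynomial (Fin n) ℝ}
    {W : Polynomial ℝ} (hU : U ≠ 0) (hW : W ≠ 0) (h : map (Int.castRingHom ℝ) V = tensor U W) :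
    ∃ W' : Polynomial ℤ, W' ≠ 0 ∧ (∃ c : ℝ, W'.map (Int.castRingHom ℝ) = c • W) ∧
      |(W'.leadingCoeff : ℝ)| ≤ l1 (map (Int.castRingHom ℝ) V) := by
  obtain ⟨i, hi⟩ := ne_zero_iff.mp hU
  let W' : Polynomial ℤ :=
    ∑ t ∈ Finset.range (W.natDegree + 1), Polynomial.monomial t (coeff (i.cons t) V)
  have hc : ∀ t, ((coeff (i.cons t) V : ℤ) : ℝ) = coeff i U * W.coeff t := fun t => by
    rw [← coeff_tensor, ← h, coeff_map]; simp
  have hco : ∀ t, W'.coeff t = if t < W.natDegree + 1 then coeff (i.cons t) V else 0 := by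
    intro t
    simp [W', Polynomial.finsetSum_coeff, Polynomial.coeff_monomial]
  have heq : W'.map (Int.castRingHom ℝ) = coeff i U • W := by
    ext t
    rw [Polynomial.coeff_map, hco, Polynomial.coeff_smul, smul_eq_mul, eq_intCast]
    split_ifs with ht
    · exact hc t
    · rw [Polynomial.coeff_eq_zero_of_natDegree_lt (by omega)]; simp
  refine ⟨W', ?_, ⟨_, heq⟩, ?_⟩
  · intro h0
    rw [h0, Polynomial.map_zero] at heq
    exact smul_ne_zero hi hW heq.symm
  · rw [Polynomial.leadingCoeff, hco]
    split_ifs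
    · have := abs_coeff_le_l1 (map (Int.castRingHom ℝ) V) (i.cons W'.natDegree)
      rwa [coeff_map, eq_intCast] at this
    · simpa using l1_nonneg _

end MvPolynomial

theorem sum_max_sub_div_ge {s r : ℕ} {e : Fin s → ℕ} (he : ∀ a, e a < s)
    (hinj : Function.Injective e) (hs : 0 < s) (hr : 0 < r) (hsr : s ≤ r + 1) {c : ℝ} (hc : 0 < c)
    (hc1 : c ≤ 1) : s * (c ^ 2 / 8) ≤ ∑ a, max (c - e a / r) 0 := by
  have h1 : ∑ a, max (c - e a / r) 0 = ∑ j ∈ Finset.range s, max (c - (j : ℝ) / r) 0 := by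
    have himg : Finset.univ.image e = Finset.range s := by
      refine Finset.eq_of_subset_of_card_le (fun j hj => ?_) ?_
      · obtain ⟨a, _, rfl⟩ := Finset.mem_image.mp hj
        exact Finset.mem_range.mpr (he a)
      · rw [Finset.card_image_of_injective _ hinj]; simp
    rw [← himg, Finset.sum_image fun a _ b _ hab => hinj hab]
  rw [h1]
  have hs1 : (1 : ℝ) ≤ s := by exact_mod_cast hs
  have hr0 : (0 : ℝ) < r := by exact_mod_cast hr
  have hsr' : (s : ℝ) ≤ r + 1 := by exact_mod_cast hsr
  set m := ⌊c * (s - 1) / 2⌋₊ + 1 with hm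
  have hnn : 0 ≤ c * (s - 1) / 2 := by
    have : 0 ≤ (s : ℝ) - 1 := by linarith
    positivity
  have hfl := Nat.floor_le hnn
  have hfl2 := Nat.lt_floor_add_one (c * (s - 1) / 2)
  have hms : m ≤ s := by
    have : (⌊c * (s - 1) / 2⌋₊ : ℝ) < s := by
      refine hfl.trans_lt ?_
      nlinarith
    have : ⌊c * (s - 1) / 2⌋₊ < s := by exact_mod_cast this
    omega
  have hmc : (m : ℝ) = ⌊c * (s - 1) / 2⌋₊ + 1 := by rw [hm]; push_cast; ring
  have hm1 : c * s / 4 ≤ m := by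
    have : (0 : ℝ) ≤ ⌊c * (s - 1) / 2⌋₊ := Nat.cast_nonneg _
    rw [hmc]; nlinarith
  calc s * (c ^ 2 / 8) = (c * s / 4) * (c / 2) := by ring
    _ ≤ m * (c / 2) := by gcongr
    _ = ∑ j ∈ Finset.range m, c / 2 := by simp
    _ ≤ ∑ j ∈ Finset.range m, max (c - (j : ℝ) / r) 0 := by
        refine Finset.sum_le_sum fun j hj => le_max_of_le_left ?_
        have hj' : (j : ℝ) ≤ ⌊c * (s - 1) / 2⌋₊ := by
          have := Finset.mem_range.mp hj
          exact_mod_cast (by omega : j ≤ ⌊c * (s - 1) / 2⌋₊)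
        have : (j : ℝ) / r ≤ c / 2 := by
          rw [div_le_iff₀ hr0]
          nlinarith
        linarith
    _ ≤ _ := Finset.sum_le_sum_of_subset_of_nonneg (Finset.range_mono hms)
        fun _ _ _ => le_max_right _ _

namespace MvPolynomial

theorem roth_index_zero {r : Fin 0 → ℕ} (b : Fin 0 → ℝ) {P : MvPolynomial (Fin 0) ℝ} (hP : P ≠ 0)
    {ε : ℝ} (hε : 0 < ε) : ∃ i, coeff i (shift b P) ≠ 0 ∧ ∑ h, (1 / (r h : ℝ)) * i h ≤ ε := by
  obtain ⟨i, hi⟩ := ne_zero_iff.mp (shift_ne_zero b hP)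
  exact ⟨i, hi, by simpa using hε.le⟩

/-- The logarithmic size of a determinant of derivatives of an integer polynomial. -/
theorem log_l1_det_hasse_le {n s : ℕ} {r : Fin (n + 1) → ℕ} {P : MvPolynomial (Fin (n + 1)) ℝ}
    {ρ : ℝ} (hdeg : ∀ h, degreeOf h P ≤ r h) (hρ : ∀ h, (r h : ℝ) ≤ ρ) (hs : 0 < s)
    (hsr : s ≤ r 0 + 1) (hP : 1 ≤ l1 P) (E : Fin s → Fin s → (Fin (n + 1) →₀ ℕ))
    (hV : 1 ≤ l1 (Matrix.of fun i j => hasse (E i j) P).det) :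
    Real.log (l1 (Matrix.of fun i j => hasse (E i j) P).det) ≤
      s * ((n + 2) * (Real.log (l1 P) + ρ)) := by
  have h1 := l1_det_le (Matrix.of fun i j => hasse (E i j) P)
    (B := 2 ^ (∑ a, r a) * l1 P) (fun i j => l1_hasse_le _ hdeg)
  have hs0 : (0 : ℝ) < s := by exact_mod_cast hs
  have h2 := Real.log_le_log (by linarith) h1
  have hlogP : 0 ≤ Real.log (l1 P) := Real.log_nonneg hP
  have hr0 : (s : ℝ) ≤ r 0 + 1 := by exact_mod_cast hsr
  have hfac : Real.log (s.factorial : ℝ) ≤ s * ρ := by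
    have : (s.factorial : ℝ) ≤ (s : ℝ) ^ s := by exact_mod_cast Nat.factorial_le_pow s
    refine (Real.log_le_log (by positivity) this).trans ?_
    rw [Real.log_pow]
    gcongr
    have := Real.log_le_sub_one_of_pos hs0
    linarith [hρ 0]
  have hsum : ((∑ a, r a : ℕ) : ℝ) ≤ (n + 1) * ρ := by
    push_cast
    refine (Finset.sum_le_card_nsmul _ _ ρ fun a _ => hρ a).trans ?_
    simp
  have hlog2 : Real.log 2 ≤ 1 := by linarith [Real.log_two_lt_d9]
  have hlog2' : 0 ≤ Real.log 2 := Real.log_nonneg (by norm_num)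
  rw [Real.log_mul (by positivity) (by positivity), Real.log_pow,
    Real.log_mul (by positivity) (by positivity), Real.log_pow] at h2
  have h3 : ((∑ a, r a : ℕ) : ℝ) * Real.log 2 ≤ (n + 1) * ρ :=
    (mul_le_of_le_one_right (Nat.cast_nonneg _) hlog2).trans hsum
  have h4 : (s : ℝ) * (((∑ a, r a : ℕ) : ℝ) * Real.log 2 + Real.log (l1 P)) ≤
      s * ((n + 1) * ρ + Real.log (l1 P)) := by gcongr
  have h5 : (s : ℝ) * (ρ + ((n + 1) * ρ + Real.log (l1 P))) ≤
      s * ((n + 2) * (Real.log (l1 P) + ρ)) := by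
    gcongr
    have : 0 ≤ (n + 1 : ℝ) * Real.log (l1 P) := by positivity
    nlinarith
  nlinarith

theorem sum_inv_mul_le_of_degree_lt {n s r₀ : ℕ} {r : Fin n → ℕ} {ω : ℝ} (d : Fin n →₀ ℕ)
    (hr0 : 0 < r₀) (hr : ∀ h, 0 < r h) (hω : ∀ h, (r₀ : ℝ) ≤ ω * r h) (hd : d.degree < s)
    (hs : s ≤ r₀ + 1) (hω0 : 0 < ω) : ∑ h, (1 / (r h : ℝ)) * d h ≤ ω := by
  have h0 : (0 : ℝ) < r₀ := by exact_mod_cast hr0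
  calc ∑ h, (1 / (r h : ℝ)) * d h ≤ ∑ h, (ω / r₀) * d h := by
        refine Finset.sum_le_sum fun h _ => mul_le_mul_of_nonneg_right ?_ (Nat.cast_nonneg _)
        have : (0 : ℝ) < r h := by exact_mod_cast hr h
        rw [div_le_div_iff₀ this h0, one_mul]
        exact hω h
    _ = ω / r₀ * (d.degree : ℕ) := by
        rw [← Finset.mul_sum, Finsupp.degree_eq_sum]; push_cast; rfl
    _ ≤ ω / r₀ * r₀ := by
        gcongr; omega
    _ = ω := by field_simp

/-- Roth's lemma: a nonzero integer polynomial of small height has small index at a rational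
point whose coordinates have rapidly varying large denominators. -/
theorem roth_lemma (n : ℕ) : ∀ ε : ℝ, 0 < ε → ∃ ω : ℝ, 0 < ω ∧
    ∀ (r : Fin n → ℕ) (β : Fin n → ℚ) (P : MvPolynomial (Fin n) ℤ) (ρ T : ℝ), P ≠ 0 →
    (∀ h, degreeOf h P ≤ r h) → (∀ h, 0 < r h) → (∀ h, (r h : ℝ) ≤ ρ) →
    (∀ i j, i < j → (r i : ℝ) ≤ ω * r j) → (∀ h, T ≤ r h * Real.log (β h).den) →
    Real.log (l1 (map (Int.castRingHom ℝ) P)) + ρ ≤ ω * T →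
    ∃ i, coeff i (shift (fun h => (β h : ℝ)) (map (Int.castRingHom ℝ) P)) ≠ 0 ∧
      ∑ h, (1 / (r h : ℝ)) * i h ≤ ε := by
  induction n with
  | zero =>
    intro ε hε
    refine ⟨1, one_pos, fun r β P ρ T hP _ _ _ _ _ _ => roth_index_zero _ ?_ hε⟩
    exact (map_injective _ (RingHom.injective_int _)).ne hP |> fun h => by simpa using h
  | succ n ih =>
    intro ε₁ hε₁
    obtain ⟨ε, hε, hε1, hεε⟩ : ∃ ε : ℝ, 0 < ε ∧ ε ≤ 1 ∧ ε ≤ ε₁ :=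
      ⟨min ε₁ 1, lt_min hε₁ one_pos, min_le_right _ _, min_le_left _ _⟩
    obtain ⟨ω', hω', hroth⟩ := ih (ε ^ 2 / 128) (by positivity)
    set ω : ℝ := min (ω' / (n + 3)) (min (ε / 2) (ε ^ 2 / (128 * (n + 3)))) with hωdef
    have hω0 : 0 < ω := by positivity
    have hωa : (n + 3) * ω ≤ ω' := by
      have : ω ≤ ω' / (n + 3) := min_le_left _ _
      rw [le_div_iff₀ (by positivity)] at this; linarith
    have hωb : ω ≤ ε / 2 := (min_le_right _ _).trans (min_le_left _ _)
    have hωc : (n + 3) * ω ≤ ε ^ 2 / 128 := by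
      have : ω ≤ ε ^ 2 / (128 * (n + 3)) := (min_le_right _ _).trans (min_le_right _ _)
      rw [le_div_iff₀ (by positivity)] at this; linarith
    clear_value ω
    refine ⟨ω, hω0, fun r β P ρ T hP hdeg hr hρ hrω hT hlog => ?_⟩
    set PR := map (Int.castRingHom ℝ) P with hPR
    have hPR0 : PR ≠ 0 := by
      have := (map_injective (σ := Fin (n + 1)) _ (RingHom.injective_int (Int.castRingHom ℝ))).ne hP
      simpa using this
    have hPR1 : 1 ≤ l1 PR := one_le_l1_map hP
    have hlogP : 0 ≤ Real.log (l1 PR) := Real.log_nonneg hPR1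
    have hρ0 : 0 < ρ := lt_of_lt_of_le (by exact_mod_cast hr 0) (hρ 0)
    have hT0 : 0 < T := by
      by_contra h; push Not at h
      nlinarith
    have hdegR : ∀ h, degreeOf h PR ≤ r h := fun h => by
      rw [degreeOf_le_iff]
      intro m hm
      exact (monomial_le_degreeOf h (support_map_subset _ _ hm)).trans (hdeg h)
    obtain ⟨s, hs, hsr, d, e, U, W, hd, he, hinj, hU, hW, hdet⟩ :=
      exists_det_hasse_eq_tensor hPR0 (hdegR 0)
    have hs0 : (0 : ℝ) < s := by exact_mod_cast hs
    have hr0 : (0 : ℝ) < r 0 := by exact_mod_cast hr 0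
    set V : MvPolynomial (Fin (n + 1)) ℤ :=
      (Matrix.of fun i j => hasse ((d i).cons (e j)) P).det with hVdef
    have hVmap : map (Int.castRingHom ℝ) V =
        (Matrix.of fun i j => hasse ((d i).cons (e j)) PR).det := by
      rw [hVdef, RingHom.map_det]
      congr 1
      ext1 i j
      simp [map_hasse, hPR]
    have hVT : map (Int.castRingHom ℝ) V = tensor U W := hVmap.trans hdet
    have hV0 : V ≠ 0 := by
      intro h
      rw [h, map_zero] at hVT
      exact tensor_ne_zero hU hW hVT.symm
    have hVl1 : 1 ≤ l1 (map (Int.castRingHom ℝ) V) := one_le_l1_map hV0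
    have hVlog : Real.log (l1 (map (Int.castRingHom ℝ) V)) ≤ s * ((n + 2) * (ω * T)) := by
      have := log_l1_det_hasse_le hdegR hρ hs hsr hPR1 (fun i j => (d i).cons (e j))
        (by rw [← hVmap]; exact hVl1)
      rw [← hVmap] at this
      refine this.trans ?_
      gcongr
    have hVdeg : ∀ h, degreeOf h V ≤ s * r h := fun h =>
      degreeOf_det_le h _ fun i j => (degreeOf_hasse_le _ _ _).trans (hdeg h)
    obtain ⟨U', hU', ⟨c, hcU⟩, hU'l1, hU'deg⟩ := exists_int_left_factor hU hW hVT
    obtain ⟨W', hW', ⟨c', hcW⟩, hW'lead⟩ := exists_int_right_factor hU hW hVT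
    -- the factor in the last variables
    obtain ⟨i, hi, hiε⟩ := hroth (fun h => s * r h.succ) (fun h => β h.succ) U' (s * ρ) (s * T) hU'
      (fun h => (hU'deg h).trans (hVdeg _)) (fun h => Nat.mul_pos hs (hr _))
      (fun h => by push_cast; exact mul_le_mul_of_nonneg_left (hρ _) hs0.le)
      (fun a b hab => by
        push_cast
        have h1 := hrω a.succ b.succ (Fin.succ_lt_succ_iff.mpr hab)
        have h2 : ω ≤ ω' := le_trans (by nlinarith [(n.cast_nonneg : (0 : ℝ) ≤ n)]) hωa
        have h3 : (r a.succ : ℝ) ≤ ω' * r b.succ := h1.trans (by gcongr)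
        nlinarith)
      (fun h => by
        push_cast
        rw [mul_assoc]
        exact mul_le_mul_of_nonneg_left (hT _) hs0.le)
      (by
        have h1 : Real.log (l1 (map (Int.castRingHom ℝ) U')) ≤ s * ((n + 2) * (ω * T)) :=
          (Real.log_le_log (lt_of_lt_of_le one_pos (one_le_l1_map hU')) hU'l1).trans hVlog
        have h2 : ρ ≤ ω * T := by linarith
        have h3 : (n + 3) * ω * T ≤ ω' * T := by gcongr
        nlinarith)
    -- the factor in the first variable
    obtain ⟨e₀, he₀, hden⟩ :=
      Polynomial.exists_taylor_coeff_ne_zero_and_den_pow_le hW' (β 0)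
    have hden0 : (0 : ℝ) < (β 0).den := by exact_mod_cast (β 0).den_pos
    have he₀' : (e₀ : ℝ) / r 0 ≤ s * ((n + 2) * ω) := by
      have h1 := Real.log_le_log (by positivity) (hden.trans hW'lead)
      rw [Real.log_pow] at h1
      have h2 := h1.trans hVlog
      have h3 := hT 0
      rw [div_le_iff₀ hr0]
      have h4 : (e₀ : ℝ) * T ≤ (s * ((n + 2) * ω) * r 0) * T := by
        calc (e₀ : ℝ) * T ≤ e₀ * (r 0 * Real.log (β 0).den) := by gcongr
          _ = r 0 * (e₀ * Real.log (β 0).den) := by ring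
          _ ≤ r 0 * (s * ((n + 2) * (ω * T))) := by gcongr
          _ = _ := by ring
      exact le_of_mul_le_mul_right h4 hT0
    have hVne : coeff (i.cons e₀) (shift (fun h => (β h : ℝ)) (map (Int.castRingHom ℝ) V)) ≠ 0 := by
      rw [hVT, shift_tensor, coeff_tensor]
      rw [hcU, map_smul, coeff_smul] at hi
      rw [hcW, Polynomial.smul_comp, Polynomial.coeff_smul] at he₀
      exact mul_ne_zero (right_ne_zero_of_smul hi) (right_ne_zero_of_smul he₀)
    by_contra hcon
    push Not at hcon
    -- all monomials of the translate have large weight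
    have hord : HasOrder (fun h => 1 / (r h : ℝ)) ε (shift (fun h => (β h : ℝ)) PR) :=
      fun i hi => hεε.trans (hcon i hi).le
    have hw0 : ∀ h, (0 : ℝ) ≤ (fun h => 1 / (r h : ℝ)) h := fun h => by positivity
    have hVord : HasOrder (fun h => 1 / (r h : ℝ)) (∑ j, max (ε / 2 - e j / r 0) 0)
        (shift (fun h => (β h : ℝ)) (map (Int.castRingHom ℝ) V)) := by
      rw [hVmap, ← AlgHom.coe_toRingHom, RingHom.map_det]
      refine HasOrder.det _ _ fun a b => ?_
      simp only [RingHom.mapMatrix_apply, Matrix.map_apply, Matrix.of_apply, AlgHom.coe_toRingHom]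
      rcases le_total (ε / 2 - (e b : ℝ) / r 0) 0 with h0 | h0
      · rw [max_eq_right h0]; exact hasOrder_zero_right hw0
      · rw [max_eq_left h0, ← hasse_shift]
        refine (hord.hasse _).mono ?_
        have := sum_inv_mul_le_of_degree_lt (d a) (hr 0) (fun h => hr h.succ)
          (fun h => hrω 0 h.succ (Fin.succ_pos h)) (hd a) hsr hω0
        rw [Fin.sum_univ_succ]
        simp only [Finsupp.cons_zero, Finsupp.cons_succ]
        have h2 : 1 / (r 0 : ℝ) * e b = e b / r 0 := by ring
        rw [h2]
        linarith
    have h1 := hVord _ hVne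
    rw [Fin.sum_univ_succ] at h1
    simp only [Finsupp.cons_zero, Finsupp.cons_succ] at h1
    have h2 := sum_max_sub_div_ge he hinj hs (hr 0) hsr (half_pos hε) (by linarith)
    have h3 : ∑ h : Fin n, 1 / (r h.succ : ℝ) * i h ≤ s * (ε ^ 2 / 128) := by
      have : ∑ h : Fin n, 1 / (r h.succ : ℝ) * i h =
          s * ∑ h : Fin n, (1 / ((s * r h.succ : ℕ) : ℝ)) * i h := by
        rw [Finset.mul_sum]
        refine Finset.sum_congr rfl fun h _ => ?_
        push_cast
        field_simp
      rw [this]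
      exact mul_le_mul_of_nonneg_left hiε hs0.le
    have h4 : 1 / (r 0 : ℝ) * e₀ = e₀ / r 0 := by ring
    have h5 : (s : ℝ) * ((n + 2) * ω) ≤ s * (ε ^ 2 / 128) := by
      gcongr; nlinarith
    have h6 : (s : ℝ) * (ε ^ 2 / 32) ≤ s * (ε ^ 2 / 64) := by
      have : (s : ℝ) * ((ε / 2) ^ 2 / 8) = s * (ε ^ 2 / 32) := by ring
      linarith
    have h7 := le_of_mul_le_mul_left h6 hs0
    nlinarith [pow_pos hε 2]

end MvPolynomial

section Siegel

attribute [local instance] Matrix.seminormedAddCommGroup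

/-- Siegel's lemma when there are at least twice as many unknowns as equations. -/
theorem exists_int_vec_abs_le {α β : Type*} [Fintype α] [Fintype β] (A : Matrix α β ℤ) {B : ℕ}
    (hB : ∀ i j, |A i j| ≤ B) (hB1 : 1 ≤ B) (hα : 0 < Fintype.card α)
    (h : 2 * Fintype.card α ≤ Fintype.card β) :
    ∃ t : β → ℤ, t ≠ 0 ∧ (∀ i, ∑ j, A i j * t j = 0) ∧
      ∀ j, |(t j : ℝ)| ≤ Fintype.card β * B := by
  obtain ⟨t, ht, hA, hle⟩ := Int.Matrix.exists_ne_zero_int_vec_norm_le A (by omega) hα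
  refine ⟨t, ht, fun i => congrFun hA i, fun j => ?_⟩
  have h1 : |(t j : ℝ)| ≤ ‖t‖ := by
    have := norm_le_pi_norm t j
    rwa [Int.norm_eq_abs] at this
  have hβ : (1 : ℝ) ≤ Fintype.card β := by exact_mod_cast (by omega : 1 ≤ Fintype.card β)
  have hB' : (1 : ℝ) ≤ B := by exact_mod_cast hB1
  have hnorm : ‖A‖ ≤ B := by
    rw [Matrix.norm_le_iff (by positivity)]
    intro i j
    rw [Int.norm_eq_abs]
    exact_mod_cast hB i j
  have hbase : (Fintype.card β : ℝ) * max 1 ‖A‖ ≤ Fintype.card β * B :=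
    mul_le_mul_of_nonneg_left (max_le hB' hnorm) (by positivity)
  have hbase1 : 1 ≤ (Fintype.card β : ℝ) * max 1 ‖A‖ :=
    one_le_mul_of_one_le_of_one_le hβ (le_max_left _ _)
  have hα' : (0 : ℝ) < Fintype.card α := by exact_mod_cast hα
  have hαβ : 2 * (Fintype.card α : ℝ) ≤ Fintype.card β := by exact_mod_cast h
  have hexp : (Fintype.card α : ℝ) / (Fintype.card β - Fintype.card α) ≤ 1 := by
    rw [div_le_one (by linarith)]; linarith
  calc |(t j : ℝ)| ≤ ‖t‖ := h1
    _ ≤ _ := hle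
    _ ≤ ((Fintype.card β : ℝ) * max 1 ‖A‖) ^ (1 : ℝ) := Real.rpow_le_rpow_of_exponent_le hbase1 hexp
    _ ≤ _ := by rw [Real.rpow_one]; exact hbase

end Siegel

theorem sum_range_sub_half {r : ℕ} (hr : 0 < r) :
    ∑ a ∈ Finset.range (r + 1), ((a : ℝ) / r - 1 / 2) = 0 := by
  have h := Finset.sum_range_id_mul_two (r + 1)
  have h' : (∑ a ∈ Finset.range (r + 1), (a : ℝ)) * 2 = (r + 1) * r := by
    have := congrArg (Nat.cast (R := ℝ)) h
    push_cast at this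
    simpa using this
  have h0 : (r : ℝ) ≠ 0 := by exact_mod_cast hr.ne'
  rw [Finset.sum_sub_distrib, ← Finset.sum_div]
  simp only [Finset.sum_const, Finset.card_range, nsmul_eq_mul]
  push_cast
  field_simp
  linarith

/-- Chernoff bound for exponents in a box, in the direction given by the sign of `t`. -/
theorem card_box_filter_le {n : ℕ} {r : Fin n → ℕ} (hr : ∀ h, 0 < r h) {η t : ℝ}
    (hη1 : η ≤ 1) (ht : |t| = η) :
    (((Fintype.piFinset fun h => Finset.range (r h + 1)).filter fun j =>
      η ^ 2 * n ≤ t * ∑ h, ((j h : ℝ) / r h - 1 / 2)).card : ℝ) ≤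
      (∏ h, ((r h : ℝ) + 1)) * Real.exp (-(3 / 4) * n * η ^ 2) := by
  set box := Fintype.piFinset fun h => Finset.range (r h + 1) with hbox
  have hη0 : 0 ≤ η := ht ▸ abs_nonneg t
  have ht2 : t ^ 2 = η ^ 2 := by rw [← ht, sq_abs]
  have hone : ∀ h, ∑ a ∈ Finset.range (r h + 1), Real.exp (t * ((a : ℝ) / r h - 1 / 2)) ≤
      (r h + 1) * Real.exp (η ^ 2 / 4) := by
    intro h
    have hr0 : (0 : ℝ) < r h := by exact_mod_cast hr h
    have hle : ∀ a ∈ Finset.range (r h + 1), Real.exp (t * ((a : ℝ) / r h - 1 / 2)) ≤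
        1 + t * ((a : ℝ) / r h - 1 / 2) + η ^ 2 / 4 := by
      intro a ha
      have ha' : (a : ℝ) ≤ r h := by
        exact_mod_cast Nat.lt_succ_iff.mp (Finset.mem_range.mp ha)
      have hy : |(a : ℝ) / r h - 1 / 2| ≤ 1 / 2 := by
        rw [abs_le]
        have h1 : (a : ℝ) / r h ≤ 1 := (div_le_one hr0).mpr ha'
        have h2 : 0 ≤ (a : ℝ) / r h := by positivity
        constructor <;> linarith
      have hty : |t * ((a : ℝ) / r h - 1 / 2)| ≤ η / 2 := by
        rw [abs_mul, ht]; nlinarith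
      have h1 := Real.abs_exp_sub_one_sub_id_le (hty.trans (by linarith))
      have h2 := (abs_le.mp h1).2
      have h3 : (t * ((a : ℝ) / r h - 1 / 2)) ^ 2 ≤ η ^ 2 / 4 := by
        rw [← sq_abs]; nlinarith [abs_nonneg (t * ((a : ℝ) / r h - 1 / 2))]
      linarith
    refine (Finset.sum_le_sum hle).trans ?_
    rw [Finset.sum_add_distrib, Finset.sum_add_distrib, ← Finset.mul_sum, sum_range_sub_half (hr h)]
    simp only [Finset.sum_const, Finset.card_range, nsmul_eq_mul]
    push_cast
    have := Real.add_one_le_exp (η ^ 2 / 4)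
    nlinarith
  have htot : ∑ j ∈ box, Real.exp (t * ∑ h, ((j h : ℝ) / r h - 1 / 2)) ≤
      (∏ h, ((r h : ℝ) + 1)) * Real.exp (n * (η ^ 2 / 4)) := by
    have h1 : ∀ j ∈ box, Real.exp (t * ∑ h, ((j h : ℝ) / r h - 1 / 2)) =
        ∏ h, Real.exp (t * ((j h : ℝ) / r h - 1 / 2)) := fun j _ => by
      rw [Finset.mul_sum, Real.exp_sum]
    rw [Finset.sum_congr rfl h1, hbox, ← Finset.prod_univ_sum (fun h => Finset.range (r h + 1))
      (fun h (a : ℕ) => Real.exp (t * ((a : ℝ) / r h - 1 / 2)))]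
    refine (Finset.prod_le_prod (fun h _ => Finset.sum_nonneg fun _ _ => (Real.exp_pos _).le)
      fun h _ => hone h).trans ?_
    rw [Finset.prod_mul_distrib, ← Real.exp_sum]
    simp
  have hmarkov : ((box.filter fun j => η ^ 2 * n ≤ t * ∑ h, ((j h : ℝ) / r h - 1 / 2)).card : ℝ) *
      Real.exp (η ^ 2 * n) ≤ ∑ j ∈ box, Real.exp (t * ∑ h, ((j h : ℝ) / r h - 1 / 2)) := by
    rw [← nsmul_eq_mul]
    refine (Finset.card_nsmul_le_sum _ (fun j : Fin n → ℕ =>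
      Real.exp (t * ∑ h, ((j h : ℝ) / r h - 1 / 2))) _ fun j hj => ?_).trans
      (Finset.sum_le_sum_of_subset_of_nonneg (Finset.filter_subset _ _)
        fun _ _ _ => (Real.exp_pos _).le)
    exact Real.exp_le_exp.mpr (Finset.mem_filter.mp hj).2
  have h2 := hmarkov.trans htot
  rw [← le_div_iff₀ (Real.exp_pos _), mul_div_assoc, ← Real.exp_sub] at h2
  rwa [show -(3 / 4) * (n : ℝ) * η ^ 2 = n * (η ^ 2 / 4) - η ^ 2 * n by ring]

namespace MvPolynomial

/-- The auxiliary polynomial of the Thue–Siegel–Roth method at a `q`-th root. -/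
theorem exists_auxiliary_polynomial {q K : ℕ} (hq : 0 < q) (hK : 1 ≤ K) {ξ : ℝ} (hξ : ξ ^ q = K)
    {η : ℝ} (hη0 : 0 < η) (hη : η < 1 / 2) {n : ℕ} (hn0 : 0 < n)
    (hn : Real.exp (-(3 / 4) * n * η ^ 2) * (2 * q + 1) ≤ 1) {r : Fin n → ℕ} (hr : ∀ h, 0 < r h) :
    ∃ P : MvPolynomial (Fin n) ℤ, P ≠ 0 ∧ (∀ h, degreeOf h P ≤ r h) ∧
      l1 (map (Int.castRingHom ℝ) P) ≤ (8 * K) ^ (∑ h, r h) ∧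
      (∀ i, coeff i P ≠ 0 → ∑ h, (1 / (r h : ℝ)) * i h ≤ n * (1 / 2 + η)) ∧
      ∀ i, ∑ h, (1 / (r h : ℝ)) * i h < n * (1 / 2 - η) →
        coeff i (shift (fun _ => ξ) (map (Int.castRingHom ℝ) P)) = 0 := by
  classical
  set box := Fintype.piFinset fun h => Finset.range (r h + 1) with hbox
  have hmem : ∀ j, j ∈ box ↔ ∀ h, j h ≤ r h := fun j => by
    simp [hbox, Fintype.mem_piFinset]
  set p₀ := Real.exp (-(3 / 4) * n * η ^ 2) with hp₀
  have hwt : ∀ j : Fin n → ℕ, ∑ h, ((j h : ℝ) / r h - 1 / 2) =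
      ∑ h, (1 / (r h : ℝ)) * j h - n / 2 := by
    intro j
    rw [Finset.sum_sub_distrib]
    simp only [Finset.sum_const, Finset.card_univ, Fintype.card_fin, nsmul_eq_mul]
    congr 1
    · exact Finset.sum_congr rfl fun h _ => by ring
    · ring
  set J := box.filter fun j => ∑ h, (1 / (r h : ℝ)) * j h ≤ n * (1 / 2 + η) with hJ
  set E := box.filter fun j => ∑ h, (1 / (r h : ℝ)) * j h < n * (1 / 2 - η) with hE
  have hcard : (box.card : ℝ) = ∏ h, ((r h : ℝ) + 1) := by
    rw [hbox, Fintype.card_piFinset]; push_cast; simp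
  have hEcard : (E.card : ℝ) ≤ box.card * p₀ := by
    rw [hcard]
    refine le_trans ?_ (card_box_filter_le hr (η := η) (t := -η) (by linarith)
      (by rw [abs_neg, abs_of_pos hη0]))
    refine Nat.cast_le.mpr (Finset.card_le_card fun j hj => ?_)
    obtain ⟨h1, h2⟩ := Finset.mem_filter.mp hj
    refine Finset.mem_filter.mpr ⟨h1, ?_⟩
    rw [hwt]
    nlinarith
  have hJcard : (box.card : ℝ) ≤ J.card + box.card * p₀ := by
    have h1 := Finset.card_filter_add_card_filter_not (s := box)
      (fun j : Fin n → ℕ => ∑ h, (1 / (r h : ℝ)) * j h ≤ n * (1 / 2 + η))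
    have h2 : ((box.filter fun j : Fin n → ℕ =>
        ¬ ∑ h, (1 / (r h : ℝ)) * j h ≤ n * (1 / 2 + η)).card : ℝ) ≤ box.card * p₀ := by
      rw [hcard]
      refine le_trans ?_ (card_box_filter_le hr (η := η) (t := η) (by linarith) (abs_of_pos hη0))
      refine Nat.cast_le.mpr (Finset.card_le_card fun j hj => ?_)
      obtain ⟨h1, h2⟩ := Finset.mem_filter.mp hj
      refine Finset.mem_filter.mpr ⟨h1, ?_⟩
      rw [hwt]
      push Not at h2
      nlinarith
    have h3 : (box.card : ℝ) = J.card + ((box.filter fun j : Fin n → ℕ =>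
        ¬ ∑ h, (1 / (r h : ℝ)) * j h ≤ n * (1 / 2 + η)).card : ℝ) := by exact_mod_cast h1.symm
    linarith
  have hboxpos : (0 : ℝ) < box.card := by rw [hcard]; positivity
  have hEne : E.Nonempty := by
    refine ⟨0, Finset.mem_filter.mpr ⟨(hmem _).mpr fun h => Nat.zero_le _, ?_⟩⟩
    have : (0 : ℝ) < n := by exact_mod_cast hn0
    simp only [Pi.zero_apply, Nat.cast_zero, mul_zero, Finset.sum_const_zero]
    exact mul_pos this (by linarith)
  set R := ∑ h, r h with hR
  have hle_sum : ∀ j ∈ box, ∑ h, j h ≤ R := fun j hj =>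
    Finset.sum_le_sum fun h _ => (hmem j).mp hj h
  -- the linear system
  let A : Matrix (E × Fin q) J ℤ := fun ia j =>
    if (∀ h, (ia.1 : Fin n → ℕ) h ≤ (j : Fin n → ℕ) h) ∧
        (∑ h, ((j : Fin n → ℕ) h - (ia.1 : Fin n → ℕ) h)) % q = ia.2 then
      (∏ h, ((j : Fin n → ℕ) h).choose ((ia.1 : Fin n → ℕ) h) : ℕ) *
        (K : ℤ) ^ ((∑ h, ((j : Fin n → ℕ) h - (ia.1 : Fin n → ℕ) h)) / q)
    else 0
  have hAle : ∀ ia j, |A ia j| ≤ ((2 * K) ^ R : ℕ) := by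
    intro ia j
    have hj := (Finset.mem_filter.mp j.2).1
    simp only [A]
    split_ifs
    · rw [abs_of_nonneg (by positivity)]
      rw [mul_pow]
      push_cast
      refine mul_le_mul ?_ ?_ (by positivity) (by positivity)
      · have : ∏ h, ((j : Fin n → ℕ) h).choose ((ia.1 : Fin n → ℕ) h) ≤ 2 ^ R := by
          rw [hR, ← Finset.prod_pow_eq_pow_sum]
          exact Finset.prod_le_prod' fun h _ => (Nat.choose_le_two_pow _ _).trans
            (Nat.pow_le_pow_right (by norm_num) ((hmem _).mp hj h))
        exact_mod_cast this
      · refine pow_le_pow_right₀ (by exact_mod_cast hK) ((Nat.div_le_self _ _).trans ?_)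
        exact (Finset.sum_le_sum fun h _ => Nat.sub_le _ _).trans (hle_sum _ hj)
    · simp
  obtain ⟨t, ht, hAt, htle⟩ := exists_int_vec_abs_le A hAle (Nat.one_le_pow _ _ (by omega))
    (by simpa [Fintype.card_prod] using ⟨hEne, hq⟩)
    (by
      simp only [Fintype.card_prod, Fintype.card_coe, Fintype.card_fin]
      have h1 : 2 * ((E.card : ℝ) * q) ≤ J.card := by
        have : (0 : ℝ) ≤ q := Nat.cast_nonneg _
        nlinarith
      exact_mod_cast h1)
  let P : MvPolynomial (Fin n) ℤ := ∑ j : J,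
      monomial (Finsupp.equivFunOnFinite.symm (j : Fin n → ℕ)) (t j)
  have hcoef : ∀ i, coeff i P = if h : (i : Fin n → ℕ) ∈ J then t ⟨i, h⟩ else 0 := by
    intro i
    simp only [P, coeff_sum, coeff_monomial]
    split_ifs with h
    · rw [Finset.sum_eq_single_of_mem (⟨i, h⟩ : J) (Finset.mem_univ _)]
      · rw [if_pos]; ext a; rfl
      · intro j _ hj
        rw [if_neg]
        rintro rfl
        exact hj (Subtype.ext rfl)
    · refine Finset.sum_eq_zero fun j _ => ?_
      rw [if_neg]
      rintro rfl
      exact h j.2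
  have hsupp : ∀ i, coeff i P ≠ 0 → (i : Fin n → ℕ) ∈ J := by
    intro i hi
    by_contra h
    exact hi (by rw [hcoef, dif_neg h])
  refine ⟨P, ?_, ?_, ?_, ?_, ?_⟩
  · obtain ⟨j, hj⟩ := Function.ne_iff.mp ht
    refine ne_zero_iff.mpr ⟨Finsupp.equivFunOnFinite.symm (j : Fin n → ℕ), ?_⟩
    rw [hcoef, dif_pos (by exact j.2)]
    exact hj
  · intro h
    rw [degreeOf_le_iff]
    intro m hm
    exact (hmem _).mp (Finset.mem_filter.mp (hsupp m (mem_support_iff.mp hm))).1 h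
  · have h1 : map (Int.castRingHom ℝ) P =
        ∑ j : J, monomial (Finsupp.equivFunOnFinite.symm (j : Fin n → ℕ)) (t j : ℝ) := by
      simp [P, map_sum, map_monomial]
    rw [h1]
    have hJR : (J.card : ℝ) ≤ 2 ^ R := by
      have h3 : J.card ≤ 2 ^ R := by
        refine (Finset.card_filter_le _ _).trans ?_
        rw [hbox, Fintype.card_piFinset, hR, ← Finset.prod_pow_eq_pow_sum]
        refine Finset.prod_le_prod' fun h _ => ?_
        rw [Finset.card_range]
        exact Nat.lt_two_pow_self
      exact_mod_cast h3
    have h2 : ∀ j ∈ (Finset.univ : Finset J),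
        l1 (monomial (Finsupp.equivFunOnFinite.symm (j : Fin n → ℕ)) (t j : ℝ)) ≤
          2 ^ R * (2 * K) ^ R := by
      intro j _
      refine (l1_monomial_le _ _).trans ((htle j).trans ?_)
      push_cast
      gcongr
      rwa [Fintype.card_coe]
    refine (l1_sum_le _ _).trans ((Finset.sum_le_card_nsmul _ _ _ h2).trans ?_)
    rw [Finset.card_univ, Fintype.card_coe, nsmul_eq_mul]
    calc (J.card : ℝ) * (2 ^ R * (2 * K) ^ R) ≤ 2 ^ R * (2 ^ R * (2 * K) ^ R) := by gcongr
      _ = (8 * K) ^ R := by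
        rw [← mul_pow, ← mul_pow]; ring
  · intro i hi
    exact (Finset.mem_filter.mp (hsupp i hi)).2
  · intro i hi
    have h1 : map (Int.castRingHom ℝ) P =
        ∑ j : J, monomial (Finsupp.equivFunOnFinite.symm (j : Fin n → ℕ)) (t j : ℝ) := by
      simp [P, map_sum, map_monomial]
    rw [coeff_shift, h1, map_sum, map_sum]
    by_cases hib : (i : Fin n → ℕ) ∈ box
    · have hiE : (i : Fin n → ℕ) ∈ E := Finset.mem_filter.mpr ⟨hib, hi⟩
      have key : ∀ j : J, eval (fun _ => ξ) (hasse i (monomial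
          (Finsupp.equivFunOnFinite.symm (j : Fin n → ℕ)) (t j : ℝ))) =
          ∑ a : Fin q, ξ ^ (a : ℕ) * ((A (⟨i, hiE⟩, a) j * t j : ℤ) : ℝ) := by
        intro j
        rw [hasse_monomial, eval_monomial, Finsupp.prod_fintype _ _ (by simp),
          Finset.prod_pow_eq_pow_sum]
        set D := ∑ h, ((j : Fin n → ℕ) h - i h) with hD
        have hD' : ∑ h, (Finsupp.equivFunOnFinite.symm (j : Fin n → ℕ) - i : Fin n →₀ ℕ) h = D :=
          rfl
        rw [hD']
        by_cases hij : ∀ h, i h ≤ (j : Fin n → ℕ) h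
        · rw [Finset.sum_eq_single_of_mem (⟨D % q, Nat.mod_lt _ hq⟩ : Fin q) (Finset.mem_univ _)]
          · have hA1 : A (⟨i, hiE⟩, ⟨D % q, Nat.mod_lt _ hq⟩) j =
                (∏ h, ((j : Fin n → ℕ) h).choose (i h) : ℕ) * (K : ℤ) ^ (D / q) :=
              if_pos ⟨hij, rfl⟩
            rw [hA1]
            push_cast
            rw [← hξ, ← pow_mul]
            have hpow : ξ ^ D = ξ ^ (D % q) * ξ ^ (q * (D / q)) := by
              rw [← pow_add, Nat.mod_add_div]
            rw [hpow]
            simp only [multiChoose, Finsupp.equivFunOnFinite_symm_apply_apply]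
            push_cast
            ring
          · intro a _ ha
            have hA0 : A (⟨i, hiE⟩, a) j = 0 := if_neg fun h => ha (Fin.ext h.2.symm)
            rw [hA0]; simp
        · have hA0 : ∀ a, A (⟨i, hiE⟩, a) j = 0 := fun a => if_neg fun h => hij h.1
          rw [multiChoose_eq_zero (fun h => hij fun x => h x)]
          simp [hA0]
      rw [Finset.sum_congr rfl fun j _ => key j, Finset.sum_comm]
      refine Finset.sum_eq_zero fun a _ => ?_
      rw [← Finset.mul_sum, ← Int.cast_sum, hAt, Int.cast_zero, mul_zero]
    · refine Finset.sum_eq_zero fun j _ => ?_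
      rw [hasse_monomial, multiChoose_eq_zero]
      · simp
      · intro hle
        exact hib ((hmem _).mpr fun h =>
          (hle h).trans ((hmem _).mp (Finset.mem_filter.mp j.2).1 h))

end MvPolynomial

section RootIrrational

/-- If `k ^ p` is the `q`-th power of a rational with `p` and `q` coprime then so is `k`. -/
theorem exists_nat_pow_eq_of_rat_pow_eq {k p q : ℕ} (hk : 0 < k) (hq : 0 < q)
    (hcop : Nat.Coprime p q) {x : ℚ} (hx : x ^ q = (k : ℚ) ^ p) : ∃ m : ℕ, k = m ^ q := by
  have hk0 : (k : ℚ) ≠ 0 := by exact_mod_cast hk.ne'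
  have hx0 : x ≠ 0 := by
    rintro rfl
    rw [zero_pow hq.ne'] at hx
    exact pow_ne_zero p hk0 hx.symm
  have hbez := Nat.gcd_eq_gcd_ab p q
  rw [hcop] at hbez
  set u := Nat.gcdA p q
  set v := Nat.gcdB p q
  set z : ℚ := x ^ u * (k : ℚ) ^ v with hz
  have hzq : z ^ q = k := by
    rw [hz, mul_pow, ← zpow_natCast (x ^ u), ← zpow_mul, mul_comm u, zpow_mul, zpow_natCast, hx,
      ← zpow_natCast, ← zpow_mul, ← zpow_natCast ((k : ℚ) ^ v), ← zpow_mul, ← zpow_add₀ hk0,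
      mul_comm v, ← hbez]
    simp
  have hint : IsIntegral ℤ z :=
    ⟨Polynomial.X ^ q - Polynomial.C (k : ℤ), Polynomial.monic_X_pow_sub_C _ hq.ne', by simp [hzq]⟩
  obtain ⟨m, hm⟩ := IsIntegrallyClosed.isIntegral_iff.mp hint
  refine ⟨m.natAbs, ?_⟩
  have h1 : m ^ q = (k : ℤ) := by
    have : (m : ℚ) ^ q = k := by rw [← hzq, ← hm]; simp
    exact_mod_cast this
  have h2 := congrArg Int.natAbs h1
  rw [Int.natAbs_pow] at h2
  simpa using h2.symm

/-- The denominators of good `k`-adic approximations to a `q`-th root are large. -/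
theorem exists_le_log_den {k q K : ℕ} (hk : 2 ≤ k) (hq : 0 < q) {ξ : ℝ} (hξ0 : 0 < ξ)
    (hξ : ξ ^ q = K) (hirr : ∀ x : ℚ, x ^ q ≠ K) :
    ∃ d₁ : ℕ, ∀ d ≥ d₁, ∀ a : ℤ, |(k : ℝ) ^ d * ξ - a| ≤ 1 →
      Real.log k / (2 * q) * d ≤ Real.log ((a : ℚ) / (k : ℚ) ^ d).den := by
  have hlk : 0 < Real.log k := Real.log_pos (by exact_mod_cast hk)
  have hk0 : (0 : ℝ) < k := by positivity
  have hq0 : (0 : ℝ) < q := by exact_mod_cast hq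
  set C : ℝ := q * (ξ + 1) ^ (q - 1) with hC
  have hC0 : 0 < C := by positivity
  obtain ⟨d₁, hd₁⟩ := exists_nat_ge (2 * Real.log C / Real.log k)
  refine ⟨d₁, fun d hd a ha => ?_⟩
  set β : ℚ := (a : ℚ) / (k : ℚ) ^ d with hβ
  have hkd : (1 : ℝ) ≤ (k : ℝ) ^ d := one_le_pow₀ (by exact_mod_cast (by omega : 1 ≤ k))
  have hkd0 : (0 : ℝ) < (k : ℝ) ^ d := by positivity
  have hβR : (β : ℝ) = a / (k : ℝ) ^ d := by rw [hβ]; push_cast; rfl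
  have hdiff : |ξ - β| ≤ 1 / (k : ℝ) ^ d := by
    rw [hβR, le_div_iff₀ hkd0, ← abs_of_pos hkd0, ← abs_mul, sub_mul, abs_of_pos hkd0,
      div_mul_cancel₀ _ hkd0.ne', mul_comm]
    exact ha
  have hβle : |(β : ℝ)| ≤ ξ + 1 := by
    have h1 : |(β : ℝ)| ≤ |ξ| + |ξ - β| := by
      rw [show (β : ℝ) = ξ - (ξ - β) by ring]
      simpa using abs_sub ξ (ξ - β)
    rw [abs_of_pos hξ0] at h1
    have : 1 / (k : ℝ) ^ d ≤ 1 := by rw [div_le_one hkd0]; exact hkd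
    linarith
  have hpow : |ξ ^ q - (β : ℝ) ^ q| ≤ 1 / (k : ℝ) ^ d * C := by
    refine (abs_pow_sub_pow_le ξ β q).trans ?_
    rw [hC, mul_assoc]
    gcongr
    rw [abs_of_pos hξ0]
    exact max_le (by linarith) hβle
  have hden0 : (0 : ℝ) < β.den := by exact_mod_cast β.den_pos
  have hlow : 1 / (β.den : ℝ) ^ q ≤ |ξ ^ q - (β : ℝ) ^ q| := by
    have h1 : ξ ^ q - (β : ℝ) ^ q = ((K * (β.den : ℤ) ^ q - β.num ^ q : ℤ) : ℝ) /
        (β.den : ℝ) ^ q := by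
      rw [hξ, Rat.cast_def, div_pow]
      push_cast
      field_simp
    have h2 : (K * (β.den : ℤ) ^ q - β.num ^ q : ℤ) ≠ 0 := by
      intro h
      apply hirr β
      have hd0 : (β.den : ℚ) ≠ 0 := by exact_mod_cast β.den_nz
      have h3 : (K : ℚ) * (β.den : ℚ) ^ q = (β.num : ℚ) ^ q := by
        have := congrArg (Int.cast (R := ℚ)) (sub_eq_zero.mp h)
        push_cast at this
        exact this
      rw [← Rat.num_div_den β, div_pow, ← h3]
      field_simp
    rw [h1, abs_div, abs_of_pos (by positivity : (0 : ℝ) < (β.den : ℝ) ^ q)]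
    gcongr
    exact_mod_cast Int.one_le_abs h2
  have h3 : (k : ℝ) ^ d ≤ C * (β.den : ℝ) ^ q := by
    have := hlow.trans hpow
    rw [div_mul_eq_mul_div, one_mul, div_le_div_iff₀ (by positivity) hkd0, one_mul] at this
    exact this
  have h4 := Real.log_le_log hkd0 h3
  rw [Real.log_mul hC0.ne' (by positivity), Real.log_pow, Real.log_pow] at h4
  have hd' : 2 * Real.log C ≤ d * Real.log k := by
    rw [div_le_iff₀ hlk] at hd₁
    refine hd₁.trans ?_
    gcongr
  rw [div_mul_eq_mul_div, div_le_iff₀ (by positivity)]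
  nlinarith

end RootIrrational

namespace MvPolynomial

theorem one_le_pow_mul_abs_eval {n k L : ℕ} (hk : 0 < k) (Q : MvPolynomial (Fin n) ℤ)
    (a : Fin n → ℤ) (d : Fin n → ℕ) (hL : ∀ i, coeff i Q ≠ 0 → ∑ h, d h * i h ≤ L)
    (hne : eval (fun h => (a h : ℝ) / (k : ℝ) ^ d h) (map (Int.castRingHom ℝ) Q) ≠ 0) :
    1 ≤ (k : ℝ) ^ L * |eval (fun h => (a h : ℝ) / (k : ℝ) ^ d h) (map (Int.castRingHom ℝ) Q)| := by
  have hk0 : (k : ℝ) ≠ 0 := by exact_mod_cast hk.ne'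
  have key : (k : ℝ) ^ L * eval (fun h => (a h : ℝ) / (k : ℝ) ^ d h) (map (Int.castRingHom ℝ) Q) =
      ((∑ i ∈ Q.support, coeff i Q * (k ^ (L - ∑ h, d h * i h) * ∏ h, a h ^ i h) : ℤ) : ℝ) := by
    rw [eval_map, eval₂_eq', Finset.mul_sum]
    push_cast
    refine Finset.sum_congr rfl fun i hi => ?_
    have h1 := hL i (mem_support_iff.mp hi)
    have h2 : (k : ℝ) ^ L = k ^ (L - ∑ h, d h * i h) * ∏ h, ((k : ℝ) ^ d h) ^ i h := by
      simp_rw [← pow_mul]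
      rw [Finset.prod_pow_eq_pow_sum, ← pow_add, Nat.sub_add_cancel h1]
    have h3 : ∏ h, ((k : ℝ) ^ d h) ^ i h ≠ 0 :=
      Finset.prod_ne_zero_iff.mpr fun h _ => pow_ne_zero _ (pow_ne_zero _ hk0)
    simp_rw [div_pow]
    rw [Finset.prod_div_distrib, h2, eq_intCast]
    field_simp
  have h4 : (k : ℝ) ^ L * eval (fun h => (a h : ℝ) / (k : ℝ) ^ d h)
      (map (Int.castRingHom ℝ) Q) ≠ 0 :=
    mul_ne_zero (pow_ne_zero _ hk0) hne
  rw [← abs_of_nonneg (by positivity : (0 : ℝ) ≤ (k : ℝ) ^ L), ← abs_mul]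
  rw [key] at h4 ⊢
  have : (∑ i ∈ Q.support, coeff i Q * (k ^ (L - ∑ h, d h * i h) * ∏ h, a h ^ i h) : ℤ) ≠ 0 :=
    fun h => h4 (by rw [h]; simp)
  exact_mod_cast Int.one_le_abs this

/-- Upper bound for a Taylor coefficient at `b` of a polynomial vanishing to high order at `ξ`. -/
theorem abs_coeff_shift_le {n : ℕ} {r : Fin n → ℕ} {P : MvPolynomial (Fin n) ℝ} {ξ B : ℝ}
    (hξ : 0 < ξ) (hdeg : ∀ h, degreeOf h P ≤ r h) (b : Fin n → ℝ) (μ : Fin n →₀ ℕ)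
    (hB : ∀ i, coeff (i + μ) (shift (fun _ => ξ) P) ≠ 0 → ∏ h, |b h - ξ| ^ i h ≤ B) (hB0 : 0 ≤ B) :
    |coeff μ (shift b P)| ≤ (2 * (1 + ξ)) ^ (∑ h, r h) * l1 P * B := by
  have h1 : shift b P = shift (fun h => b h - ξ) (shift (fun _ => ξ) P) := by
    have : shift b = (shift fun h => b h - ξ).comp (shift fun _ => ξ) := by
      refine algHom_ext fun h => ?_
      simp only [shift, AlgHom.comp_apply, aeval_X, map_add, map_sub, algHom_C, algebraMap_eq]
      ring
    rw [this]; rfl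
  rw [h1, coeff_shift]
  refine (abs_eval_le_l1 _ _ (B := B) fun i hi => hB i fun h0 => hi ?_).trans ?_
  · rw [coeff_hasse, h0, mul_zero]
  · gcongr
    rw [hasse_shift]
    refine (l1_shift_le (r := r) _ fun a => (degreeOf_hasse_le _ _ _).trans (hdeg a)).trans ?_
    have h2 := l1_hasse_le μ hdeg
    rw [Finset.prod_pow_eq_pow_sum, abs_of_pos hξ]
    calc (1 + ξ) ^ (∑ h, r h) * l1 (hasse μ P) ≤
        (1 + ξ) ^ (∑ h, r h) * (2 ^ (∑ h, r h) * l1 P) := by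
          gcongr
      _ = _ := by rw [mul_pow]; ring

end MvPolynomial

theorem exists_lacunary_seq {p : ℕ → Prop} (hp : ∀ x, ∃ d ≥ x, p d) (d₀ : ℕ) {C : ℕ} (hC : 1 ≤ C) :
    ∃ D : ℕ → ℕ, (∀ m, p (D m)) ∧ (∀ m, d₀ ≤ D m) ∧ ∀ i j, i < j → C * D i ≤ D j := by
  choose f hf hpf using hp
  let D : ℕ → ℕ := fun m => Nat.rec (f d₀) (fun _ y => f (C * y)) m
  have hstep : ∀ m, C * D m ≤ D (m + 1) := fun m => hf _
  have hmono : Monotone D :=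
    monotone_nat_of_le_succ fun m => le_trans (Nat.le_mul_of_pos_left _ hC) (hstep m)
  refine ⟨D, fun m => ?_, fun m => (hf d₀).trans (hmono (Nat.zero_le m)), fun i j hij =>
    (hstep i).trans (hmono hij)⟩
  cases m <;> exact hpf _

set_option maxHeartbeats 2000000 in
/-- **Ridout's theorem** for `k`-adic rational approximations to a `q`-th root. -/
theorem exists_rpow_neg_le_abs_sub {k q K : ℕ} (hk : 2 ≤ k) (hq : 0 < q) (hK : 1 ≤ K) {ξ : ℝ}
    (hξ0 : 0 < ξ) (hξ : ξ ^ q = K) (hirr : ∀ x : ℚ, x ^ q ≠ K) {ε : ℝ} (hε : 0 < ε) (hε1 : ε ≤ 1) :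
    ∃ d₀ : ℕ, ∀ d ≥ d₀, ∀ a : ℤ, (k : ℝ) ^ (-(ε * d)) ≤ |(k : ℝ) ^ d * ξ - a| := by
  by_contra hcon
  have hbad : ∀ d₀ : ℕ, ∃ d ≥ d₀, ∃ a : ℤ, |(k : ℝ) ^ d * ξ - a| < (k : ℝ) ^ (-(ε * d)) := by
    push Not at hcon
    exact hcon
  have hk0 : (0 : ℝ) < k := by exact_mod_cast (by omega : 0 < k)
  have hk1 : (1 : ℝ) < k := by exact_mod_cast hk
  have hlk : 0 < Real.log k := Real.log_pos hk1
  obtain ⟨η, hη⟩ : ∃ η, η = ε / 100 := ⟨_, rfl⟩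
  have hη0 : 0 < η := by rw [hη]; positivity
  have hη1 : η ≤ 1 / 100 := by linarith
  have hq0 : (0 : ℝ) < q := by exact_mod_cast hq
  have hK0 : (1 : ℝ) ≤ K := by exact_mod_cast hK
  obtain ⟨n, hn0, hn⟩ : ∃ n : ℕ, 0 < n ∧ Real.exp (-(3 / 4) * n * η ^ 2) * (2 * q + 1) ≤ 1 := by
    obtain ⟨n, hn⟩ := exists_nat_ge (Real.log (2 * q + 1) / (3 / 4 * η ^ 2))
    refine ⟨n + 1, n.succ_pos, ?_⟩
    rw [div_le_iff₀ (by positivity)] at hn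
    nth_rw 1 [← Real.exp_log (by positivity : (0 : ℝ) < 2 * q + 1)]
    rw [← Real.exp_add, Real.exp_le_one_iff]
    push_cast
    nlinarith
  have hn0' : (0 : ℝ) < n := by exact_mod_cast hn0
  obtain ⟨ω, hω0, hroth⟩ := MvPolynomial.roth_lemma n (n * η) (by positivity)
  obtain ⟨d₁, hd₁⟩ := exists_le_log_den hk hq hξ0 hξ hirr
  obtain ⟨c₁, hc₁⟩ : ∃ c, c = Real.log k / (2 * q) := ⟨_, rfl⟩
  have hc₁0 : 0 < c₁ := by rw [hc₁]; positivity
  obtain ⟨C₀, hC₀⟩ := exists_nat_ge (2 / ω)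
  obtain ⟨C', hC'⟩ : ∃ C, C = 2 * (1 + ξ) * (8 * K) := ⟨_, rfl⟩
  have hC'1 : 1 ≤ C' := by rw [hC']; nlinarith
  obtain ⟨m₁, hm₁⟩ := exists_nat_ge ((n * Real.log (8 * K) + 1) * 2 / (ω * c₁))
  obtain ⟨m₂, hm₂⟩ := exists_nat_ge (2 * Real.log C' / (η * Real.log k))
  obtain ⟨m, hm⟩ : ∃ m, m = d₁ + m₁ + m₂ + 1 := ⟨_, rfl⟩
  have hm0 : (0 : ℝ) < m := by rw [hm]; positivity
  have hmm₁ : (m₁ : ℝ) ≤ m := by exact_mod_cast (by omega)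
  have hmm₂ : (m₂ : ℝ) ≤ m := by exact_mod_cast (by omega)
  have hA : (n * Real.log (8 * K) + 1) * 2 ≤ ω * c₁ * m := by
    rw [div_le_iff₀ (by positivity)] at hm₁
    refine hm₁.trans ?_
    rw [mul_comm]
    gcongr
  have hB : 2 * Real.log C' ≤ η * Real.log k * m := by
    rw [div_le_iff₀ (by positivity)] at hm₂
    refine hm₂.trans ?_
    rw [mul_comm]
    gcongr
  obtain ⟨D, hDp, hDm, hDl⟩ := exists_lacunary_seq hbad m (C := C₀ + 1) (by omega)
  choose b hb using hDp
  obtain ⟨d, hd⟩ : ∃ d : Fin n → ℕ, d = fun h => D h.rev := ⟨_, rfl⟩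
  obtain ⟨a, ha⟩ : ∃ a : Fin n → ℤ, a = fun h => b h.rev := ⟨_, rfl⟩
  have had : ∀ h, |(k : ℝ) ^ d h * ξ - a h| < (k : ℝ) ^ (-(ε * d h)) := fun h => by
    rw [hd, ha]; exact hb _
  have hmd : ∀ h, (m : ℝ) ≤ d h := fun h => by rw [hd]; exact_mod_cast hDm _
  have hd0 : ∀ h, (0 : ℝ) < d h := fun h => hm0.trans_le (hmd h)
  have hdl : ∀ i j : Fin n, i < j → (C₀ + 1 : ℝ) * d j ≤ d i := fun i j hij => by
    rw [hd]
    exact_mod_cast hDl _ _ (Fin.rev_lt_rev.mpr hij)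
  obtain ⟨R, hR⟩ : ∃ R : ℝ, R = (∑ h, (d h : ℝ)) / η := ⟨_, rfl⟩
  have hdR : ∀ h, (d h : ℝ) ≤ η * R := fun h => by
    rw [hR, mul_div_cancel₀ _ hη0.ne']
    exact Finset.single_le_sum (f := fun h => (d h : ℝ)) (fun _ _ => by positivity)
      (Finset.mem_univ h)
  have hR0 : 0 < R := by
    have h1 := hdR ⟨0, hn0⟩
    have h2 := hd0 ⟨0, hn0⟩
    by_contra h3
    nlinarith
  obtain ⟨r, hr⟩ : ∃ r : Fin n → ℕ, r = fun h => ⌈R / d h⌉₊ := ⟨_, rfl⟩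
  have hr0 : ∀ h, 0 < r h := fun h => by
    rw [hr]; exact Nat.ceil_pos.mpr (div_pos hR0 (hd0 h))
  have hr0' : ∀ h, (0 : ℝ) < r h := fun h => by exact_mod_cast hr0 h
  have hRr : ∀ h, R ≤ r h * d h := fun h => by
    rw [← div_le_iff₀ (hd0 h), hr]; exact Nat.le_ceil _
  have hrR : ∀ h, r h * d h ≤ (1 + η) * R := fun h => by
    have h1 : (r h : ℝ) < R / d h + 1 := by
      rw [hr]; exact Nat.ceil_lt_add_one (div_nonneg hR0.le (hd0 h).le)
    have h2 : (r h : ℝ) * d h ≤ (R / d h + 1) * d h := by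
      gcongr
    rw [add_mul, div_mul_cancel₀ _ (hd0 h).ne'] at h2
    linarith [hdR h]
  obtain ⟨ρ, hρ⟩ : ∃ ρ : ℝ, ρ = 2 * R / m := ⟨_, rfl⟩
  have hrρ : ∀ h, (r h : ℝ) ≤ ρ := fun h => by
    rw [hρ, le_div_iff₀ hm0]
    calc (r h : ℝ) * m ≤ r h * d h := by gcongr; exact_mod_cast hmd h
      _ ≤ (1 + η) * R := hrR h
      _ ≤ 2 * R := by gcongr; linarith
  have hsum : ((∑ h, r h : ℕ) : ℝ) ≤ n * ρ := by
    push_cast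
    refine (Finset.sum_le_sum fun h _ => hrρ h).trans ?_
    simp
  obtain ⟨P, hP0, hPdeg, hPl, hPw, hPv⟩ :=
    MvPolynomial.exists_auxiliary_polynomial hq hK hξ hη0 (by linarith) hn0 hn hr0
  have hl1 := MvPolynomial.one_le_l1_map hP0
  obtain ⟨β, hβ⟩ : ∃ β : Fin n → ℚ, β = fun h => (a h : ℚ) / (k : ℚ) ^ d h := ⟨_, rfl⟩
  have hβR : (fun h => (β h : ℝ)) = fun h => (a h : ℝ) / (k : ℝ) ^ d h := by
    rw [hβ]; push_cast; rfl
  obtain ⟨μ, hμ, hμw⟩ := hroth r β P ρ (c₁ * R) hP0 hPdeg hr0 hrρ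
    (fun i j hij => by
      have h1 := hdl i j hij
      have h2 : (r i : ℝ) * d i ≤ 2 * R := (hrR i).trans (by gcongr; linarith)
      have h3 : 2 ≤ ω * C₀ := by rw [div_le_iff₀ hω0] at hC₀; linarith
      have h4 : (2 : ℝ) * d j ≤ ω * d i := by nlinarith [hd0 j]
      have h5 := hRr j
      have h6 : (r i : ℝ) * d i * d j ≤ ω * r j * d i * d j := by
        calc (r i : ℝ) * d i * d j ≤ 2 * R * d j := by gcongr
          _ = R * (2 * d j) := by ring
          _ ≤ (r j * d j) * (ω * d i) := by gcongr
          _ = _ := by ring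
      exact le_of_mul_le_mul_right (le_of_mul_le_mul_right h6 (hd0 j)) (hd0 i))
    (fun h => by
      have h1 := hd₁ (d h) (by have := hmd h; have : m ≤ d h := by exact_mod_cast this
                               omega) (a h) ((had h).le.trans
          (Real.rpow_le_one_of_one_le_of_nonpos hk1.le (by have := hd0 h; nlinarith)))
      rw [← hc₁] at h1
      rw [hβ]
      calc c₁ * R ≤ c₁ * (r h * d h) := by gcongr; exact hRr h
        _ = r h * (c₁ * d h) := by ring
        _ ≤ _ := by gcongr)
    (by
      have h1 := Real.log_le_log (by linarith) hPl
      rw [Real.log_pow] at h1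
      have h2 : 0 ≤ Real.log (8 * K) := Real.log_nonneg (by linarith)
      calc _ ≤ n * ρ * Real.log (8 * K) + ρ := by
            gcongr
            exact h1.trans (by gcongr)
        _ = (n * Real.log (8 * K) + 1) * 2 / m * R := by rw [hρ]; ring
        _ ≤ (ω * c₁) * R := by
            gcongr
            rw [div_le_iff₀ hm0]; exact hA
        _ = _ := by ring)
  obtain ⟨v, hv⟩ : ∃ v, v = MvPolynomial.coeff μ (MvPolynomial.shift (fun h => (β h : ℝ))
    (MvPolynomial.map (Int.castRingHom ℝ) P)) := ⟨_, rfl⟩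
  rw [← hv] at hμ
  have hsplit : ∀ i : Fin n →₀ ℕ, ∑ h, (1 / (r h : ℝ)) * (i + μ) h =
      ∑ h, (1 / (r h : ℝ)) * i h + ∑ h, (1 / (r h : ℝ)) * μ h := fun i => by
    rw [← Finset.sum_add_distrib]
    refine Finset.sum_congr rfl fun h _ => ?_
    rw [Finsupp.add_apply]; push_cast; ring
  -- lower bound
  have hlow : 1 ≤ (k : ℝ) ^ ⌊(1 + η) * R * (n * (1 / 2 + η))⌋₊ * |v| := by
    have h1 : v = MvPolynomial.eval (fun h => (a h : ℝ) / (k : ℝ) ^ d h)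
        (MvPolynomial.map (Int.castRingHom ℝ) (MvPolynomial.hasse μ P)) := by
      rw [hv, MvPolynomial.coeff_shift, MvPolynomial.map_hasse, hβR]
    rw [h1]
    refine MvPolynomial.one_le_pow_mul_abs_eval (by omega) _ a d (fun i hi => ?_) (h1 ▸ hμ)
    have h2 : MvPolynomial.coeff (i + μ) P ≠ 0 := fun h0 => hi (by
      rw [MvPolynomial.coeff_hasse, h0, mul_zero])
    have h3 := hPw _ h2
    rw [hsplit] at h3
    have h4 : 0 ≤ ∑ h, (1 / (r h : ℝ)) * μ h := Finset.sum_nonneg fun h _ => by positivity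
    refine Nat.le_floor ?_
    push_cast
    calc ∑ h, (d h : ℝ) * i h ≤ ∑ h, (1 + η) * R * (1 / (r h : ℝ) * i h) := by
          refine Finset.sum_le_sum fun h _ => ?_
          have : (d h : ℝ) ≤ (1 + η) * R * (1 / r h) := by
            rw [mul_one_div, le_div_iff₀ (hr0' h), mul_comm]; exact hrR h
          rw [← mul_assoc]
          gcongr
      _ = (1 + η) * R * ∑ h, (1 / (r h : ℝ) * i h) := by rw [Finset.mul_sum]
      _ ≤ _ := by gcongr; linarith
  -- upper bound
  have hupp : |v| ≤ C' ^ (∑ h, r h) * (k : ℝ) ^ (-((1 + ε) * (R * (n * (1 / 2 - 2 * η))))) := by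
    have h1 := MvPolynomial.abs_coeff_shift_le (r := r) hξ0
      (P := MvPolynomial.map (Int.castRingHom ℝ) P)
      (fun h => (MvPolynomial.degreeOf_le_iff.mpr fun i hi => MvPolynomial.degreeOf_le_iff.mp
          (hPdeg h) i
        (MvPolynomial.support_map_subset _ _ hi))) (fun h => (β h : ℝ)) μ
      (B := (k : ℝ) ^ (-((1 + ε) * (R * (n * (1 / 2 - 2 * η)))))) (fun i hi => ?_) (by positivity)
    · rw [hv]
      refine h1.trans ?_
      rw [hC', mul_pow _ (8 * (K : ℝ))]
      gcongr
    · have h2 : n * (1 / 2 - η) ≤ ∑ h, (1 / (r h : ℝ)) * (i + μ) h := by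
        by_contra h; exact hi (hPv _ (not_le.mp h))
      rw [hsplit] at h2
      have h3 : R * (n * (1 / 2 - 2 * η)) ≤ ∑ h, (d h : ℝ) * i h := by
        calc R * (n * (1 / 2 - 2 * η)) ≤ R * ∑ h, (1 / (r h : ℝ)) * i h := by
              gcongr; linarith
          _ = ∑ h, R * (1 / (r h : ℝ)) * i h := by
              rw [Finset.mul_sum]; simp_rw [mul_assoc]
          _ ≤ _ := by
              refine Finset.sum_le_sum fun h _ => ?_
              gcongr
              rw [mul_one_div, div_le_iff₀ (hr0' h), mul_comm]; exact hRr h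
      have h4 : ∀ h, |(β h : ℝ) - ξ| ≤ (k : ℝ) ^ (-((1 + ε) * d h)) := fun h => by
        have h5 : (β h : ℝ) - ξ = -((k : ℝ) ^ d h * ξ - a h) * (k : ℝ) ^ (-(d h : ℝ)) := by
          rw [congrFun hβR h, Real.rpow_neg hk0.le, Real.rpow_natCast]
          field_simp
          ring
        rw [h5, abs_mul, abs_neg, abs_of_pos (by positivity : (0:ℝ) < (k : ℝ) ^ (-(d h : ℝ))),
          show -((1 + ε) * (d h : ℝ)) = -(ε * d h) + -(d h : ℝ) by ring, Real.rpow_add hk0]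
        gcongr
        exact (had h).le
      calc ∏ h, |(β h : ℝ) - ξ| ^ i h ≤ ∏ h, (k : ℝ) ^ (-((1 + ε) * (d h * i h))) := by
            refine Finset.prod_le_prod (fun _ _ => by positivity) fun h _ => ?_
            rw [← mul_assoc, ← neg_mul, Real.rpow_mul_natCast hk0.le]
            exact pow_le_pow_left₀ (abs_nonneg _) (h4 h) _
        _ = (k : ℝ) ^ (∑ h, -((1 + ε) * (d h * i h : ℝ))) := (Real.rpow_sum_of_pos hk0 _ _).symm
        _ ≤ _ := by
            rw [Finset.sum_neg_distrib, ← Finset.mul_sum]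
            gcongr
            exact hk1.le
  have hfin : 1 ≤ (k : ℝ) ^ ⌊(1 + η) * R * (n * (1 / 2 + η))⌋₊ *
      (C' ^ (∑ h, r h) * (k : ℝ) ^ (-((1 + ε) * (R * (n * (1 / 2 - 2 * η)))))) :=
    hlow.trans (by gcongr)
  have hlog := Real.log_nonneg hfin
  have hC'0 : 0 < C' := by linarith
  rw [Real.log_mul (by positivity) (by positivity), Real.log_mul (by positivity) (by positivity),
    Real.log_pow, Real.log_pow, Real.log_rpow hk0] at hlog
  have e1 : (⌊(1 + η) * R * (n * (1 / 2 + η))⌋₊ : ℝ) * Real.log k ≤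
      (1 + η) * R * (n * (1 / 2 + η)) * Real.log k := by
    gcongr; exact Nat.floor_le (by positivity)
  have e2 : ((∑ h, r h : ℕ) : ℝ) * Real.log C' ≤ R * n * Real.log k * η := by
    calc _ ≤ n * ρ * Real.log C' := by gcongr; exact Real.log_nonneg hC'1
      _ = n * R * (2 * Real.log C') / m := by rw [hρ]; ring
      _ ≤ n * R * (η * Real.log k * m) / m := by gcongr
      _ = _ := by field_simp
  have e3 : 0 ≤ R * n * Real.log k * ((1 + η) * (1 / 2 + η) + η - (1 + ε) * (1 / 2 - 2 * η)) := by
    refine hlog.trans ?_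
    linarith
  have e4 : 0 < R * n * Real.log k := by positivity
  have e5 := nonneg_of_mul_nonneg_right e3 e4
  have : ε = 100 * η := by rw [hη]; ring
  rw [this] at e5
  nlinarith

section ZetaApproximation

theorem hasDerivAt_ofReal_cpow {u : ℝ} (hu : 0 < u) (r : ℂ) :
    HasDerivAt (fun u : ℝ => (u : ℂ) ^ r) (r * (u : ℂ) ^ (r - 1)) u := by
  have := (hasDerivAt_id (u : ℂ)).cpow_const (c := r) (Or.inl (by simpa using hu))
  simpa using this.comp_ofReal

/-- `(s - 1)` times the Euler-Maclaurin approximation of `ζ(s)` with `n + 1` terms. -/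
noncomputable def zetaTrapezoid (n : ℕ) (s : ℂ) : ℂ :=
  (s - 1) * (∑ m ∈ Finset.range n, ((m + 1 : ℝ) : ℂ) ^ (-s) + 1 / 2 * ((n + 1 : ℝ) : ℂ) ^ (-s)) +
    ((n + 1 : ℝ) : ℂ) ^ (1 - s)

theorem norm_zetaTrapezoid_succ_sub_le (n : ℕ) {s : ℂ} (hs : -1 / 2 ≤ s.re) :
    ‖zetaTrapezoid (n + 1) s - zetaTrapezoid n s‖ ≤
      ‖s - 1‖ * ‖s‖ * ‖s + 1‖ * ((n + 1 : ℝ) ^ (-3 / 2 : ℝ)) := by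
  set M : ℝ := n + 1 with hM
  have hM1 : 1 ≤ M := by simp [hM]
  let g : ℝ → ℂ := fun x => (s - 1) * (1 / 2) * x * ((M : ℂ) ^ (-s) + ((M + x : ℝ) : ℂ) ^ (-s)) +
    ((M + x : ℝ) : ℂ) ^ (1 - s) - (M : ℂ) ^ (1 - s)
  let g1 : ℝ → ℂ := fun x => (s - 1) * (1 / 2) * ((M : ℂ) ^ (-s) - ((M + x : ℝ) : ℂ) ^ (-s) -
    s * x * ((M + x : ℝ) : ℂ) ^ (-s - 1))
  let g2 : ℝ → ℂ := fun x => (s - 1) * (1 / 2) * (s * (s + 1) * x * ((M + x : ℝ) : ℂ) ^ (-s - 2))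
  have hx0 : ∀ x ∈ Set.Icc (0 : ℝ) 1, 0 < M + x := fun x hx => by linarith [hx.1]
  have hder : ∀ r : ℂ, ∀ x ∈ Set.Icc (0 : ℝ) 1,
      HasDerivAt (fun x : ℝ => ((M + x : ℝ) : ℂ) ^ r) (r * ((M + x : ℝ) : ℂ) ^ (r - 1)) x := by
    intro r x hx
    simpa using (hasDerivAt_ofReal_cpow (hx0 x hx) r).comp_const_add M x
  have hid : ∀ x : ℝ, HasDerivAt (fun x : ℝ => (x : ℂ)) 1 x := fun x =>
    (hasDerivAt_id x).ofReal_comp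
  have hg : ∀ x ∈ Set.Icc (0 : ℝ) 1, HasDerivWithinAt g (g1 x) (Set.Icc 0 1) x := by
    intro x hx
    have h1 := ((((hid x).const_mul ((s - 1) * (1 / 2))).mul
      ((hder (-s) x hx).const_add ((M : ℂ) ^ (-s)))).add (hder (1 - s) x hx)).sub_const
        ((M : ℂ) ^ (1 - s))
    refine (HasDerivAt.congr_deriv (f := g) h1 ?_).hasDerivWithinAt
    simp only [g1]
    rw [show (1 : ℂ) - s - 1 = -s by ring]
    ring
  have hg1 : ∀ x ∈ Set.Icc (0 : ℝ) 1, HasDerivWithinAt g1 (g2 x) (Set.Icc 0 1) x := by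
    intro x hx
    have h1 := (((hder (-s) x hx).const_sub ((M : ℂ) ^ (-s))).sub
      (((hid x).const_mul s).mul (hder (-s - 1) x hx))).const_mul ((s - 1) * (1 / 2))
    refine (HasDerivAt.congr_deriv (f := g1) h1 ?_).hasDerivWithinAt
    simp only [g2]
    rw [show -s - 1 - 1 = -s - 2 by ring]
    ring
  set B : ℝ := ‖s - 1‖ * ‖s‖ * ‖s + 1‖ * M ^ (-3 / 2 : ℝ) with hB
  have hB0 : 0 ≤ B := by positivity
  have hg2B : ∀ x ∈ Set.Icc (0 : ℝ) 1, ‖g2 x‖ ≤ B := by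
    intro x hx
    have h1 : ‖((M + x : ℝ) : ℂ) ^ (-s - 2)‖ ≤ M ^ (-3 / 2 : ℝ) := by
      rw [norm_cpow_eq_rpow_re_of_pos (hx0 x hx)]
      calc (M + x) ^ (-s - 2).re ≤ (M + x) ^ (-3 / 2 : ℝ) := by
            apply Real.rpow_le_rpow_of_exponent_le (by linarith [hx.1])
            simp; linarith
        _ ≤ _ := Real.rpow_le_rpow_of_nonpos (by linarith) (by linarith [hx.1]) (by norm_num)
    have h2 : ‖(x : ℂ)‖ ≤ 1 := by
      rw [norm_real, Real.norm_eq_abs, abs_of_nonneg hx.1]; exact hx.2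
    simp only [g2, norm_mul]
    calc ‖s - 1‖ * ‖(1 / 2 : ℂ)‖ * (‖s‖ * ‖s + 1‖ * ‖(x : ℂ)‖ * ‖((M + x : ℝ) : ℂ) ^ (-s - 2)‖)
        ≤ ‖s - 1‖ * 1 * (‖s‖ * ‖s + 1‖ * 1 * M ^ (-3 / 2 : ℝ)) := by
          gcongr
          norm_num
      _ = B := by rw [hB]; ring
  have hg1B : ∀ x ∈ Set.Icc (0 : ℝ) 1, ‖g1 x‖ ≤ B := by
    intro x hx
    have h1 := norm_image_sub_le_of_norm_deriv_le_segment' hg1 (C := B)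
      (fun y hy => hg2B y ⟨hy.1, hy.2.le⟩) x hx
    have h2 : g1 0 = 0 := by simp [g1]
    rw [h2, sub_zero] at h1
    refine h1.trans ?_
    nlinarith [hx.1, hx.2]
  have h1 := norm_image_sub_le_of_norm_deriv_le_segment' hg (C := B)
      (fun y hy => hg1B y ⟨hy.1, hy.2.le⟩) 1 ⟨zero_le_one, le_rfl⟩
  have h2 : g 0 = 0 := by simp [g]
  rw [h2, sub_zero, sub_zero, mul_one] at h1
  have h3 : zetaTrapezoid (n + 1) s - zetaTrapezoid n s = g 1 := by
    simp only [g, zetaTrapezoid, Finset.sum_range_succ, hM]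
    push_cast
    ring
  rw [h3]
  exact h1

theorem tendsto_zetaTrapezoid_of_one_lt_re {s : ℂ} (hs : 1 < s.re) :
    Tendsto (fun n => zetaTrapezoid n s) atTop (nhds ((s - 1) * riemannZeta s)) := by
  have hat : Tendsto (fun n : ℕ => (n : ℝ) + 1) atTop atTop :=
    tendsto_atTop_add_const_right _ _ tendsto_natCast_atTop_atTop
  have h0 : ∀ r : ℂ, r.re < 0 →
      Tendsto (fun n : ℕ => ((n + 1 : ℝ) : ℂ) ^ r) atTop (nhds 0) := by
    intro r hr
    rw [tendsto_zero_iff_norm_tendsto_zero]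
    have h1 : ∀ n : ℕ, ‖((n + 1 : ℝ) : ℂ) ^ r‖ = (n + 1 : ℝ) ^ r.re := fun n =>
      norm_cpow_eq_rpow_re_of_pos (by positivity) r
    simp_rw [h1]
    have := (tendsto_rpow_neg_atTop (y := -r.re) (by linarith)).comp hat
    simpa [Function.comp_def] using this
  have h1 : HasSum (fun n : ℕ => ((n + 1 : ℝ) : ℂ) ^ (-s)) (riemannZeta s) := by
    rw [zeta_eq_tsum_one_div_nat_add_one_cpow hs]
    have h2 := (summable_nat_add_iff 1).mpr (Complex.summable_one_div_nat_cpow.mpr hs)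
    have h3 : (fun n : ℕ => ((n + 1 : ℝ) : ℂ) ^ (-s)) = fun n : ℕ => 1 / ((n : ℂ) + 1) ^ s := by
      ext n
      rw [cpow_neg]
      push_cast
      rw [one_div]
    rw [h3]
    push_cast at h2
    exact h2.hasSum
  have h2 := ((h1.tendsto_sum_nat.add ((h0 (-s) (by simp; linarith)).const_mul (1 / 2))).const_mul
    (s - 1)).add (h0 (1 - s) (by simp; linarith))
  simpa [zetaTrapezoid] using h2

theorem tendsto_zetaTrapezoid {s : ℂ} (hs : -1 / 2 < s.re) :
    Tendsto (fun n => zetaTrapezoid n s) atTop (nhds (riemannZeta₁ s)) := by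
  set R : ℝ := ‖s‖ + 3
  have hR : 3 ≤ R := by simp [R]
  set U : Set ℂ := {z | -1 / 2 < z.re} ∩ Metric.ball 0 R with hU
  have hUo : IsOpen U := (isOpen_lt continuous_const continuous_re).inter Metric.isOpen_ball
  have hUc : IsPreconnected U :=
    ((convex_halfSpace_re_gt (-1 / 2)).inter (convex_ball 0 R)).isPreconnected
  let d : ℕ → ℂ → ℂ := fun n z => zetaTrapezoid (n + 1) z - zetaTrapezoid n z
  let u : ℕ → ℝ := fun n => (R + 1) * R * (R + 1) * ((n + 1 : ℝ) ^ (-3 / 2 : ℝ))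
  have hu : Summable u := by
    apply Summable.mul_left
    have := (summable_nat_add_iff 1).mpr
        (Real.summable_nat_rpow.mpr (by norm_num : (-3 / 2 : ℝ) < -1))
    simpa using this
  have hdu : ∀ n, ∀ z ∈ U, ‖d n z‖ ≤ u n := by
    intro n z hz
    have hzR : ‖z‖ ≤ R := by exact (mem_ball_zero_iff.mp hz.2).le
    refine (norm_zetaTrapezoid_succ_sub_le n hz.1.le).trans ?_
    simp only [u]
    gcongr
    · refine (norm_sub_le _ _).trans ?_
      simpa using hzR
    · refine (norm_add_le _ _).trans ?_
      simpa using hzR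
  have htrap : ∀ n, Differentiable ℂ (zetaTrapezoid n) := by
    intro n z
    have hne : ∀ m : ℕ, ((m + 1 : ℝ) : ℂ) ≠ 0 := fun m => by
      exact_mod_cast (by positivity : (m + 1 : ℝ) ≠ 0)
    have hc : ∀ m : ℕ, ∀ f : ℂ → ℂ, DifferentiableAt ℂ f z →
        DifferentiableAt ℂ (fun s => ((m + 1 : ℝ) : ℂ) ^ (f s)) z := fun m f hf =>
      hf.const_cpow (Or.inl (hne m))
    have h1 := hc n (fun s => -s) (by fun_prop)
    have h2 := hc n (fun s => 1 - s) (by fun_prop)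
    have h3 : DifferentiableAt ℂ (fun s => ∑ m ∈ Finset.range n, ((m + 1 : ℝ) : ℂ) ^ (-s)) z :=
      DifferentiableAt.fun_sum fun m _ => hc m (fun s => -s) (by fun_prop)
    unfold zetaTrapezoid
    fun_prop
  let F : ℂ → ℂ := fun z => zetaTrapezoid 0 z + ∑' n, d n z
  have hF : DifferentiableOn ℂ F U := (htrap 0).differentiableOn.add
    (Complex.differentiableOn_tsum_of_summable_norm hu
      (fun n => ((htrap (n + 1)).sub (htrap n)).differentiableOn) hUo hdu)
  have hlim : ∀ z ∈ U, Tendsto (fun n => zetaTrapezoid n z) atTop (nhds (F z)) := by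
    intro z hz
    have h1 := (Summable.of_norm_bounded hu fun n => hdu n z hz).hasSum.tendsto_sum_nat.const_add
      (zetaTrapezoid 0 z)
    refine h1.congr fun n => ?_
    rw [Finset.sum_range_sub (fun n => zetaTrapezoid n z)]
    ring
  have hre : ∀ z : ℂ, 1 < z.re → (z - 1) * riemannZeta z = riemannZeta₁ z := by
    intro z hz
    have hz1 : z ≠ 1 := by rintro rfl; simp at hz
    rw [riemannZeta_eq_inv_sub_mul hz1, mul_inv_cancel_left₀ (sub_ne_zero.mpr hz1)]
  have h2U : (2 : ℂ) ∈ U := by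
    refine ⟨by simp; norm_num, ?_⟩
    simp
    linarith
  have heq : Set.EqOn F riemannZeta₁ U := by
    refine AnalyticOnNhd.eqOn_of_preconnected_of_eventuallyEq (hF.analyticOnNhd hUo)
      (differentiable_riemannZeta₁.differentiableOn.analyticOnNhd hUo) hUc h2U ?_
    have : {z : ℂ | 1 < z.re} ∩ U ∈ nhds (2 : ℂ) :=
      ((isOpen_lt continuous_const continuous_re).inter hUo).mem_nhds ⟨by norm_num, h2U⟩
    filter_upwards [this] with z hz
    exact tendsto_nhds_unique (hlim z hz.2)
      (hre z hz.1 ▸ tendsto_zetaTrapezoid_of_one_lt_re hz.1)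
  have hsU : s ∈ U := ⟨hs, by simp [R]⟩
  exact heq hsU ▸ hlim s hsU

end ZetaApproximation

section AbelSummation

/-- Abel summation against a bounded antitone weight. -/
theorem norm_sum_mul_sub_le {a b : ℕ} {η : ℕ → ℝ} {G : ℕ → ℂ} {H B : ℝ}
    (hη : ∀ m, a ≤ m → m + 1 < b → η (m + 1) ≤ η m) (hH : ∀ m, a ≤ m → m < b → |η m| ≤ H)
    (hG : ∀ m, a ≤ m → m ≤ b → ‖G m‖ ≤ B) (hB : 0 ≤ B) (hH0 : 0 ≤ H) :
    ‖∑ m ∈ Finset.Ico a b, (η m : ℂ) * (G m - G (m + 1))‖ ≤ 4 * H * B := by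
  rcases Nat.lt_or_ge a b with hab | hab
  swap
  · rw [Finset.Ico_eq_empty_of_le hab]; simp; positivity
  obtain ⟨n, rfl⟩ : ∃ n, b = a + n + 1 := ⟨b - a - 1, by omega⟩
  have key : ∀ j ≤ n, ‖∑ m ∈ Finset.Ico a (a + j + 1), (η m : ℂ) * (G m - G (m + 1)) +
      (η (a + j) : ℂ) * G (a + j + 1)‖ ≤ B * (|η a| + η a - η (a + j)) := by
    intro j
    induction j with
    | zero =>
      intro _
      simp only [add_zero]
      rw [Finset.sum_Ico_succ_top le_rfl, Finset.Ico_self, Finset.sum_empty, zero_add,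
        show (η a : ℂ) * (G a - G (a + 1)) + η a * G (a + 1) = η a * G a by ring, norm_mul,
        norm_real, Real.norm_eq_abs]
      have := hG a le_rfl (by omega)
      nlinarith [abs_nonneg (η a)]
    | succ j ih =>
      intro hj
      have h1 := ih (by omega)
      have h2 := hη (a + j) (by omega) (by omega)
      have h3 := hG (a + j + 1) (by omega) (by omega)
      rw [show a + (j + 1) = a + j + 1 by ring, Finset.sum_Ico_succ_top (by omega),
        show ∑ m ∈ Finset.Ico a (a + j + 1), (η m : ℂ) * (G m - G (m + 1)) +
          η (a + j + 1) * (G (a + j + 1) - G (a + j + 1 + 1)) +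
          η (a + j + 1) * G (a + j + 1 + 1) =
          (∑ m ∈ Finset.Ico a (a + j + 1), (η m : ℂ) * (G m - G (m + 1)) +
            η (a + j) * G (a + j + 1)) + ((η (a + j + 1) - η (a + j) : ℝ) : ℂ) * G (a + j + 1) by
          push_cast; ring]
      refine (norm_add_le _ _).trans ?_
      rw [norm_mul, norm_real, Real.norm_eq_abs, abs_of_nonpos (by linarith)]
      nlinarith
  have h1 := key n le_rfl
  have h2 := hG (a + n + 1) (by omega) le_rfl
  have h3 := hH a le_rfl (by omega)
  have h4 := hH (a + n) (by omega) (by omega)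
  have h5 : ‖(η (a + n) : ℂ) * G (a + n + 1)‖ ≤ H * B := by
    rw [norm_mul, norm_real, Real.norm_eq_abs]
    gcongr
  have h6 := norm_sub_le (∑ m ∈ Finset.Ico a (a + n + 1), (η m : ℂ) * (G m - G (m + 1)) +
      (η (a + n) : ℂ) * G (a + n + 1)) ((η (a + n) : ℂ) * G (a + n + 1))
  rw [add_sub_cancel_right] at h6
  have h7 : B * (|η a| + η a - η (a + n)) ≤ B * (3 * H) := by
    gcongr
    have := abs_le.mp h3
    have := abs_le.mp h4
    linarith
  linarith

theorem norm_sum_mul_le_of_antitone {a b : ℕ} {g : ℕ → ℝ} {z : ℕ → ℂ} {H B : ℝ}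
    (hg : ∀ m, a ≤ m → m + 1 < b → g (m + 1) ≤ g m) (hH : ∀ m, a ≤ m → m < b → |g m| ≤ H)
    (hz : ∀ m, a ≤ m → m ≤ b → ‖∑ j ∈ Finset.Ico a m, z j‖ ≤ B) (hB : 0 ≤ B) (hH0 : 0 ≤ H) :
    ‖∑ m ∈ Finset.Ico a b, (g m : ℂ) * z m‖ ≤ 4 * H * B := by
  have h1 := norm_sum_mul_sub_le (a := a) (b := b) (G := fun m => -∑ j ∈ Finset.Ico a m, z j)
    hg hH (fun m h1 h2 => by rw [norm_neg]; exact hz m h1 h2) hB hH0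
  convert h1 using 2
  refine Finset.sum_congr rfl fun m hm => ?_
  rw [Finset.sum_Ico_succ_top (Finset.mem_Ico.mp hm).1]
  ring

theorem norm_sum_mul_le_of_monotone {a b : ℕ} {g : ℕ → ℝ} {z : ℕ → ℂ} {H B : ℝ}
    (hg : ∀ m, a ≤ m → m + 1 < b → g m ≤ g (m + 1)) (hH : ∀ m, a ≤ m → m < b → |g m| ≤ H)
    (hz : ∀ m, a ≤ m → m ≤ b → ‖∑ j ∈ Finset.Ico a m, z j‖ ≤ B) (hB : 0 ≤ B) (hH0 : 0 ≤ H) :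
    ‖∑ m ∈ Finset.Ico a b, (g m : ℂ) * z m‖ ≤ 4 * H * B := by
  have h1 := norm_sum_mul_le_of_antitone (a := a) (b := b) (g := fun m => -g m)
    (fun m h1 h2 => neg_le_neg (hg m h1 h2)) (fun m h1 h2 => by rw [abs_neg]; exact hH m h1 h2)
    hz hB hH0
  rw [← norm_neg, ← Finset.sum_neg_distrib]
  simpa using h1

end AbelSummation

section ZetaApproximation

theorem sq_log_one_add_inv_mul_le {u : ℝ} (hu : 0 < u) :
    Real.log (1 + 1 / u) ^ 2 * (u * (u + 1)) ≤ 1 := by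
  set w := Real.log (1 + 1 / u) with hw
  have hw0 : 0 ≤ w := Real.log_nonneg (by have : 0 < 1 / u := by positivity
                                          linarith)
  have h1 : w / 2 ≤ Real.sinh (w / 2) := Real.self_le_sinh_iff.mpr (by linarith)
  have he : Real.exp w = 1 + 1 / u := Real.exp_log (by positivity)
  have h2 : (2 * Real.sinh (w / 2)) ^ 2 = 1 / (u * (u + 1)) := by
    have h3 : Real.exp (w / 2) ^ 2 = Real.exp w := by rw [← Real.exp_nat_mul]; congr 1; ring
    have h4 : Real.exp (w / 2) * Real.exp (-(w / 2)) = 1 := by rw [← Real.exp_add]; simp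
    have h5 : Real.exp (-(w / 2)) ^ 2 = (Real.exp w)⁻¹ := by
      rw [← Real.exp_neg, ← Real.exp_nat_mul]; congr 1; ring
    rw [Real.sinh_eq]
    calc (2 * ((Real.exp (w / 2) - Real.exp (-(w / 2))) / 2)) ^ 2
        = Real.exp (w / 2) ^ 2 + Real.exp (-(w / 2)) ^ 2 -
          2 * (Real.exp (w / 2) * Real.exp (-(w / 2))) := by ring
      _ = _ := by
        rw [h3, h4, h5, he]
        field_simp
        ring
  have h3 : w ^ 2 ≤ 1 / (u * (u + 1)) := by
    rw [← h2]
    gcongr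
    linarith
  rwa [le_div_iff₀ (by positivity)] at h3

/-- The real weight in the telescoping of the Euler-Maclaurin approximations to `ζ(it)`. -/
noncomputable def zetaWeight (t u : ℝ) : ℝ :=
  u + 1 / 2 - t / 2 * (Real.cos (t / 2 * Real.log (1 + 1 / u)) /
    Real.sin (t / 2 * Real.log (1 + 1 / u)))

theorem log_one_add_inv_le {u : ℝ} (hu : 0 < u) : Real.log (1 + 1 / u) ≤ 1 / u := by
  have := Real.log_le_sub_one_of_pos (by positivity : 0 < 1 + 1 / u)
  linarith

theorem log_one_add_inv_pos {u : ℝ} (hu : 0 < u) : 0 < Real.log (1 + 1 / u) :=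
  Real.log_pos (by have : 0 < 1 / u := by positivity
                   linarith)

theorem zetaWeight_arg {t u : ℝ} (ht : 0 < t) (htu : t ≤ u) :
    0 < t / 2 * Real.log (1 + 1 / u) ∧ t / 2 * Real.log (1 + 1 / u) ≤ 1 / 2 := by
  have hu : 0 < u := ht.trans_le htu
  have h1 := log_one_add_inv_pos hu
  refine ⟨by positivity, ?_⟩
  calc t / 2 * Real.log (1 + 1 / u) ≤ t / 2 * (1 / u) := by
        gcongr; exact log_one_add_inv_le hu
    _ = t / u / 2 := by ring
    _ ≤ 1 / 2 := by
        gcongr; rw [div_le_one hu]; exact htu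

theorem antitoneOn_zetaWeight {t : ℝ} (ht : 0 < t) : AntitoneOn (zetaWeight t) (Set.Ici t) := by
  have hder : ∀ u ∈ Set.Ici t, HasDerivAt (zetaWeight t)
      (1 - t ^ 2 / 4 / (Real.sin (t / 2 * Real.log (1 + 1 / u)) ^ 2 * (u * (u + 1)))) u := by
    intro u hu
    have hu0 : 0 < u := ht.trans_le hu
    obtain ⟨h1, h2⟩ := zetaWeight_arg ht hu
    have hs : Real.sin (t / 2 * Real.log (1 + 1 / u)) ≠ 0 :=
      (Real.sin_pos_of_pos_of_lt_pi h1 (by linarith [Real.pi_gt_three])).ne'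
    have h3 : HasDerivAt (fun u : ℝ => 1 + 1 / u) (-(u ^ 2)⁻¹) u := by
      simpa [one_div] using (hasDerivAt_inv hu0.ne').const_add 1
    have h4 := (h3.log (by positivity)).const_mul (t / 2)
    have h5 := (((hasDerivAt_id u).add_const (1 / 2)).sub
      (((h4.cos).div h4.sin hs).const_mul (t / 2)))
    refine HasDerivAt.congr_deriv (f := zetaWeight t) h5 ?_
    have h6 := Real.sin_sq_add_cos_sq (t / 2 * Real.log (1 + 1 / u))
    set S := Real.sin (t / 2 * Real.log (1 + 1 / u))
    set c := Real.cos (t / 2 * Real.log (1 + 1 / u))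
    have h7 : c ^ 2 = 1 - S ^ 2 := by linarith
    field_simp
    ring_nf
    rw [h7]
    ring
  refine antitoneOn_of_deriv_nonpos (convex_Ici t)
    (fun u hu => (hder u hu).continuousAt.continuousWithinAt)
    (fun u hu => (hder u (interior_subset hu)).differentiableAt.differentiableWithinAt) ?_
  intro u hu
  replace hu := interior_subset hu
  rw [(hder u hu).deriv]
  have hu0 : 0 < u := ht.trans_le hu
  obtain ⟨h1, h2⟩ := zetaWeight_arg ht hu
  have hs := Real.sin_pos_of_pos_of_lt_pi h1 (by linarith [Real.pi_gt_three])
  have h3 := Real.sin_le h1.le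
  have h4 := sq_log_one_add_inv_mul_le hu0
  rw [sub_nonpos, le_div_iff₀ (by positivity), one_mul]
  calc Real.sin (t / 2 * Real.log (1 + 1 / u)) ^ 2 * (u * (u + 1))
      ≤ (t / 2 * Real.log (1 + 1 / u)) ^ 2 * (u * (u + 1)) := by gcongr
    _ = t ^ 2 / 4 * (Real.log (1 + 1 / u) ^ 2 * (u * (u + 1))) := by ring
    _ ≤ t ^ 2 / 4 * 1 := by gcongr
    _ = _ := mul_one _

theorem abs_zetaWeight_le {t u A : ℝ} (ht : 0 < t) (hA : t ≤ A) (hu : A ≤ u) :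
    |zetaWeight t u| ≤ 1 / 2 + t ^ 2 / A := by
  have hu0 : 0 < u := ht.trans_le (hA.trans hu)
  have hA0 : 0 < A := ht.trans_le hA
  obtain ⟨h1, h2⟩ := zetaWeight_arg ht (hA.trans hu)
  have hs := Real.sin_pos_of_pos_of_lt_pi h1 (by linarith [Real.pi_gt_three])
  have hw := log_one_add_inv_pos hu0
  have hwu := log_one_add_inv_le hu0
  have hwl : 1 / (u + 1 / 2) ≤ Real.log (1 + 1 / u) := by
    have := Real.le_log_one_add_of_nonneg (x := 1 / u) (by positivity)
    refine le_trans (le_of_eq ?_) this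
    field_simp
    ring
  set w := Real.log (1 + 1 / u)
  set z := t / 2 * w with hz
  have hcl : 1 - z ^ 2 / 2 ≤ Real.cos z := Real.one_sub_sq_div_two_le_cos
  have hc0 : 0 < Real.cos z := by nlinarith
  have hsz := Real.sin_le h1.le
  have htan : z * Real.cos z ≤ Real.sin z := by
    have := Real.le_tan h1.le (by linarith [Real.pi_gt_three])
    rwa [Real.tan_eq_sin_div_cos, le_div_iff₀ hc0] at this
  have htz : t / 2 = z / w := by rw [hz]; field_simp
  have hup : t / 2 * (Real.cos z / Real.sin z) ≤ u + 1 / 2 := by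
    calc t / 2 * (Real.cos z / Real.sin z) = (z * Real.cos z) / Real.sin z / w := by
          rw [htz]; ring
      _ ≤ 1 / w := by
          gcongr
          rw [div_le_one hs]; exact htan
      _ ≤ u + 1 / 2 := by
          rw [div_le_iff₀ hw]
          rwa [div_le_iff₀ (by positivity), mul_comm] at hwl
  have hlo : u - t ^ 2 / A ≤ t / 2 * (Real.cos z / Real.sin z) := by
    calc u - t ^ 2 / A ≤ 1 / w - t ^ 2 * w := by
          have e1 : u ≤ 1 / w := by
            rw [le_div_iff₀ hw]
            rwa [le_div_iff₀ hu0, mul_comm] at hwu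
          have e2 : t ^ 2 * w ≤ t ^ 2 / A := by
            rw [div_eq_mul_one_div]
            gcongr
            exact hwu.trans (by gcongr)
          linarith
      _ ≤ (1 - z ^ 2 / 2) / w := by
          rw [sub_div]
          have : z ^ 2 / 2 / w = t ^ 2 * w / 8 := by rw [hz]; field_simp; ring
          rw [this]
          have : 0 ≤ t ^ 2 * w := by positivity
          linarith
      _ ≤ Real.cos z / w := by gcongr
      _ ≤ (z * (Real.cos z / Real.sin z)) / w := by
          gcongr
          rw [← mul_div_assoc, le_div_iff₀ hs, mul_comm]
          gcongr
      _ = _ := by rw [htz]; ring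
  have : 0 ≤ t ^ 2 / A := by positivity
  rw [zetaWeight, abs_le]
  constructor <;> linarith

theorem zetaTrapezoid_succ_sub {t : ℝ} (n : ℕ)
    (hs : Real.sin (t / 2 * Real.log (1 + 1 / (n + 1 : ℝ))) ≠ 0) :
    zetaTrapezoid (n + 1) (t * I) - zetaTrapezoid n (t * I) =
      (zetaWeight t (n + 1 : ℝ) : ℂ) *
        (((n + 1 + 1 : ℝ) : ℂ) ^ (-(t * I)) - ((n + 1 : ℝ) : ℂ) ^ (-(t * I))) := by
  set M : ℝ := n + 1 with hM
  have hM0 : 0 < M := by positivity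
  set w := Real.log (1 + 1 / M) with hw
  set z := t / 2 * w with hz
  have hMC : (M : ℂ) ≠ 0 := by exact_mod_cast hM0.ne'
  have hM1C : ((M + 1 : ℝ) : ℂ) ≠ 0 := by exact_mod_cast (by positivity : M + 1 ≠ 0)
  have e1 : ((M + 1 : ℝ) : ℂ) ^ (-(t * I)) = (M : ℂ) ^ (-(t * I)) * cexp (-(2 * z * I)) := by
    have : M + 1 = M * (1 + 1 / M) := by field_simp
    rw [this, ofReal_mul, mul_cpow_ofReal_nonneg hM0.le (by positivity)]
    congr 1
    rw [cpow_def_of_ne_zero (by exact_mod_cast (by positivity : 1 + 1 / M ≠ 0)), ← ofReal_log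
      (by positivity), ← hw, hz]
    congr 1
    push_cast
    ring
  have e2 : (M : ℂ) ^ (1 - t * I) = M * (M : ℂ) ^ (-(t * I)) := by
    rw [sub_eq_add_neg, cpow_add _ _ hMC, cpow_one]
  have e3 : ((M + 1 : ℝ) : ℂ) ^ (1 - t * I) =
      ((M + 1 : ℝ) : ℂ) * ((M + 1 : ℝ) : ℂ) ^ (-(t * I)) := by
    rw [sub_eq_add_neg, cpow_add _ _ hM1C, cpow_one]
  have hsC : Complex.sin z ≠ 0 := by exact_mod_cast hs
  have e4 : cexp (-(2 * z * I)) = (Complex.cos z - Complex.sin z * I) ^ 2 := by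
    have : Complex.cos z - Complex.sin z * I = cexp (-(z * I)) := by
      have := Complex.exp_mul_I (-(z : ℂ))
      rw [Complex.cos_neg, Complex.sin_neg, neg_mul] at this
      rw [this]; ring
    rw [this, ← Complex.exp_nat_mul]
    congr 1
    push_cast; ring
  have e5 := Complex.sin_sq_add_cos_sq (z : ℂ)
  simp only [zetaTrapezoid, Finset.sum_range_succ]
  have hM' : ((n + 1 : ℕ) : ℝ) + 1 = M + 1 := by push_cast; rw [hM]
  rw [hM', ← hM, e3, e2, e1, e4, zetaWeight, ← hw, ← hz]
  push_cast
  set S := Complex.sin z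
  set c := Complex.cos z
  set G := (M : ℂ) ^ (-(t * I))
  have key : I * (1 + (c - S * I) ^ 2) = c / S * (1 - (c - S * I) ^ 2) := by
    field_simp
    have hI := Complex.I_sq
    linear_combination (c - S * I) * e5 + (S ^ 3 * I - c * S ^ 2) * hI
  linear_combination (t / 2 * G) * key

theorem norm_zetaTrapezoid_sub_le {t : ℝ} (ht : t ≠ 0) {a b : ℕ} (hab : a ≤ b)
    (hta : |t| ≤ a + 1) :
    ‖zetaTrapezoid b (t * I) - zetaTrapezoid a (t * I)‖ ≤ 4 * (1 / 2 + t ^ 2 / (a + 1)) := by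
  have hτ : 0 < |t| := abs_pos.mpr ht
  have habs : ∀ u, zetaWeight t u = zetaWeight |t| u := fun u => by
    rcases abs_choice t with h | h
    · rw [h]
    · rw [h, zetaWeight, zetaWeight, show -t / 2 * Real.log (1 + 1 / u) =
        -(t / 2 * Real.log (1 + 1 / u)) by ring, Real.cos_neg, Real.sin_neg, div_neg]
      ring
  have hcast : ∀ m : ℕ, a ≤ m → |t| ≤ (m + 1 : ℝ) := fun m hm => by
    have : (a : ℝ) ≤ m := by exact_mod_cast hm
    linarith
  have hsum : zetaTrapezoid b (t * I) - zetaTrapezoid a (t * I) =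
      ∑ m ∈ Finset.Ico a b, (zetaWeight |t| (m + 1 : ℝ) : ℂ) *
        (-((m + 1 : ℝ) : ℂ) ^ (-(t * I)) - -(((m + 1 : ℕ) : ℝ) + 1 : ℝ) ^ (-(t * I))) := by
    rw [← Finset.sum_Ico_sub (fun n => zetaTrapezoid n (t * I)) hab]
    refine Finset.sum_congr rfl fun m hm => ?_
    obtain ⟨h1, h2⟩ := zetaWeight_arg hτ (hcast m (Finset.mem_Ico.mp hm).1)
    rw [zetaTrapezoid_succ_sub, ← habs]
    · push_cast
      ring
    · have h3 := (Real.sin_pos_of_pos_of_lt_pi h1 (by linarith [Real.pi_gt_three])).ne'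
      rcases abs_choice t with h | h
      · rwa [h] at h3
      · rwa [h, neg_div, neg_mul, Real.sin_neg, neg_ne_zero] at h3
  rw [hsum]
  have h1 := norm_sum_mul_sub_le (a := a) (b := b) (η := fun m => zetaWeight |t| (m + 1 : ℝ))
    (G := fun m => -((m + 1 : ℝ) : ℂ) ^ (-(t * I))) (H := 1 / 2 + |t| ^ 2 / (a + 1)) (B := 1)
    (fun m hm _ => antitoneOn_zetaWeight hτ (hcast m hm)
      (by push_cast; exact (hcast m hm).trans (by linarith)) (by push_cast; linarith))
    (fun m hm _ => abs_zetaWeight_le hτ hta (by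
      have : (a : ℝ) ≤ m := by exact_mod_cast hm
      linarith))
    (fun m _ _ => by
      rw [norm_neg, norm_cpow_eq_rpow_re_of_pos (by positivity)]
      simp) zero_le_one (by positivity)
  rw [sq_abs, mul_one] at h1
  exact h1

/-- Approximation of `ζ(it)` by its first terms, once their number exceeds `|t|`. -/
theorem norm_riemannZeta_sub_le {t : ℝ} (ht : t ≠ 0) {a : ℕ} (hta : |t| ≤ a + 1) :
    ‖riemannZeta (t * I) - zetaTrapezoid a (t * I) / (t * I - 1)‖ ≤
      2 / |t| + 4 * |t| / (a + 1) := by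
  have h1 : ‖riemannZeta₁ (t * I) - zetaTrapezoid a (t * I)‖ ≤ 4 * (1 / 2 + t ^ 2 / (a + 1)) := by
    refine le_of_tendsto ((tendsto_zetaTrapezoid (s := t * I) (by simp; norm_num)).sub_const
        _).norm ?_
    filter_upwards [eventually_ge_atTop a] with b hb
    exact norm_zetaTrapezoid_sub_le ht hb hta
  have hs1 : (t * I : ℂ) ≠ 1 := fun h => by
    have := congrArg Complex.re h
    simp at this
  have hτ : 0 < |t| := abs_pos.mpr ht
  have h2 : |t| ≤ ‖(t * I : ℂ) - 1‖ := by
    have := Complex.abs_im_le_norm ((t * I : ℂ) - 1)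
    simpa using this
  rw [riemannZeta_eq_inv_sub_mul hs1, inv_mul_eq_div, ← sub_div, norm_div]
  calc _ ≤ 4 * (1 / 2 + t ^ 2 / (a + 1)) / |t| := by gcongr
    _ = _ := by
      rw [← sq_abs t]
      field_simp
      ring

end ZetaApproximation

section Sawtooth

/-- The error in approximating the sawtooth by its Fourier series, on `(0, 1)`. -/
noncomputable def sawError (N : ℕ) (x : ℝ) : ℝ :=
  ∑ n ∈ Finset.range N, Real.sin (2 * Real.pi * (n + 1) * x) / (n + 1) + Real.pi * (x - 1 / 2)

theorem sin_mul_dirichlet (N : ℕ) (x : ℝ) :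
    Real.sin (Real.pi * x) * (1 + 2 * ∑ n ∈ Finset.range N, Real.cos (2 * Real.pi * (n + 1) * x)) =
      Real.sin ((2 * N + 1) * (Real.pi * x)) := by
  induction N with
  | zero => simp
  | succ N ih =>
    rw [Finset.sum_range_succ, mul_add 2, ← add_assoc, mul_add, ih]
    have h1 : (2 * ((N + 1 : ℕ) : ℝ) + 1) * (Real.pi * x) =
        2 * Real.pi * (N + 1) * x + Real.pi * x := by push_cast; ring
    have h2 : (2 * (N : ℝ) + 1) * (Real.pi * x) = 2 * Real.pi * (N + 1) * x - Real.pi * x := by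
      ring
    rw [h1, h2, Real.sin_add, Real.sin_sub]
    ring

theorem hasDerivAt_sawError (N : ℕ) {x : ℝ} (hx : Real.sin (Real.pi * x) ≠ 0) :
    HasDerivAt (sawError N)
      (Real.pi * Real.sin ((2 * N + 1) * (Real.pi * x)) / Real.sin (Real.pi * x)) x := by
  have h1 : ∀ n ∈ Finset.range N, HasDerivAt
      (fun x => Real.sin (2 * Real.pi * (n + 1) * x) / (n + 1))
      (2 * Real.pi * Real.cos (2 * Real.pi * (n + 1) * x)) x := by
    intro n _
    have := (((hasDerivAt_id x).const_mul (2 * Real.pi * (n + 1))).sin).div_const ((n : ℝ) + 1)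
    refine HasDerivAt.congr_deriv this ?_
    have : (n : ℝ) + 1 ≠ 0 := by positivity
    simp only [id]
    field_simp
  have h2 := (HasDerivAt.fun_sum h1).add
    (((hasDerivAt_id x).sub_const (1 / 2)).const_mul Real.pi)
  refine HasDerivAt.congr_deriv (f := sawError N) h2 ?_
  rw [← sin_mul_dirichlet, ← Finset.mul_sum]
  generalize ∑ n ∈ Finset.range N, Real.cos (2 * Real.pi * (n + 1) * x) = T
  field_simp
  ring

theorem abs_sub_le_of_abs_deriv_le {f h f' h' : ℝ → ℝ} {a b : ℝ} (hab : a ≤ b)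
    (hf : ∀ x ∈ Set.Icc a b, HasDerivAt f (f' x) x) (hh : ∀ x ∈ Set.Icc a b, HasDerivAt h (h' x) x)
    (hle : ∀ x ∈ Set.Icc a b, |f' x| ≤ -h' x) : |f a - f b| ≤ h a - h b := by
  have key : ∀ s : ℝ, |s| = 1 → s * (f b - f a) ≤ h a - h b := by
    intro s hs
    have hd : ∀ x ∈ Set.Icc a b, HasDerivAt (fun x => s * f x + h x) (s * f' x + h' x) x :=
      fun x hx => ((hf x hx).const_mul s).add (hh x hx)
    have hanti : AntitoneOn (fun x => s * f x + h x) (Set.Icc a b) := by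
      refine antitoneOn_of_deriv_nonpos (convex_Icc a b)
        (fun u hu => (hd u hu).continuousAt.continuousWithinAt)
        (fun u hu => (hd u (interior_subset hu)).differentiableAt.differentiableWithinAt) ?_
      intro x hx
      replace hx := interior_subset hx
      rw [(hd x hx).deriv]
      have h1 := hle x hx
      have h2 : s * f' x ≤ |f' x| := by
        have := le_abs_self (s * f' x)
        rwa [abs_mul, hs, one_mul] at this
      linarith
    have := hanti (Set.left_mem_Icc.mpr hab) (Set.right_mem_Icc.mpr hab) hab
    simp only at this
    linarith
  have h1 := key 1 (by simp)
  have h2 := key (-1) (by simp)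
  rw [abs_le]
  constructor <;> linarith

theorem sin_natCast_half_odd (N : ℕ) : Real.cos ((2 * N + 1) * (Real.pi * (1 / 2))) = 0 := by
  have : (2 * N + 1) * (Real.pi * (1 / 2)) = N * Real.pi + Real.pi / 2 := by ring
  rw [this, Real.cos_add_pi_div_two, Real.sin_nat_mul_pi, neg_zero]

theorem sawError_half (N : ℕ) : sawError N (1 / 2) = 0 := by
  have : ∀ n ∈ Finset.range N, Real.sin (2 * Real.pi * (n + 1) * (1 / 2)) / (n + 1) = 0 := by
    intro n _
    have : 2 * Real.pi * ((n : ℝ) + 1) * (1 / 2) = ((n + 1 : ℕ) : ℝ) * Real.pi := by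
      push_cast; ring
    rw [this, Real.sin_nat_mul_pi, zero_div]
  rw [sawError, Finset.sum_eq_zero this]
  ring

theorem sawError_bounds_aux (N : ℕ) {x : ℝ} (hx0 : 0 < x) (hx1 : x ≤ 1 / 2) :
    |sawError N x + Real.cos ((2 * N + 1) * (Real.pi * x)) /
        ((2 * N + 1) * Real.sin (Real.pi * x))| ≤ 1 / ((2 * N + 1) * Real.sin (Real.pi * x)) ∧
    |sawError N x + Real.cos ((2 * N + 1) * (Real.pi * x)) /
        ((2 * N + 1) * Real.sin (Real.pi * x))| ≤
      2 / ((2 * N + 1) ^ 2 * Real.sin (Real.pi * x) ^ 2) := by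
  have hpi := Real.pi_pos
  obtain ⟨M, hM⟩ : ∃ M : ℝ, M = 2 * N + 1 := ⟨_, rfl⟩
  have hM0 : 0 < M := by rw [hM]; positivity
  have hsin : ∀ y ∈ Set.Icc x (1 / 2), 0 < Real.sin (Real.pi * y) := fun y hy =>
    Real.sin_pos_of_pos_of_lt_pi (mul_pos hpi (hx0.trans_le hy.1)) (by nlinarith [hy.2])
  have hcos : ∀ y ∈ Set.Icc x (1 / 2), 0 ≤ Real.cos (Real.pi * y) := fun y hy =>
    Real.cos_nonneg_of_neg_pi_div_two_le_of_le (by nlinarith [hy.1]) (by nlinarith [hy.2])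
  have hds : ∀ y, HasDerivAt (fun y => Real.sin (Real.pi * y))
      (Real.cos (Real.pi * y) * Real.pi) y := fun y => by
    simpa using ((hasDerivAt_id y).const_mul Real.pi).sin
  have hdc : ∀ y, HasDerivAt (fun y => Real.cos (Real.pi * y))
      (-(Real.sin (Real.pi * y) * Real.pi)) y := fun y => by
    simpa using ((hasDerivAt_id y).const_mul Real.pi).cos
  have hdsM : ∀ y, HasDerivAt (fun y => Real.sin (M * (Real.pi * y)))
      (Real.cos (M * (Real.pi * y)) * (M * Real.pi)) y := fun y => by
    simpa using (((hasDerivAt_id y).const_mul Real.pi).const_mul M).sin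
  have hdcM : ∀ y, HasDerivAt (fun y => Real.cos (M * (Real.pi * y)))
      (-(Real.sin (M * (Real.pi * y)) * (M * Real.pi))) y := fun y => by
    simpa using (((hasDerivAt_id y).const_mul Real.pi).const_mul M).cos
  have hf : ∀ y ∈ Set.Icc x (1 / 2), HasDerivAt
      (fun y => sawError N y + Real.cos (M * (Real.pi * y)) / (M * Real.sin (Real.pi * y)))
      (-(Real.pi * Real.cos (M * (Real.pi * y)) * Real.cos (Real.pi * y) /
        (M * Real.sin (Real.pi * y) ^ 2))) y := by
    intro y hy
    have hs := (hsin y hy).ne'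
    have h1 := (hasDerivAt_sawError N hs).add
      ((hdcM y).div ((hds y).const_mul M) (mul_ne_zero hM0.ne' hs))
    refine HasDerivAt.congr_deriv h1 ?_
    rw [← hM]
    field_simp
    ring
  have hh : ∀ y ∈ Set.Icc x (1 / 2), HasDerivAt (fun y => 1 / (M * Real.sin (Real.pi * y)))
      (-(Real.pi * Real.cos (Real.pi * y) / (M * Real.sin (Real.pi * y) ^ 2))) y := by
    intro y hy
    have hs := (hsin y hy).ne'
    have h1 := (hasDerivAt_const y (1 : ℝ)).div ((hds y).const_mul M) (mul_ne_zero hM0.ne' hs)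
    refine HasDerivAt.congr_deriv h1 ?_
    field_simp
    ring
  have hf2 : ∀ y ∈ Set.Icc x (1 / 2), HasDerivAt
      (fun y => sawError N y + Real.cos (M * (Real.pi * y)) / (M * Real.sin (Real.pi * y)) +
        Real.sin (M * (Real.pi * y)) * Real.cos (Real.pi * y) /
          (M ^ 2 * Real.sin (Real.pi * y) ^ 2))
      (-(Real.sin (M * (Real.pi * y)) * (Real.pi * (Real.sin (Real.pi * y) ^ 2 +
        2 * Real.cos (Real.pi * y) ^ 2) / (M ^ 2 * Real.sin (Real.pi * y) ^ 3)))) y := by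
    intro y hy
    have hs := (hsin y hy).ne'
    have h1 := (hf y hy).add (((hdsM y).mul (hdc y)).div (((hds y).pow 2).const_mul (M ^ 2))
      (mul_ne_zero (pow_ne_zero 2 hM0.ne') (pow_ne_zero 2 hs)))
    refine HasDerivAt.congr_deriv h1 ?_
    simp only [Pi.mul_apply, Pi.pow_apply]
    field_simp
    push_cast
    ring
  have hh2 : ∀ y ∈ Set.Icc x (1 / 2), HasDerivAt
      (fun y => Real.cos (Real.pi * y) / (M ^ 2 * Real.sin (Real.pi * y) ^ 2))
      (-(Real.pi * (Real.sin (Real.pi * y) ^ 2 +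
        2 * Real.cos (Real.pi * y) ^ 2) / (M ^ 2 * Real.sin (Real.pi * y) ^ 3))) y := by
    intro y hy
    have hs := (hsin y hy).ne'
    have h1 := (hdc y).div (((hds y).pow 2).const_mul (M ^ 2))
      (mul_ne_zero (pow_ne_zero 2 hM0.ne') (pow_ne_zero 2 hs))
    refine HasDerivAt.congr_deriv h1 ?_
    simp only [Pi.pow_apply]
    field_simp
    push_cast
    ring
  have k1 := abs_sub_le_of_abs_deriv_le hx1 hf hh (fun y hy => by
    have hs := hsin y hy
    have hc := hcos y hy
    rw [abs_neg, neg_neg, abs_div, abs_mul, abs_mul, abs_of_pos hpi, abs_of_nonneg hc,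
      abs_of_pos (by positivity : 0 < M * Real.sin (Real.pi * y) ^ 2)]
    gcongr
    have := Real.abs_cos_le_one (M * (Real.pi * y))
    nlinarith)
  have k2 := abs_sub_le_of_abs_deriv_le hx1 hf2 hh2 (fun y hy => by
    have hs := hsin y hy
    have hpos : 0 ≤ Real.pi * (Real.sin (Real.pi * y) ^ 2 +
        2 * Real.cos (Real.pi * y) ^ 2) / (M ^ 2 * Real.sin (Real.pi * y) ^ 3) := by positivity
    rw [abs_neg, neg_neg, abs_mul, abs_of_nonneg hpos]
    have := Real.abs_sin_le_one (M * (Real.pi * y))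
    nlinarith)
  have hM' : Real.cos (M * (Real.pi * (1 / 2))) = 0 := by rw [hM]; exact sin_natCast_half_odd N
  have hhalf : Real.sin (Real.pi * (1 / 2)) = 1 := by
    rw [mul_one_div, Real.sin_pi_div_two]
  have hhalf' : Real.cos (Real.pi * (1 / 2)) = 0 := by
    rw [mul_one_div, Real.cos_pi_div_two]
  simp only [sawError_half, hM', hhalf, hhalf', zero_div, mul_zero, add_zero, sub_zero,
    mul_one] at k1 k2
  rw [← hM]
  have hs := hsin x ⟨le_rfl, hx1⟩
  have hc := hcos x ⟨le_rfl, hx1⟩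
  refine ⟨k1.trans (sub_le_self _ (by positivity)), ?_⟩
  have h3 : |Real.sin (M * (Real.pi * x)) * Real.cos (Real.pi * x) /
      (M ^ 2 * Real.sin (Real.pi * x) ^ 2)| ≤ 1 / (M ^ 2 * Real.sin (Real.pi * x) ^ 2) := by
    rw [abs_div, abs_mul, abs_of_pos (by positivity : 0 < M ^ 2 * Real.sin (Real.pi * x) ^ 2)]
    gcongr
    exact mul_le_one₀ (Real.abs_sin_le_one _) (abs_nonneg _) (Real.abs_cos_le_one _)
  have h4 : Real.cos (Real.pi * x) / (M ^ 2 * Real.sin (Real.pi * x) ^ 2) ≤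
      1 / (M ^ 2 * Real.sin (Real.pi * x) ^ 2) := by
    gcongr
    exact Real.cos_le_one _
  have h5 := abs_sub (sawError N x + Real.cos (M * (Real.pi * x)) / (M * Real.sin (Real.pi * x)) +
        Real.sin (M * (Real.pi * x)) * Real.cos (Real.pi * x) /
          (M ^ 2 * Real.sin (Real.pi * x) ^ 2))
              (Real.sin (M * (Real.pi * x)) * Real.cos (Real.pi * x) /
      (M ^ 2 * Real.sin (Real.pi * x) ^ 2))
  rw [add_sub_cancel_right] at h5
  calc _ ≤ _ := h5
    _ ≤ 1 / (M ^ 2 * Real.sin (Real.pi * x) ^ 2) + 1 / (M ^ 2 * Real.sin (Real.pi * x) ^ 2) :=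
      add_le_add (k2.trans h4) h3
    _ = _ := by ring

theorem sawError_one_sub (N : ℕ) (x : ℝ) : sawError N (1 - x) = -sawError N x := by
  have : ∀ n : ℕ, Real.sin (2 * Real.pi * (n + 1) * (1 - x)) =
      -Real.sin (2 * Real.pi * (n + 1) * x) := fun n => by
    have : 2 * Real.pi * (n + 1) * (1 - x) =
        -(2 * Real.pi * (n + 1) * x) + ((n + 1 : ℕ) : ℝ) * (2 * Real.pi) := by push_cast; ring
    rw [this, Real.sin_add_nat_mul_two_pi, Real.sin_neg]
  simp only [sawError, this, neg_div, Finset.sum_neg_distrib]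
  ring

theorem cos_odd_mul_one_sub (N : ℕ) (x : ℝ) : Real.cos ((2 * N + 1) * (Real.pi * (1 - x))) =
    -Real.cos ((2 * N + 1) * (Real.pi * x)) := by
  have : (2 * N + 1) * (Real.pi * (1 - x)) =
      Real.pi - (2 * N + 1) * (Real.pi * x) + (N : ℝ) * (2 * Real.pi) := by ring
  rw [this, Real.cos_add_nat_mul_two_pi, Real.cos_pi_sub]

theorem sawError_bounds (N : ℕ) {x : ℝ} (hx0 : 0 < x) (hx1 : x < 1) :
    |sawError N x + Real.cos ((2 * N + 1) * (Real.pi * x)) /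
        ((2 * N + 1) * Real.sin (Real.pi * x))| ≤ 1 / ((2 * N + 1) * Real.sin (Real.pi * x)) ∧
    |sawError N x + Real.cos ((2 * N + 1) * (Real.pi * x)) /
        ((2 * N + 1) * Real.sin (Real.pi * x))| ≤
      2 / ((2 * N + 1) ^ 2 * Real.sin (Real.pi * x) ^ 2) := by
  rcases le_or_gt x (1 / 2) with h | h
  · exact sawError_bounds_aux N hx0 h
  · have h1 := sawError_bounds_aux N (x := 1 - x) (by linarith) (by linarith)
    have h2 : Real.sin (Real.pi * (1 - x)) = Real.sin (Real.pi * x) := by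
      rw [mul_sub, mul_one, Real.sin_pi_sub]
    rw [h2, sawError_one_sub, cos_odd_mul_one_sub, neg_div, ← neg_add, abs_neg] at h1
    exact h1

theorem abs_sawError_le (N : ℕ) {x : ℝ} (hx0 : 0 < x) (hx1 : x < 1) :
    |sawError N x| ≤ 2 / ((2 * N + 1) * Real.sin (Real.pi * x)) := by
  have hs : 0 < Real.sin (Real.pi * x) := Real.sin_pos_of_pos_of_lt_pi (by positivity)
    (by nlinarith [Real.pi_pos])
  have h1 := (sawError_bounds N hx0 hx1).1
  have h2 := abs_sub (sawError N x + Real.cos ((2 * N + 1) * (Real.pi * x)) /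
        ((2 * N + 1) * Real.sin (Real.pi * x))) (Real.cos ((2 * N + 1) * (Real.pi * x)) /
        ((2 * N + 1) * Real.sin (Real.pi * x)))
  rw [add_sub_cancel_right] at h2
  have h3 : |Real.cos ((2 * N + 1) * (Real.pi * x)) / ((2 * N + 1) * Real.sin (Real.pi * x))| ≤
      1 / ((2 * N + 1) * Real.sin (Real.pi * x)) := by
    rw [abs_div, abs_of_pos (by positivity : 0 < (2 * N + 1) * Real.sin (Real.pi * x))]
    gcongr
    exact Real.abs_cos_le_one _
  calc _ ≤ _ := h2
    _ ≤ 1 / ((2 * N + 1) * Real.sin (Real.pi * x)) + 1 / ((2 * N + 1) * Real.sin (Real.pi * x)) :=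
      add_le_add h1 h3
    _ = _ := by ring

theorem two_mul_le_sin_pi {x : ℝ} (hx0 : 0 ≤ x) (hx1 : x ≤ 1 / 2) :
    2 * x ≤ Real.sin (Real.pi * x) := by
  have := Real.mul_le_sin (x := Real.pi * x) (by positivity) (by nlinarith [Real.pi_pos])
  calc 2 * x = 2 / Real.pi * (Real.pi * x) := by field_simp
    _ ≤ _ := this

theorem min_le_sin_pi {x : ℝ} (hx0 : 0 ≤ x) (hx1 : x ≤ 1) :
    2 * min x (1 - x) ≤ Real.sin (Real.pi * x) := by
  rcases le_or_gt x (1 / 2) with h | h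
  · rw [min_eq_left (by linarith)]
    exact two_mul_le_sin_pi hx0 h
  · rw [min_eq_right (by linarith)]
    have := two_mul_le_sin_pi (x := 1 - x) (by linarith) (by linarith)
    rwa [mul_sub Real.pi, mul_one, Real.sin_pi_sub] at this

theorem abs_sawError_le_const_aux (N : ℕ) {x : ℝ} (hx0 : 0 ≤ x) (hx1 : x ≤ 1 / 2) :
    |sawError N x| ≤ 10 := by
  have hpi := Real.pi_pos
  have hpi4 := Real.pi_lt_four
  rcases le_or_gt ((2 * N + 1) * x) 1 with h | h
  · have h1 : ∀ n ∈ Finset.range N, |Real.sin (2 * Real.pi * (n + 1) * x) / (n + 1)| ≤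
        2 * Real.pi * x := by
      intro n _
      have hn : (0 : ℝ) < n + 1 := by positivity
      rw [abs_div, abs_of_pos hn, div_le_iff₀ hn]
      refine Real.abs_sin_le_abs.trans ?_
      rw [abs_of_nonneg (by positivity)]
      exact le_of_eq (by ring)
    have h2 := (Finset.abs_sum_le_sum_abs _ _).trans (Finset.sum_le_sum h1)
    rw [Finset.sum_const, Finset.card_range, nsmul_eq_mul] at h2
    have h3 : |Real.pi * (x - 1 / 2)| ≤ 2 := by
      rw [abs_le]; constructor <;> nlinarith
    refine (abs_add_le _ _).trans ?_
    have h4 : (N : ℝ) * (2 * Real.pi * x) ≤ 4 := by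
      have : 2 * (N : ℝ) * x ≤ 1 := by nlinarith
      nlinarith
    linarith
  · have hx0' : 0 < x := by
      rcases hx0.eq_or_lt with h0 | h0
      · rw [← h0] at h; norm_num at h
      · exact h0
    refine (abs_sawError_le N hx0' (by linarith)).trans ?_
    have h1 := two_mul_le_sin_pi hx0 hx1
    have h2 : 2 ≤ (2 * N + 1) * Real.sin (Real.pi * x) := by nlinarith
    rw [div_le_iff₀ (by linarith)]
    linarith

theorem abs_sawError_le_const (N : ℕ) {x : ℝ} (hx0 : 0 ≤ x) (hx1 : x ≤ 1) :
    |sawError N x| ≤ 10 := by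
  rcases le_or_gt x (1 / 2) with h | h
  · exact abs_sawError_le_const_aux N hx0 h
  · have := abs_sawError_le_const_aux N (x := 1 - x) (by linarith) (by linarith)
    rwa [sawError_one_sub, abs_neg] at this

theorem abs_sum_sin_div_le (N : ℕ) (y : ℝ) :
    |∑ n ∈ Finset.range N, Real.sin ((n + 1) * y) / (n + 1)| ≤ 12 := by
  have hpi := Real.pi_pos
  set x := Int.fract (y / (2 * Real.pi)) with hx
  have h1 := abs_sawError_le_const N (Int.fract_nonneg (y / (2 * Real.pi)))
    (Int.fract_lt_one _).le
  rw [← hx] at h1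
  have h2 : ∀ n : ℕ, Real.sin ((n + 1) * y) = Real.sin (2 * Real.pi * (n + 1) * x) := fun n => by
    have : (n + 1) * y = 2 * Real.pi * (n + 1) * x +
        (((n + 1) * ⌊y / (2 * Real.pi)⌋ : ℤ) : ℝ) * (2 * Real.pi) := by
      rw [hx, Int.fract]
      push_cast
      field_simp
      ring
    rw [this, Real.sin_add_int_mul_two_pi]
  have h3 : |Real.pi * (x - 1 / 2)| ≤ 2 := by
    have h4 := Int.fract_nonneg (y / (2 * Real.pi))
    have h5 := Int.fract_lt_one (y / (2 * Real.pi))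
    rw [← hx] at h4 h5
    have := Real.pi_lt_four
    rw [abs_le]; constructor <;> nlinarith
  simp_rw [h2]
  have h4 := abs_sub (sawError N x) (Real.pi * (x - 1 / 2))
  rw [sawError, add_sub_cancel_right] at h4
  rw [sawError] at h1
  linarith

/-- Partial sums of `∑ sin (c (j + 1/2)) / (j + 1/2)` are bounded uniformly in `c`. -/
theorem abs_sum_sin_half_div_le (J : ℕ) (c : ℝ) :
    |∑ j ∈ Finset.range J, Real.sin (c * (j + 1 / 2)) / (j + 1 / 2)| ≤ 36 := by
  have key : ∑ j ∈ Finset.range J, Real.sin (c * (j + 1 / 2)) / (j + 1 / 2) =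
      2 * ∑ n ∈ Finset.range (2 * J), Real.sin ((n + 1) * (c / 2)) / (n + 1) -
        ∑ n ∈ Finset.range J, Real.sin ((n + 1) * c) / (n + 1) := by
    induction J with
    | zero => simp
    | succ J ih =>
      rw [Finset.sum_range_succ, ih, show 2 * (J + 1) = 2 * J + 1 + 1 by ring,
        Finset.sum_range_succ _ (2 * J + 1), Finset.sum_range_succ _ (2 * J),
        Finset.sum_range_succ _ J]
      push_cast
      have e1 : (2 * (J : ℝ) + 1) * (c / 2) = c * (J + 1 / 2) := by ring
      have e2 : (2 * (J : ℝ) + 1 + 1) * (c / 2) = (J + 1) * c := by ring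
      rw [e1, e2]
      have h1 : (J : ℝ) + 1 / 2 ≠ 0 := by positivity
      have h2 : (2 * J : ℝ) + 1 ≠ 0 := by positivity
      have h3 : (J : ℝ) + 1 ≠ 0 := by positivity
      have h4 : (2 * J : ℝ) + 1 + 1 ≠ 0 := by positivity
      have e3 : Real.sin (c * (J + 1 / 2)) / ((J : ℝ) + 1 / 2) =
          2 * (Real.sin (c * (J + 1 / 2)) / (2 * J + 1)) := by field_simp
      have e4 : Real.sin ((J + 1) * c) / ((J : ℝ) + 1) =
          2 * (Real.sin ((J + 1) * c) / (2 * J + 1 + 1)) := by field_simp; ring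
      rw [e3, e4]
      ring
  rw [key]
  have h1 := abs_sum_sin_div_le (2 * J) (c / 2)
  have h2 := abs_sum_sin_div_le J c
  refine (abs_sub _ _).trans ?_
  rw [abs_mul, abs_two]
  linarith

end Sawtooth

section ExpFourier

/-- The mean-zero combination `x - 1/2 + 1/c - exp (c x) / (exp c - 1)` of a sawtooth and an
exponential, which takes the same value at `0` and `1`. -/
noncomputable def expSaw (c x : ℝ) : ℝ :=
  x - 1 / 2 + 1 / c - Real.exp (c * x) / (Real.exp c - 1)

theorem expSaw_zero_eq_one {c : ℝ} (hc : 0 < c) : expSaw c 0 = expSaw c 1 := by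
  have : Real.exp c - 1 ≠ 0 := by
    have := Real.add_one_lt_exp hc.ne'
    linarith
  simp only [expSaw, mul_zero, mul_one, Real.exp_zero]
  field_simp
  ring

theorem continuous_expSaw (c : ℝ) : Continuous (expSaw c) := by
  unfold expSaw
  fun_prop

theorem integral_expSaw {c : ℝ} (hc : 0 < c) (n : ℤ) (hn : n ≠ 0) :
    ∫ x in (0 : ℝ)..1, Complex.exp (-(2 * Real.pi * I * n) * x) * (expSaw c x : ℂ) =
      -1 / (2 * Real.pi * I * n) - 1 / (c - 2 * Real.pi * I * n) := by
  obtain ⟨w, hw⟩ : ∃ w : ℂ, w = 2 * Real.pi * I * n := ⟨_, rfl⟩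
  rw [← hw]
  have hw0 : w ≠ 0 := by
    rw [hw]; simp [Real.pi_ne_zero, hn]
  have hcw : (c : ℂ) - w ≠ 0 := by
    intro h
    have := congrArg Complex.re h
    rw [hw] at this
    simp at this
    exact hc.ne' this
  have hc0 : (c : ℂ) ≠ 0 := by exact_mod_cast hc.ne'
  have hK : Real.exp c - 1 ≠ 0 := by
    have := Real.add_one_lt_exp hc.ne'
    linarith
  have hKc : Complex.exp c - 1 ≠ 0 := by
    rw [← Complex.ofReal_exp]; exact_mod_cast hK
  have hew : Complex.exp (-w) = 1 := by
    rw [Complex.exp_neg, hw, Complex.exp_eq_one_iff.mpr ⟨n, by ring⟩, inv_one]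
  have hd : ∀ x : ℝ, HasDerivAt (fun x : ℝ =>
      -((x : ℂ) - 1 / 2 + 1 / c) * Complex.exp (-w * x) / w - Complex.exp (-w * x) / w ^ 2 -
        Complex.exp ((c - w) * x) / ((Complex.exp c - 1) * (c - w)))
      (Complex.exp (-w * x) * (expSaw c x : ℂ)) x := by
    intro x
    have h0 : HasDerivAt (fun x : ℝ => (x : ℂ)) 1 x := Complex.ofRealCLM.hasDerivAt
    have he : ∀ a : ℂ, HasDerivAt (fun x : ℝ => Complex.exp (a * x))
        (Complex.exp (a * x) * (a * 1)) x := fun a => (h0.const_mul a).cexp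
    have h1 := ((((((h0.sub_const (1 / 2)).add_const (1 / (c : ℂ))).neg).mul (he (-w))).div_const
      w).sub ((he (-w)).div_const (w ^ 2))).sub
      ((he (c - w)).div_const ((Complex.exp c - 1) * (c - w)))
    refine HasDerivAt.congr_deriv h1 ?_
    simp only [expSaw]
    push_cast
    have : Complex.exp ((c - w) * x) = Complex.exp (c * x) * Complex.exp (-w * x) := by
      rw [← Complex.exp_add]; ring_nf
    rw [this]
    generalize Complex.exp (-w * x) = E
    simp only [Pi.neg_apply]
    field_simp
    ring
  rw [intervalIntegral.integral_eq_sub_of_hasDerivAt (fun x _ => hd x)]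
  · have h1 : Complex.exp ((c - w) * (1 : ℝ)) = Complex.exp c := by
      rw [Complex.ofReal_one, mul_one, sub_eq_add_neg, Complex.exp_add, hew, mul_one]
    rw [h1]
    simp only [Complex.ofReal_one, Complex.ofReal_zero, mul_one, mul_zero, hew, Complex.exp_zero]
    field_simp
    ring
  · apply Continuous.intervalIntegrable
    have := continuous_expSaw c
    fun_prop

theorem integral_expSaw_zero {c : ℝ} (hc : 0 < c) : ∫ x in (0 : ℝ)..1, expSaw c x = 0 := by
  have hK : Real.exp c - 1 ≠ 0 := by
    have := Real.add_one_lt_exp hc.ne'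
    linarith
  have hd : ∀ x : ℝ, HasDerivAt (fun x : ℝ => x ^ 2 / 2 - x / 2 + x / c -
      Real.exp (c * x) / (c * (Real.exp c - 1))) (expSaw c x) x := by
    intro x
    have h1 := (((((hasDerivAt_id x).pow 2).div_const 2).sub
      ((hasDerivAt_id x).div_const 2)).add ((hasDerivAt_id x).div_const c)).sub
      ((((hasDerivAt_id x).const_mul c).exp).div_const (c * (Real.exp c - 1)))
    refine HasDerivAt.congr_deriv h1 ?_
    simp only [expSaw, id]
    field_simp
    push_cast
    ring
  rw [intervalIntegral.integral_eq_sub_of_hasDerivAt (fun x _ => hd x)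
    ((continuous_expSaw c).intervalIntegrable _ _)]
  simp only [mul_zero, mul_one, Real.exp_zero]
  field_simp
  ring

theorem norm_one_sub_ge {c : ℝ} (hc : 0 < c) (n : ℤ) :
    2 * Real.pi * |(n : ℝ)| / c ≤ ‖(1 : ℂ) - 2 * Real.pi * n / c * I‖ := by
  have h : (1 : ℂ) - 2 * Real.pi * n / c * I =
    ⟨1, -(2 * Real.pi * n / c)⟩ := by
    apply Complex.ext <;> simp [Complex.div_re, Complex.div_im, field]
  rw [h]
  refine le_trans (le_of_eq ?_) (Complex.abs_im_le_norm _)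
  rw [abs_neg, abs_div, abs_mul, abs_of_pos hc, abs_of_pos (by positivity : 0 < 2 * Real.pi)]

theorem hasSum_expSaw {c : ℝ} (hc : 0 < c) {x : ℝ} (hx : x ∈ Set.Ico (0 : ℝ) 1) :
    HasSum (fun n : ℤ => Complex.exp (2 * Real.pi * I * n * x) /
      (n * (1 - 2 * Real.pi * n / c * I))) (-2 * Real.pi * I * expSaw c x) := by
  have hfact : Fact ((0 : ℝ) < 1) := ⟨one_pos⟩
  have hc0 : (c : ℂ) ≠ 0 := by exact_mod_cast hc.ne'
  let f : ℝ → ℂ := fun x => (expSaw c x : ℂ)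
  have hf : Continuous f := Complex.continuous_ofReal.comp (continuous_expSaw c)
  have hcont : Continuous (AddCircle.liftIco (1 : ℝ) 0 f) :=
    AddCircle.liftIco_zero_continuous (by simp only [f, expSaw_zero_eq_one hc]) hf.continuousOn
  let B : C(AddCircle (1 : ℝ), ℂ) := ⟨_, hcont⟩
  have hcoef : ∀ n : ℤ, fourierCoeff B n =
      (-1 / (2 * Real.pi * I)) * (1 / (n * (1 - 2 * Real.pi * n / c * I))) := by
    intro n
    change fourierCoeff (AddCircle.liftIco (1 : ℝ) 0 f) n = _
    rw [fourierCoeff_liftIco_eq, fourierCoeffOn_eq_integral]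
    have h3 : ∫ x in (0 : ℝ)..0 + 1, (fourier (-n) (x : AddCircle (0 + 1 - 0 : ℝ)) : ℂ) • f x =
        ∫ x in (0 : ℝ)..1, Complex.exp (-(2 * Real.pi * I * n) * x) * (expSaw c x : ℂ) := by
      rw [zero_add]
      refine intervalIntegral.integral_congr fun x _ => ?_
      rw [fourier_coe_apply, smul_eq_mul]
      congr 2
      push_cast
      ring
    rw [h3]
    rcases eq_or_ne n 0 with rfl | hn
    · have := integral_expSaw_zero hc
      have h9 : ∫ x in (0 : ℝ)..1, (expSaw c x : ℂ) = 0 := by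
        rw [intervalIntegral.integral_ofReal, this, Complex.ofReal_zero]
      simp [h9]
    · have h4 : (2 * Real.pi * I : ℂ) ≠ 0 := Complex.two_pi_I_ne_zero
      have h5 : (n : ℂ) ≠ 0 := by exact_mod_cast hn
      have h6 : (c : ℂ) - 2 * Real.pi * I * n ≠ 0 := by
        intro h
        have := congrArg Complex.re h
        simp at this
        exact hc.ne' this
      have h7 : (1 : ℂ) - 2 * Real.pi * n / c * I = (c - 2 * Real.pi * I * n) / c := by
        field_simp
      have h8 : (Real.pi : ℂ) ≠ 0 := by exact_mod_cast Real.pi_ne_zero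
      rw [integral_expSaw hc n hn, h7]
      simp only [zero_add, sub_zero, div_one, one_smul]
      field_simp
      ring
  have hsum : Summable (fourierCoeff B) := by
    refine Summable.of_norm_bounded (g := fun n : ℤ => c / (4 * Real.pi ^ 2) * |1 / (n : ℝ) ^ 2|)
      (((Real.summable_one_div_int_pow (p := 2)).mpr one_lt_two).abs.mul_left _) fun n => ?_
    rw [hcoef]
    rcases eq_or_ne n 0 with rfl | hn
    · simp
    have hn' : 0 < |(n : ℝ)| := by positivity
    have h1 := norm_one_sub_ge hc n
    have hpi := Real.pi_pos
    have h2 : 0 < 2 * Real.pi * |(n : ℝ)| / c := by positivity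
    have h3 : ‖(-1 : ℂ) / (2 * Real.pi * I)‖ = 1 / (2 * Real.pi) := by
      simp [abs_of_pos hpi]
    rw [norm_mul, h3, norm_div, norm_mul, norm_one, Complex.norm_intCast, abs_of_nonneg
      (by positivity : (0 : ℝ) ≤ 1 / (n : ℝ) ^ 2)]
    calc 1 / (2 * Real.pi) * (1 / (|(n : ℝ)| * ‖(1 : ℂ) - 2 * Real.pi * n / c * I‖))
        ≤ 1 / (2 * Real.pi) * (1 / (|(n : ℝ)| * (2 * Real.pi * |(n : ℝ)| / c))) := by gcongr
      _ = c / (4 * Real.pi ^ 2) * (1 / |(n : ℝ)| ^ 2) := by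
        field_simp
        ring
      _ = _ := by rw [sq_abs]
  have h1 := (has_pointwise_sum_fourier_series_of_summable hsum (x : AddCircle (1 : ℝ))).mul_left
    (-2 * Real.pi * I)
  have h2 : B (x : AddCircle (1 : ℝ)) = (expSaw c x : ℂ) :=
    AddCircle.liftIco_zero_coe_apply (f := f) hx
  rw [h2] at h1
  refine Eq.mp (congrArg (fun g => HasSum g _) (funext fun n => ?_)) h1
  rw [hcoef, fourier_coe_apply, smul_eq_mul]
  have h3 : (2 * Real.pi * I : ℂ) ≠ 0 := Complex.two_pi_I_ne_zero
  rw [Complex.ofReal_one, div_one]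
  generalize (n : ℂ) * (1 - 2 * Real.pi * n / c * I) = D
  generalize Complex.exp (2 * Real.pi * I * n * x) = E
  have h4 : (Real.pi : ℂ) ≠ 0 := by exact_mod_cast Real.pi_ne_zero
  have := I_ne_zero
  field_simp

/-- The general term of the Fourier series of `-2 π i * expSaw c`. -/
noncomputable def expSawTerm (c x : ℝ) (n : ℤ) : ℂ :=
  Complex.exp (2 * Real.pi * I * n * x) / (n * (1 - 2 * Real.pi * n / c * I))

theorem norm_expSawTerm_le {c : ℝ} (hc : 0 < c) (x : ℝ) {n : ℤ} (hn : n ≠ 0) :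
    ‖expSawTerm c x n‖ ≤ c / (2 * Real.pi * |(n : ℝ)| ^ 2) := by
  have hn' : 0 < |(n : ℝ)| := by positivity
  have hpi := Real.pi_pos
  have h2 : 0 < 2 * Real.pi * |(n : ℝ)| / c := by positivity
  have h3 : ‖Complex.exp (2 * Real.pi * I * n * x)‖ = 1 := by
    have : (2 * Real.pi * I * n * x : ℂ) = ((2 * Real.pi * n * x : ℝ) : ℂ) * I := by
      push_cast; ring
    rw [this, Complex.norm_exp_ofReal_mul_I]
  rw [expSawTerm, norm_div, h3, norm_mul, Complex.norm_intCast]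
  calc 1 / (|(n : ℝ)| * ‖(1 : ℂ) - 2 * Real.pi * n / c * I‖)
      ≤ 1 / (|(n : ℝ)| * (2 * Real.pi * |(n : ℝ)| / c)) := by
        gcongr
        exact norm_one_sub_ge hc n
    _ = _ := by field_simp

theorem norm_sum_expSawTerm_sub_le {c : ℝ} (hc : 0 < c) {x : ℝ} (hx : x ∈ Set.Ico (0 : ℝ) 1)
    {N : ℕ} (hN : 1 ≤ N) :
    ‖∑ n ∈ Finset.range N, (expSawTerm c x (n + 1) + expSawTerm c x (-(n + 1))) -
      (-2 * Real.pi * I * expSaw c x)‖ ≤ c / (Real.pi * N) := by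
  have hpi := Real.pi_pos
  have hs : HasSum (fun n : ℕ => expSawTerm c x (n + 1) + expSawTerm c x (-(n + 1)))
      (-2 * Real.pi * I * expSaw c x) := by
    have h1 := (hasSum_expSaw hc hx).nat_add_neg
    have h2 := (hasSum_nat_add_iff' 1).mpr h1
    simpa [expSawTerm] using h2
  have hstep : ∀ n : ℕ, ‖expSawTerm c x (n + 1) + expSawTerm c x (-(n + 1))‖ ≤
      c / (Real.pi * ((n : ℝ) + 1) ^ 2) := by
    intro n
    have hn : ((n : ℤ) + 1) ≠ 0 := by positivity
    have h1 := norm_expSawTerm_le hc x hn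
    have h2 := norm_expSawTerm_le hc x (neg_ne_zero.mpr hn)
    have h3 : |((-((n : ℤ) + 1) : ℤ) : ℝ)| = (n : ℝ) + 1 := by
      push_cast; rw [abs_neg, abs_of_nonneg (by positivity)]
    have h4 : |(((n : ℤ) + 1 : ℤ) : ℝ)| = (n : ℝ) + 1 := by
      push_cast; rw [abs_of_nonneg (by positivity)]
    rw [h3] at h2
    rw [h4] at h1
    refine (norm_add_le _ _).trans ((add_le_add h1 h2).trans (le_of_eq ?_))
    field_simp
    ring
  have hfin : ∀ M : ℕ, N ≤ M → ‖∑ n ∈ Finset.range N,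
      (expSawTerm c x (n + 1) + expSawTerm c x (-(n + 1))) - ∑ n ∈ Finset.range M,
      (expSawTerm c x (n + 1) + expSawTerm c x (-(n + 1)))‖ ≤
          c / (Real.pi * N) - c / (Real.pi * M) := by
    intro M hM
    induction M, hM using Nat.le_induction with
    | base => simp
    | succ M hM ih =>
      rw [Finset.sum_range_succ, ← sub_sub]
      refine (norm_sub_le _ _).trans ((add_le_add ih (hstep M)).trans ?_)
      have hM0 : 0 < (M : ℝ) := by exact_mod_cast hN.trans hM
      have : c / (Real.pi * ((M : ℝ) + 1) ^ 2) ≤ c / (Real.pi * M) - c / (Real.pi * (M + 1)) := by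
        have h : c / (Real.pi * M) - c / (Real.pi * (M + 1)) = c / (Real.pi * (M * (M + 1))) := by
          field_simp
          ring
        rw [h]
        gcongr
        nlinarith
      push_cast
      linarith
  refine le_of_tendsto ((tendsto_const_nhds.sub hs.tendsto_sum_nat).norm) ?_
  filter_upwards [eventually_ge_atTop N] with M hM
  have := hfin M hM
  have h0 : 0 ≤ c / (Real.pi * M) := by positivity
  linarith

end ExpFourier

section FractIdentity

theorem log_factorial_stirling_bounds (a : ℕ) :
    ((a : ℝ) + 1) * Real.log (a + 1) - (a + 1) - Real.log (a + 1) / 2 ≤ Real.log a.factorial ∧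
    Real.log a.factorial ≤
      ((a : ℝ) + 1) * Real.log (a + 1) - (a + 1) - Real.log (a + 1) / 2 + 1 := by
  have h1 := Stirling.log_stirlingSeq_formula (a + 1)
  have h2 := Stirling.log_stirlingSeq_bounded_by_constant a
  have h3 : Real.log (Stirling.stirlingSeq (a + 1)) ≤ 1 - Real.log 2 / 2 := by
    have h := Stirling.log_stirlingSeq'_antitone (Nat.zero_le a)
    simp only [Function.comp, Nat.succ_eq_add_one, zero_add, Stirling.stirlingSeq_one] at h
    rwa [Real.log_div (by positivity) (by positivity), Real.log_exp, Real.log_sqrt (by norm_num)]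
      at h
  have h4 : Real.log (a + 1).factorial = Real.log (a + 1) + Real.log a.factorial := by
    rw [Nat.factorial_succ, Nat.cast_mul, Real.log_mul (by positivity) (by positivity)]
    push_cast
    rfl
  have hA : (0 : ℝ) < (a : ℝ) + 1 := by positivity
  rw [h4, Real.log_mul (by norm_num) (by positivity), Real.log_div (by positivity) (by positivity),
    Real.log_exp] at h1
  push_cast at h1
  constructor <;> linarith

theorem sum_log_add_one (a : ℕ) :
    ∑ m ∈ Finset.range a, Real.log ((m : ℝ) + 1) = Real.log a.factorial := by
  induction a with
  | zero => simp
  | succ a ih =>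
    rw [Finset.sum_range_succ, ih, Nat.factorial_succ, Nat.cast_mul,
      Real.log_mul (by positivity) (by positivity)]
    push_cast
    ring

variable {k : ℕ} {α : ℝ}

theorem rpow_lt_iff_logb {k : ℝ} (hk : 1 < k) {y x : ℝ} (hx : 0 < x) :
    k ^ y < x ↔ y < Real.log x / Real.log k := by
  rw [lt_div_iff₀ (Real.log_pos hk), ← Real.log_rpow (by linarith),
    Real.log_lt_log_iff (Real.rpow_pos_of_pos (by linarith) _) hx]

theorem fract_sub_log_eq (hk : 2 ≤ k) (hα1 : α < 1) {J m : ℕ}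
    (hJ : (m : ℝ) + 1 ≤ (k : ℝ) ^ (J + α)) :
    Int.fract (α - Real.log ((m : ℝ) + 1) / Real.log k) =
      α - Real.log ((m : ℝ) + 1) / Real.log k +
        ∑ d ∈ Finset.range J, if (k : ℝ) ^ (d + α) < (m : ℝ) + 1 then 1 else 0 := by
  have hk1 : (1 : ℝ) < k := by exact_mod_cast hk
  have hm : (0 : ℝ) < (m : ℝ) + 1 := by positivity
  obtain ⟨x, hx⟩ : ∃ x, x = α - Real.log ((m : ℝ) + 1) / Real.log k := ⟨_, rfl⟩
  have hx1 : x < 1 := by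
    have : 0 ≤ Real.log ((m : ℝ) + 1) / Real.log k :=
      div_nonneg (Real.log_nonneg (by linarith [m.cast_nonneg (α := ℝ)])) (Real.log_pos hk1).le
    linarith
  have hxJ : -(J : ℝ) ≤ x := by
    have := (rpow_lt_iff_logb hk1 (y := J + α) hm).not.mp (not_lt.mpr hJ)
    linarith
  rw [Finset.sum_boole]
  have hcard : (Finset.range J).filter (fun d : ℕ => (k : ℝ) ^ (d + α) < (m : ℝ) + 1) =
      Finset.range ⌈-x⌉₊ := by
    ext d
    rw [Finset.mem_filter, Finset.mem_range, Finset.mem_range, rpow_lt_iff_logb hk1 hm,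
      Nat.lt_ceil]
    constructor
    · rintro ⟨_, h⟩
      linarith
    · intro h
      refine ⟨?_, by linarith⟩
      have : (d : ℝ) < J := by linarith
      exact_mod_cast this
  rw [hcard, Finset.card_range, ← hx, Int.fract]
  have h1 : ((⌈-x⌉₊ : ℕ) : ℤ) = ⌈-x⌉ := Int.natCast_ceil_eq_ceil_of_neg_one_lt (by linarith)
  have h2 : ((⌈-x⌉₊ : ℕ) : ℝ) = ((⌈-x⌉ : ℤ) : ℝ) := by exact_mod_cast h1
  rw [h2, Int.ceil_neg]
  push_cast
  ring

theorem sum_range_boole_lt {a : ℕ} {κ : ℝ} (h0 : 0 ≤ κ) (h : κ < (a : ℝ) + 1) :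
    ∑ m ∈ Finset.range a, (if κ < (m : ℝ) + 1 then (1 : ℝ) else 0) = a - κ + Int.fract κ := by
  rw [Finset.sum_boole]
  have h1 : (Finset.range a).filter (fun m : ℕ => κ < (m : ℝ) + 1) = Finset.Ico ⌊κ⌋₊ a := by
    ext m
    rw [Finset.mem_filter, Finset.mem_range, Finset.mem_Ico, and_comm]
    refine and_congr_left fun _ => ?_
    rw [← Nat.lt_succ_iff, Nat.floor_lt h0]
    push_cast
    rfl
  have h2 : ⌊κ⌋₊ ≤ a := by
    rw [← Nat.lt_succ_iff, Nat.floor_lt h0]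
    push_cast
    exact h
  rw [h1, Nat.card_Ico, Nat.cast_sub h2, natCast_floor_eq_intCast_floor h0, Int.fract]
  ring

theorem abs_sum_fract_identity_le (hk : 2 ≤ k) (hα0 : 0 ≤ α) (hα1 : α < 1) {J a : ℕ}
    (hJ : ∀ d : ℕ, d < J ↔ (k : ℝ) ^ (d + α) < (a : ℝ) + 1) :
    |∑ m ∈ Finset.range a, (Int.fract (α - Real.log ((m : ℝ) + 1) / Real.log k) - 1 / 2) +
      1 / 2 * (Int.fract (α - Real.log ((a : ℝ) + 1) / Real.log k) - 1 / 2) -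
      ((a : ℝ) + 1) * expSaw (Real.log k)
        (Int.fract (α - Real.log ((a : ℝ) + 1) / Real.log k)) -
      ∑ d ∈ Finset.range J, (Int.fract ((k : ℝ) ^ (d + α)) - 1 / 2)| ≤ 3 + 1 / Real.log k := by
  have hk1 : (1 : ℝ) < k := by exact_mod_cast hk
  have hk0 : (0 : ℝ) < k := by linarith
  have hk2 : (2 : ℝ) ≤ k := by exact_mod_cast hk
  have hlog := Real.log_pos hk1
  obtain ⟨c, hc⟩ : ∃ c, c = Real.log k := ⟨_, rfl⟩
  have hA : (0 : ℝ) < (a : ℝ) + 1 := by positivity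
  have hAJ : (a : ℝ) + 1 ≤ (k : ℝ) ^ (J + α) := not_lt.mp ((hJ J).not.mp (lt_irrefl _))
  have h1 : ∀ m ∈ Finset.range a,
      Int.fract (α - Real.log ((m : ℝ) + 1) / Real.log k) - 1 / 2 =
      (α - 1 / 2) - Real.log ((m : ℝ) + 1) / c +
        ∑ d ∈ Finset.range J, if (k : ℝ) ^ (d + α) < (m : ℝ) + 1 then (1 : ℝ) else 0 := by
    intro m hm
    rw [fract_sub_log_eq hk hα1, hc]
    · ring
    · have : (m : ℝ) ≤ a := by exact_mod_cast (Finset.mem_range.mp hm).le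
      linarith
  have h2 : Int.fract (α - Real.log ((a : ℝ) + 1) / Real.log k) =
      α - Real.log ((a : ℝ) + 1) / c + J := by
    rw [fract_sub_log_eq hk hα1 hAJ, Finset.sum_congr rfl
      (fun d hd => if_pos ((hJ d).mp (Finset.mem_range.mp hd))), hc]
    simp
  have h3 : ∑ m ∈ Finset.range a, ∑ d ∈ Finset.range J,
      (if (k : ℝ) ^ (d + α) < (m : ℝ) + 1 then (1 : ℝ) else 0) =
      J * a - (k : ℝ) ^ α * (((k : ℝ) ^ J - 1) / (k - 1)) +
        ∑ d ∈ Finset.range J, Int.fract ((k : ℝ) ^ (d + α)) := by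
    rw [Finset.sum_comm, Finset.sum_congr rfl (fun d hd => sum_range_boole_lt
      (Real.rpow_nonneg hk0.le _) ((hJ d).mp (Finset.mem_range.mp hd)))]
    rw [Finset.sum_add_distrib, Finset.sum_sub_distrib, Finset.sum_const, Finset.card_range,
      nsmul_eq_mul, ← geom_sum_eq hk1.ne', Finset.mul_sum]
    congr 3
    ext d
    rw [Real.rpow_add hk0, Real.rpow_natCast, mul_comm]
  have h4 : Real.exp (c * (α - Real.log ((a : ℝ) + 1) / c + J)) =
      (k : ℝ) ^ α * (k : ℝ) ^ J / (a + 1) := by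
    have hc0 : c ≠ 0 := hc ▸ hlog.ne'
    have : c * (α - Real.log ((a : ℝ) + 1) / c + J) =
        Real.log k * α + Real.log k * J - Real.log (a + 1) := by
      rw [← hc]; field_simp; ring
    rw [this, Real.exp_sub, Real.exp_add, Real.exp_log hA, ← Real.rpow_def_of_pos hk0,
      ← Real.rpow_def_of_pos hk0, Real.rpow_natCast]
  obtain ⟨h5, h6⟩ := log_factorial_stirling_bounds a
  have hs1 : ∑ m ∈ Finset.range a, (Int.fract (α - Real.log ((m : ℝ) + 1) / Real.log k) - 1 / 2) =
      a * (α - 1 / 2) - Real.log a.factorial / c +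
          (J * a - (k : ℝ) ^ α * (((k : ℝ) ^ J - 1) / (k - 1)) +
        ∑ d ∈ Finset.range J, Int.fract ((k : ℝ) ^ (d + α))) := by
    rw [Finset.sum_congr rfl h1, Finset.sum_add_distrib, Finset.sum_sub_distrib, h3,
      ← Finset.sum_div, sum_log_add_one, Finset.sum_const, Finset.card_range, nsmul_eq_mul]
  have hs2 : ((a : ℝ) + 1) * expSaw (Real.log k) (α - Real.log ((a : ℝ) + 1) / c + J) =
      ((a : ℝ) + 1) * (α - Real.log ((a : ℝ) + 1) / c + J - 1 / 2 + 1 / c) -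
        (k : ℝ) ^ α * (k : ℝ) ^ J / (k - 1) := by
    have : (k : ℝ) - 1 ≠ 0 := by linarith
    rw [expSaw, ← hc, h4, hc, Real.exp_log hk0]
    field_simp
  rw [h2, hs1, hs2, Finset.sum_sub_distrib, Finset.sum_const, Finset.card_range, nsmul_eq_mul,
    ← hc]
  obtain ⟨r, hr⟩ : ∃ r, r = Real.log a.factorial -
    (((a : ℝ) + 1) * Real.log (a + 1) - (a + 1) - Real.log (a + 1) / 2) := ⟨_, rfl⟩
  have hr' : Real.log a.factorial =
    (((a : ℝ) + 1) * Real.log (a + 1) - (a + 1) - Real.log (a + 1) / 2) + r := by rw [hr]; ring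
  have hr0 : 0 ≤ r := by linarith
  have hr1 : r ≤ 1 := by linarith
  have hc0 : 0 < c := hc ▸ hlog
  have hkm : 0 < (k : ℝ) - 1 := by linarith
  have hkα : (k : ℝ) ^ α / (k - 1) ≤ 2 := by
    rw [div_le_iff₀ hkm]
    have : (k : ℝ) ^ α ≤ (k : ℝ) ^ (1 : ℝ) := Real.rpow_le_rpow_of_exponent_le hk1.le hα1.le
    rw [Real.rpow_one] at this
    linarith
  have hkα0 : 0 ≤ (k : ℝ) ^ α / (k - 1) := by positivity
  have hrc0 : 0 ≤ r / c := by positivity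
  have hrc : r / c ≤ 1 / c := by gcongr
  rw [hr']
  have : ∀ T : ℝ, a * (α - 1 / 2) - ((((a : ℝ) + 1) * Real.log (a + 1) - (a + 1) -
      Real.log (a + 1) / 2) + r) / c + (J * a - (k : ℝ) ^ α * (((k : ℝ) ^ J - 1) / (k - 1)) + T) +
      1 / 2 * (α - Real.log ((a : ℝ) + 1) / c + J - 1 / 2) -
      (((a : ℝ) + 1) * (α - Real.log ((a : ℝ) + 1) / c + J - 1 / 2 + 1 / c) -
        (k : ℝ) ^ α * (k : ℝ) ^ J / (k - 1)) - (T - J * (1 / 2)) =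
      1 / 4 - α / 2 - r / c + (k : ℝ) ^ α / (k - 1) := by
    intro T
    field_simp
    ring
  rw [this, abs_le]
  constructor <;> linarith

end FractIdentity

section ZetaSum

theorem cexp_two_pi_mul_fract (n : ℤ) (x : ℝ) :
    Complex.exp (2 * Real.pi * I * n * (Int.fract x : ℝ)) =
        Complex.exp (2 * Real.pi * I * n * x) := by
  rw [Int.fract, Complex.exp_eq_exp_iff_exists_int]
  refine ⟨-(n * ⌊x⌋), ?_⟩
  push_cast
  ring

theorem sum_cexp_div_eq (N : ℕ) (x : ℝ) :
    ∑ n ∈ Finset.range N, (Complex.exp (2 * Real.pi * I * ((n + 1 : ℤ) : ℂ) * x) /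
        ((n + 1 : ℤ) : ℂ) +
      Complex.exp (2 * Real.pi * I * ((-(n + 1) : ℤ) : ℂ) * x) / ((-(n + 1) : ℤ) : ℂ)) =
      2 * I * ((sawError N (Int.fract x) - Real.pi * (Int.fract x - 1 / 2) : ℝ) : ℂ) := by
  rw [sawError, add_sub_cancel_right, Complex.ofReal_sum, Finset.mul_sum]
  refine Finset.sum_congr rfl fun n _ => ?_
  rw [← cexp_two_pi_mul_fract _ x, ← cexp_two_pi_mul_fract _ x]
  generalize Int.fract x = y
  have h1 : (n : ℂ) + 1 ≠ 0 := by exact_mod_cast Nat.succ_ne_zero n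
  push_cast
  have h2 : (2 * Real.pi * I * ((n : ℂ) + 1) * y) = (2 * Real.pi * (n + 1) * y : ℂ) * I := by ring
  have h3 : (2 * Real.pi * I * (-1 + -(n : ℂ)) * y) = (-(2 * Real.pi * (n + 1) * y : ℂ)) * I := by
    ring
  have h4 : (2 * Real.pi * I * (-((n : ℂ) + 1)) * y) = (-(2 * Real.pi * (n + 1) * y : ℂ)) * I := by
    ring
  rw [h2, h4, Complex.sin]
  generalize Complex.exp (2 * Real.pi * (n + 1) * y * I) = E
  generalize Complex.exp (-(2 * Real.pi * (n + 1) * y : ℂ) * I) = E'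
  field_simp
  linear_combination (E - E') * I_sq

/-- The `n`-th term of the zeta sum at phase `α`. -/
noncomputable def zetaTerm (c α : ℝ) (n : ℤ) : ℂ :=
  riemannZeta ((2 * Real.pi * n / c : ℝ) * I) * Complex.exp (2 * Real.pi * I * n * α) / n

theorem natCast_cpow_mul_cexp {c : ℝ} (hc : 0 < c) (α : ℝ) (n : ℤ) (m : ℕ) :
    Complex.exp (2 * Real.pi * I * n * α) *
      (((m + 1 : ℝ)) : ℂ) ^ (-((2 * Real.pi * n / c : ℝ) * I : ℂ)) =
      Complex.exp (2 * Real.pi * I * n * (α - Real.log ((m : ℝ) + 1) / c : ℝ)) := by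
  have hm : (0 : ℝ) < (m : ℝ) + 1 := by positivity
  have hc0 : (c : ℂ) ≠ 0 := by exact_mod_cast hc.ne'
  rw [Complex.cpow_def_of_ne_zero (by exact_mod_cast hm.ne'), ← Complex.exp_add,
    ← Complex.ofReal_log hm.le]
  congr 1
  push_cast
  field_simp
  ring

theorem norm_zetaTerm_sub_le {c : ℝ} (hc : 0 < c) (α : ℝ) {n : ℤ} (hn : n ≠ 0) {a : ℕ}
    (ha : 2 * Real.pi * |(n : ℝ)| / c ≤ a + 1) :
    ‖zetaTerm c α n - (∑ m ∈ Finset.range a,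
        Complex.exp (2 * Real.pi * I * n * (α - Real.log ((m : ℝ) + 1) / c : ℝ)) / n +
      1 / 2 * (Complex.exp (2 * Real.pi * I * n * (α - Real.log ((a : ℝ) + 1) / c : ℝ)) / n) -
      (a + 1) * expSawTerm c (α - Real.log ((a : ℝ) + 1) / c) n)‖ ≤
      c / (Real.pi * |(n : ℝ)| ^ 2) + 8 * Real.pi / (c * (a + 1)) := by
  have hpi := Real.pi_pos
  have hn0 : (n : ℂ) ≠ 0 := by exact_mod_cast hn
  have hn1 : (n : ℝ) ≠ 0 := by exact_mod_cast hn
  have hn2 : 0 < |(n : ℝ)| := abs_pos.mpr hn1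
  obtain ⟨t, ht⟩ : ∃ t : ℝ, t = 2 * Real.pi * n / c := ⟨_, rfl⟩
  have habs : |t| = 2 * Real.pi * |(n : ℝ)| / c := by
    rw [ht, abs_div, abs_mul, abs_of_pos hc, abs_of_pos (by positivity : 0 < 2 * Real.pi)]
  have ht0 : t ≠ 0 := by rw [← abs_pos, habs]; positivity
  have h1 := norm_riemannZeta_sub_le ht0 (habs ▸ ha)
  have hs1 : (t * I : ℂ) - 1 ≠ 0 := by
    intro h
    have := congrArg Complex.re h
    simp at this
  have hs2 : (1 : ℂ) - 2 * Real.pi * n / c * I = -(t * I - 1) := by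
    rw [ht]; push_cast; ring
  have hA : ((a : ℝ) + 1 : ℂ) ≠ 0 := by exact_mod_cast (by positivity : (a : ℝ) + 1 ≠ 0)
  have h2 : zetaTerm c α n - (∑ m ∈ Finset.range a,
        Complex.exp (2 * Real.pi * I * n * (α - Real.log ((m : ℝ) + 1) / c : ℝ)) / n +
      1 / 2 * (Complex.exp (2 * Real.pi * I * n * (α - Real.log ((a : ℝ) + 1) / c : ℝ)) / n) -
      (a + 1) * expSawTerm c (α - Real.log ((a : ℝ) + 1) / c) n) =
      Complex.exp (2 * Real.pi * I * n * α) / n *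
        (riemannZeta (t * I) - zetaTrapezoid a (t * I) / (t * I - 1)) := by
    have hcp : (((a : ℝ) + 1 : ℝ) : ℂ) ^ (1 - t * I : ℂ) =
        (a + 1) * (((a : ℝ) + 1 : ℝ) : ℂ) ^ (-(t * I) : ℂ) := by
      rw [sub_eq_add_neg, Complex.cpow_add _ _ (by exact_mod_cast hA), Complex.cpow_one]
      push_cast
      rfl
    rw [← Finset.sum_div]
    simp_rw [← natCast_cpow_mul_cexp hc, expSawTerm, ← natCast_cpow_mul_cexp hc]
    rw [← Finset.mul_sum, zetaTerm, zetaTrapezoid, hcp, hs2, ← ht]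
    generalize Complex.exp (2 * Real.pi * I * n * α) = E
    generalize (((a : ℝ) + 1 : ℝ) : ℂ) ^ (-(t * I) : ℂ) = P
    generalize ∑ m ∈ Finset.range a, (((m : ℝ) + 1 : ℝ) : ℂ) ^ (-(t * I) : ℂ) = S
    field_simp
    ring
  have h3 : ‖Complex.exp (2 * Real.pi * I * n * α)‖ = 1 := by
    have : (2 * Real.pi * I * n * α : ℂ) = ((2 * Real.pi * n * α : ℝ) : ℂ) * I := by
      push_cast; ring
    rw [this, Complex.norm_exp_ofReal_mul_I]
  rw [h2, norm_mul, norm_div, h3, Complex.norm_intCast]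
  calc 1 / |(n : ℝ)| * _ ≤ 1 / |(n : ℝ)| * (2 / |t| + 4 * |t| / (a + 1)) := by gcongr
    _ = _ := by
      rw [habs]
      field_simp
      ring

theorem sum_range_one_div_sq_le (N : ℕ) : ∑ n ∈ Finset.range N, 1 / ((n : ℝ) + 1) ^ 2 ≤ 2 := by
  have : ∑ n ∈ Finset.range (N + 1), 1 / ((n : ℝ) + 1) ^ 2 ≤ 2 - 1 / ((N : ℝ) + 1) := by
    induction N with
    | zero => norm_num
    | succ N ih =>
      rw [Finset.sum_range_succ]
      have h : 1 / ((N : ℝ) + 1) - 1 / ((N : ℝ) + 1 + 1) =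
          1 / (((N : ℝ) + 1) * ((N : ℝ) + 1 + 1)) := by
        field_simp
        ring
      have h2 : 1 / ((N : ℝ) + 1 + 1) ^ 2 ≤ 1 / (((N : ℝ) + 1) * ((N : ℝ) + 1 + 1)) := by
        gcongr
        nlinarith [N.cast_nonneg (α := ℝ)]
      push_cast
      linarith
  have h : 0 ≤ 1 / ((N : ℝ) + 1) := by positivity
  have h2 : 0 ≤ 1 / ((N : ℝ) + 1) ^ 2 := by positivity
  rw [Finset.sum_range_succ] at this
  linarith

theorem norm_sum_zetaTerm_sub_le {k : ℕ} {α : ℝ} (hk : 2 ≤ k) (hα0 : 0 ≤ α) (hα1 : α < 1)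
    {J a N : ℕ} (hN : 1 ≤ N) (hJ : ∀ d : ℕ, d < J ↔ (k : ℝ) ^ (d + α) < (a : ℝ) + 1)
    (ha : 2 * Real.pi * N / Real.log k ≤ a + 1) {B : ℝ} (hB : (a : ℝ) + 1 ≤ B * N) :
    ‖∑ n ∈ Finset.range N, (zetaTerm (Real.log k) α (n + 1) + zetaTerm (Real.log k) α (-(n + 1))) +
      2 * Real.pi * I * (∑ d ∈ Finset.range J, (Int.fract ((k : ℝ) ^ (d + α)) - 1 / 2) : ℝ) -
      2 * I * (∑ m ∈ Finset.range a,
        sawError N (Int.fract (α - Real.log ((m : ℝ) + 1) / Real.log k)) : ℝ)‖ ≤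
      40 + (4 + B) * Real.log k + 7 / Real.log k := by
  have hpi := Real.pi_pos
  have hk1 : (1 : ℝ) < k := by exact_mod_cast hk
  have hid := abs_sum_fract_identity_le hk hα0 hα1 hJ
  obtain ⟨c, hc⟩ : ∃ c, c = Real.log k := ⟨_, rfl⟩
  have hc0 : 0 < c := hc ▸ Real.log_pos hk1
  rw [← hc] at hid ha ⊢
  obtain ⟨x, hx⟩ : ∃ x : ℕ → ℝ, x = fun m : ℕ => α - Real.log ((m : ℝ) + 1) / c := ⟨_, rfl⟩
  have hxm : ∀ m : ℕ, α - Real.log ((m : ℝ) + 1) / c = x m := fun m => by rw [hx]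
  simp_rw [hxm] at hid ⊢
  -- the main term for one frequency
  let M : ℤ → ℂ := fun n => ∑ m ∈ Finset.range a,
      Complex.exp (2 * Real.pi * I * n * (x m : ℝ)) / n +
    1 / 2 * (Complex.exp (2 * Real.pi * I * n * (x a : ℝ)) / n) - (a + 1) * expSawTerm c (x a) n
  have hterm : ∀ n : ℕ, n ∈ Finset.range N →
      ‖zetaTerm c α (n + 1) + zetaTerm c α (-(n + 1)) - (M (n + 1) + M (-(n + 1)))‖ ≤
      2 * (c / Real.pi) * (1 / ((n : ℝ) + 1) ^ 2) + 16 * Real.pi / (c * (a + 1)) := by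
    intro n hn
    have hnN : (n : ℝ) + 1 ≤ N := by exact_mod_cast Finset.mem_range.mp hn
    have hn0 : ((n : ℤ) + 1) ≠ 0 := by positivity
    have h3 : |((-((n : ℤ) + 1) : ℤ) : ℝ)| = (n : ℝ) + 1 := by
      push_cast; rw [abs_neg, abs_of_nonneg (by positivity)]
    have h4 : |(((n : ℤ) + 1 : ℤ) : ℝ)| = (n : ℝ) + 1 := by
      push_cast; rw [abs_of_nonneg (by positivity)]
    have h5 : 2 * Real.pi * ((n : ℝ) + 1) / c ≤ a + 1 := le_trans (by gcongr) ha
    have h1 := norm_zetaTerm_sub_le hc0 α hn0 (a := a) (by rw [h4]; exact h5)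
    have h2 := norm_zetaTerm_sub_le hc0 α (neg_ne_zero.mpr hn0) (a := a) (by rw [h3]; exact h5)
    simp_rw [hxm] at h1 h2
    rw [h4] at h1
    rw [h3] at h2
    rw [add_sub_add_comm]
    refine (norm_add_le _ _).trans ((add_le_add h1 h2).trans (le_of_eq ?_))
    field_simp
    ring
  have hsumM : ∑ n ∈ Finset.range N, (M (n + 1) + M (-(n + 1))) =
      2 * I * ((∑ m ∈ Finset.range a, (sawError N (Int.fract (x m)) -
        Real.pi * (Int.fract (x m) - 1 / 2)) + 1 / 2 * (sawError N (Int.fract (x a)) -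
        Real.pi * (Int.fract (x a) - 1 / 2)) : ℝ) : ℂ) - (a + 1) *
        ∑ n ∈ Finset.range N, (expSawTerm c (Int.fract (x a)) (n + 1) +
          expSawTerm c (Int.fract (x a)) (-(n + 1))) := by
    have h1 : ∀ n : ℤ, expSawTerm c (Int.fract (x a)) n = expSawTerm c (x a) n := fun n => by
      rw [expSawTerm, expSawTerm, cexp_two_pi_mul_fract]
    simp_rw [h1]
    rw [Complex.ofReal_add, Complex.ofReal_sum, mul_add, Finset.mul_sum, Complex.ofReal_mul,
      ← mul_assoc (2 * I), mul_right_comm _ (_ : ℂ) _ , ← sum_cexp_div_eq]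
    simp_rw [← sum_cexp_div_eq]
    rw [Finset.sum_comm, Finset.mul_sum, Finset.sum_mul, ← Finset.sum_add_distrib,
      ← Finset.sum_sub_distrib]
    refine Finset.sum_congr rfl fun n _ => ?_
    simp only [M]
    rw [Finset.sum_add_distrib]
    push_cast
    ring
  have hx1 : Int.fract (x a) ∈ Set.Ico (0 : ℝ) 1 := ⟨Int.fract_nonneg _, Int.fract_lt_one _⟩
  have hE := norm_sum_expSawTerm_sub_le hc0 hx1 hN
  have hsaw := abs_sawError_le_const N hx1.1 hx1.2.le
  obtain ⟨S, hS⟩ : ∃ S, S = ∑ n ∈ Finset.range N, (expSawTerm c (Int.fract (x a)) (n + 1) +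
          expSawTerm c (Int.fract (x a)) (-(n + 1))) := ⟨_, rfl⟩
  rw [← hS] at hE hsumM
  have hdiff : ‖∑ n ∈ Finset.range N, (zetaTerm c α (n + 1) + zetaTerm c α (-(n + 1))) -
      ∑ n ∈ Finset.range N, (M (n + 1) + M (-(n + 1)))‖ ≤ 4 * (c / Real.pi) + 8 := by
    rw [← Finset.sum_sub_distrib]
    refine (norm_sum_le _ _).trans ((Finset.sum_le_sum hterm).trans ?_)
    rw [Finset.sum_add_distrib, ← Finset.mul_sum, Finset.sum_const, Finset.card_range, nsmul_eq_mul]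
    have h1 := mul_le_mul_of_nonneg_left (sum_range_one_div_sq_le N)
      (by positivity : 0 ≤ 2 * (c / Real.pi))
    have h2 : (N : ℝ) * (16 * Real.pi / (c * (a + 1))) ≤ 8 := by
      rw [div_le_iff₀ hc0] at ha
      rw [mul_div_assoc', div_le_iff₀ (by positivity)]
      linarith
    linarith
  have hid' := hid
  obtain ⟨D, hD⟩ : ∃ D, D = ∑ m ∈ Finset.range a, (Int.fract (x m) - 1 / 2) +
      1 / 2 * (Int.fract (x a) - 1 / 2) - ((a : ℝ) + 1) * expSaw c (Int.fract (x a)) -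
      ∑ d ∈ Finset.range J, (Int.fract ((k : ℝ) ^ (d + α)) - 1 / 2) := ⟨_, rfl⟩
  rw [← hD] at hid
  have hexpr : ∀ Z : ℂ, Z +
      2 * Real.pi * I * (∑ d ∈ Finset.range J, (Int.fract ((k : ℝ) ^ (d + α)) - 1 / 2) : ℝ) -
      2 * I * (∑ m ∈ Finset.range a, sawError N (Int.fract (x m)) : ℝ) =
      (Z - ∑ n ∈ Finset.range N, (M (n + 1) + M (-(n + 1)))) +
      I * (sawError N (Int.fract (x a)) : ℝ) - 2 * Real.pi * I * (D : ℝ) -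
      ((a + 1 : ℝ) : ℂ) * (S - (-2 * Real.pi * I * expSaw c (Int.fract (x a)))) := by
    intro Z
    have hs : ∑ m ∈ Finset.range a, (sawError N (Int.fract (x m)) -
        Real.pi * (Int.fract (x m) - 1 / 2)) = ∑ m ∈ Finset.range a, sawError N (Int.fract (x m)) -
        Real.pi * ∑ m ∈ Finset.range a, (Int.fract (x m) - 1 / 2) := by
      rw [Finset.sum_sub_distrib, ← Finset.mul_sum]
    rw [hsumM, hD, hs]
    generalize ∑ m ∈ Finset.range a, (Int.fract (x m) - 1 / 2) = T₁
    generalize ∑ m ∈ Finset.range a, sawError N (Int.fract (x m)) = T₂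
    generalize ∑ d ∈ Finset.range J, (Int.fract ((k : ℝ) ^ (d + α)) - 1 / 2) = T₃
    push_cast
    ring
  rw [hexpr]
  have hN0 : (0 : ℝ) < N := by exact_mod_cast hN
  have h1 : ‖I * ((sawError N (Int.fract (x a)) : ℝ) : ℂ)‖ ≤ 10 := by
    rw [norm_mul, norm_I, one_mul, Complex.norm_real]
    exact hsaw
  have h2 : ‖2 * Real.pi * I * (D : ℝ)‖ ≤ 2 * Real.pi * (3 + 1 / c) := by
    rw [norm_mul, norm_mul, norm_mul, norm_I, Complex.norm_real, Complex.norm_real,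
      Complex.norm_two, Real.norm_of_nonneg hpi.le, mul_one]
    gcongr
    exact hid
  have hBN : 0 ≤ B * N := le_trans (by positivity) hB
  have h3 : ‖((a + 1 : ℝ) : ℂ) * (S - (-2 * Real.pi * I * expSaw c (Int.fract (x a))))‖ ≤
      B * N * (c / (Real.pi * N)) := by
    rw [norm_mul, Complex.norm_real, Real.norm_of_nonneg (by positivity)]
    gcongr
  have h4 : B * N * (c / (Real.pi * N)) = B * c * (1 / Real.pi) := by
    field_simp
  have hB0 : 0 < B := by
    have h0 : 0 < B * N := lt_of_lt_of_le (by positivity) hB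
    exact pos_of_mul_pos_left h0 hN0.le
  have hp1 : 1 / Real.pi ≤ 1 := by
    rw [div_le_one hpi]; linarith [Real.pi_gt_three]
  have h5 : B * c * (1 / Real.pi) ≤ B * c := mul_le_of_le_one_right (by positivity) hp1
  have h6 : 4 * (c / Real.pi) ≤ 4 * c := by
    rw [div_eq_mul_one_div]
    have := mul_le_of_le_one_right hc0.le hp1
    linarith
  have h7 : 2 * Real.pi * (3 + 1 / c) ≤ 2 * 3.15 * (3 + 1 / c) := by
    gcongr
    exact Real.pi_lt_d2.le
  have h8 : 7 / c = 7 * (1 / c) := by ring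
  have h9 : 0 < 1 / c := by positivity
  refine (norm_sub_le _ _).trans ?_
  refine (add_le_add_left ((norm_sub_le _ _).trans (add_le_add_left (norm_add_le _ _) _))
      _).trans ?_
  rw [h8]
  linarith

end ZetaSum

section KuzminLandau

theorem exists_threshold_of_antitone {Δ : ℕ → ℝ} {a b : ℕ} (hab : a ≤ b)
    (hΔ : ∀ m, a ≤ m → m + 1 < b → Δ (m + 1) ≤ Δ m) (y : ℝ) :
    ∃ c, a ≤ c ∧ c ≤ b ∧ (∀ n, a ≤ n → n < c → y < Δ n) ∧ ∀ n, c ≤ n → n < b → Δ n ≤ y := by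
  induction b, hab using Nat.le_induction with
  | base => exact ⟨a, le_rfl, le_rfl, fun n h1 h2 => by omega, fun n h1 h2 => by omega⟩
  | succ b hab ih =>
    obtain ⟨c, hac, hcb, h1, h2⟩ := ih fun m h1 h2 => hΔ m h1 (by omega)
    rcases hcb.lt_or_eq with hcb | rfl
    · refine ⟨c, hac, by omega, h1, fun n h3 h4 => ?_⟩
      rcases (Nat.lt_succ_iff.mp h4).lt_or_eq with h5 | rfl
      · exact h2 n h3 h5
      · obtain ⟨m, rfl⟩ : ∃ m, n = m + 1 := ⟨n - 1, by omega⟩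
        exact (hΔ m (by omega) (by omega)).trans (h2 m (by omega) (by omega))
    · by_cases hc : y < Δ c
      · refine ⟨c + 1, by omega, le_rfl, fun n h3 h4 => ?_, fun n h3 h4 => by omega⟩
        rcases (Nat.lt_succ_iff.mp h4).lt_or_eq with h5 | rfl
        · exact h1 n h3 h5
        · exact hc
      · refine ⟨c, hac, by omega, h1, fun n h3 h4 => ?_⟩
        have : n = c := by omega
        rw [this]
        exact not_lt.mp hc

theorem cos_div_sin_antitone {x y : ℝ} (hx : 0 < x) (hxy : x ≤ y) (hy : y < Real.pi) :
    Real.cos y / Real.sin y ≤ Real.cos x / Real.sin x := by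
  have h1 := Real.sin_pos_of_pos_of_lt_pi hx (hxy.trans_lt hy)
  have h2 := Real.sin_pos_of_pos_of_lt_pi (hx.trans_le hxy) hy
  rw [div_le_div_iff₀ h2 h1]
  have := Real.sin_nonneg_of_nonneg_of_le_pi (sub_nonneg.mpr hxy) (by linarith)
  rw [Real.sin_sub] at this
  linarith

theorem norm_cexp_two_pi (x : ℝ) : ‖Complex.exp (2 * Real.pi * I * x)‖ = 1 := by
  have : (2 * Real.pi * I * x : ℂ) = ((2 * Real.pi * x : ℝ) : ℂ) * I := by push_cast; ring
  rw [this, Complex.norm_exp_ofReal_mul_I]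

theorem cexp_eq_half_mul_sub {x y : ℝ} (i : ℤ) (h : Real.sin (Real.pi * (y - x - i)) ≠ 0) :
    Complex.exp (2 * Real.pi * I * x) =
      1 / 2 * (Complex.exp (2 * Real.pi * I * x) - Complex.exp (2 * Real.pi * I * y)) +
      I / 2 * ((Real.cos (Real.pi * (y - x - i)) / Real.sin (Real.pi * (y - x - i)) : ℝ) *
        (Complex.exp (2 * Real.pi * I * x) - Complex.exp (2 * Real.pi * I * y))) := by
  obtain ⟨θ, hθ⟩ : ∃ θ, θ = Real.pi * (y - x - i) := ⟨_, rfl⟩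
  rw [← hθ] at h ⊢
  have h1 : Complex.exp (2 * Real.pi * I * y) = Complex.exp (2 * Real.pi * I * x) *
      ((Real.cos (2 * θ) : ℝ) + (Real.sin (2 * θ) : ℝ) * I) := by
    rw [Complex.ofReal_cos, Complex.ofReal_sin, ← Complex.exp_mul_I, ← Complex.exp_add,
      Complex.exp_eq_exp_iff_exists_int]
    refine ⟨i, ?_⟩
    rw [hθ]
    push_cast
    ring
  rw [h1, Real.cos_two_mul', Real.sin_two_mul]
  have h2 : Real.cos θ ^ 2 = 1 - Real.sin θ ^ 2 := by linarith [Real.sin_sq_add_cos_sq θ]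
  rw [h2]
  have h3 : (Real.cos θ : ℂ) ^ 2 = 1 - (Real.sin θ : ℂ) ^ 2 := by exact_mod_cast h2
  have h4 : (Real.sin θ : ℂ) ≠ 0 := by exact_mod_cast h
  push_cast at h3 h4 ⊢
  field_simp
  generalize Complex.sin θ = s at *
  generalize Complex.cos θ = c at *
  linear_combination (2 * s * c ^ 2) * I_sq - 2 * s * h3

theorem norm_sum_cexp_le_of_sub_mem {f : ℕ → ℝ} {a b : ℕ} (hab : a ≤ b) {i : ℤ} {δ : ℝ} (hδ : 0 < δ)
    (hanti : ∀ m, a ≤ m → m + 1 < b → f (m + 2) - f (m + 1) ≤ f (m + 1) - f m)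
    (hmem : ∀ m, a ≤ m → m < b → i + δ ≤ f (m + 1) - f m ∧ f (m + 1) - f m ≤ i + 1 - δ) :
    ‖∑ m ∈ Finset.Ico a b, Complex.exp (2 * Real.pi * I * f m)‖ ≤ 1 + 1 / δ := by
  have hpi := Real.pi_pos
  let θ : ℕ → ℝ := fun m => Real.pi * (f (m + 1) - f m - i)
  have hθ : ∀ m, a ≤ m → m < b → 0 < θ m ∧ θ m < Real.pi := fun m h1 h2 => by
    obtain ⟨h3, h4⟩ := hmem m h1 h2
    exact ⟨mul_pos hpi (by linarith), by
      have : f (m + 1) - f m - i < 1 := by linarith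
      simpa [θ] using mul_lt_mul_of_pos_left this hpi⟩
  have hs : ∀ m, a ≤ m → m < b → 2 * δ ≤ Real.sin (θ m) := fun m h1 h2 => by
    obtain ⟨h3, h4⟩ := hmem m h1 h2
    refine le_trans ?_ (min_le_sin_pi (by linarith) (by linarith))
    have : δ ≤ min (f (m + 1) - f m - i) (1 - (f (m + 1) - f m - i)) :=
      le_min (by linarith) (by linarith)
    linarith
  have hη := norm_sum_mul_sub_le (a := a) (b := b)
    (η := fun m => -(Real.cos (θ m) / Real.sin (θ m)))
    (G := fun m => Complex.exp (2 * Real.pi * I * f m)) (H := 1 / (2 * δ)) (B := 1)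
    (fun m h1 h2 => by
      refine neg_le_neg (cos_div_sin_antitone (hθ _ (by omega) h2).1 ?_ (hθ m h1 (by omega)).2)
      have := hanti m h1 h2
      exact mul_le_mul_of_nonneg_left (by linarith) hpi.le)
    (fun m h1 h2 => by
      have h3 := hs m h1 h2
      rw [abs_neg, abs_div, abs_of_pos (by linarith : 0 < Real.sin (θ m))]
      exact div_le_div₀ zero_le_one (Real.abs_cos_le_one _) (by positivity) h3)
    (fun m _ _ => (norm_cexp_two_pi _).le) zero_le_one (by positivity)
  have hsum : ∑ m ∈ Finset.Ico a b, Complex.exp (2 * Real.pi * I * f m) =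
      1 / 2 * ∑ m ∈ Finset.Ico a b, (Complex.exp (2 * Real.pi * I * f m) -
        Complex.exp (2 * Real.pi * I * f (m + 1))) - I / 2 * ∑ m ∈ Finset.Ico a b,
        ((-(Real.cos (θ m) / Real.sin (θ m)) : ℝ) : ℂ) * (Complex.exp (2 * Real.pi * I * f m) -
          Complex.exp (2 * Real.pi * I * f (m + 1))) := by
    rw [Finset.mul_sum, Finset.mul_sum, ← Finset.sum_sub_distrib]
    refine Finset.sum_congr rfl fun m hm => ?_
    rw [Finset.mem_Ico] at hm
    have h3 := hs m hm.1 hm.2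
    refine (cexp_eq_half_mul_sub i (x := f m) (y := f (m + 1)) (by
      have : 0 < Real.sin (θ m) := by linarith
      exact this.ne')).trans ?_
    simp only [θ]
    push_cast
    ring
  have htel : ‖∑ m ∈ Finset.Ico a b, (Complex.exp (2 * Real.pi * I * f m) -
        Complex.exp (2 * Real.pi * I * f (m + 1)))‖ ≤ 2 := by
    have : ∑ m ∈ Finset.Ico a b, (Complex.exp (2 * Real.pi * I * f m) -
        Complex.exp (2 * Real.pi * I * f (m + 1))) =
        Complex.exp (2 * Real.pi * I * f a) - Complex.exp (2 * Real.pi * I * f b) := by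
      rw [← neg_inj, ← Finset.sum_neg_distrib]
      simp only [neg_sub]
      exact Finset.sum_Ico_sub (fun m => Complex.exp (2 * Real.pi * I * f m)) hab
    rw [this]
    refine (norm_sub_le _ _).trans ?_
    rw [norm_cexp_two_pi, norm_cexp_two_pi]
    norm_num
  rw [hsum]
  refine (norm_sub_le _ _).trans ?_
  rw [norm_mul, norm_mul]
  have e1 : ‖(1 / 2 : ℂ)‖ = 1 / 2 := by simp
  have e2 : ‖(I / 2 : ℂ)‖ = 1 / 2 := by simp
  rw [e1, e2]
  have : 4 * (1 / (2 * δ)) * 1 = 2 * (1 / δ) := by field_simp; ring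
  rw [this] at hη
  linarith

theorem card_le_of_gap {Δ : ℕ → ℝ} {a c : ℕ} {g δ y : ℝ} (hg : 0 < g) (hδ : 0 ≤ δ)
    (hgap : ∀ m, a ≤ m → m + 1 < c → g ≤ Δ m - Δ (m + 1))
    (hmem : ∀ m, a ≤ m → m < c → y ≤ Δ m ∧ Δ m ≤ y + δ) :
    ((c - a : ℕ) : ℝ) ≤ δ / g + 1 := by
  rcases le_or_gt c a with h | h
  · rw [Nat.sub_eq_zero_of_le h]
    push_cast
    positivity
  obtain ⟨n, rfl⟩ : ∃ n, c = a + n + 1 := ⟨c - a - 1, by omega⟩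
  have key : ∀ j ≤ n, (j : ℝ) * g ≤ Δ a - Δ (a + j) := by
    intro j
    induction j with
    | zero => simp
    | succ j ih =>
      intro hj
      have h1 := ih (by omega)
      have h2 := hgap (a + j) (by omega) (by omega)
      rw [← add_assoc]
      push_cast
      linarith
  have h1 := key n le_rfl
  have h2 := hmem a le_rfl (by omega)
  have h3 := hmem (a + n) (by omega) (by omega)
  have h4 : (n : ℝ) ≤ δ / g := by
    rw [le_div_iff₀ hg]
    linarith
  have h5 : a + n + 1 - a = n + 1 := by omega
  rw [h5]
  push_cast
  linarith

theorem norm_sum_cexp_le_card (f : ℕ → ℝ) (a b : ℕ) :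
    ‖∑ m ∈ Finset.Ico a b, Complex.exp (2 * Real.pi * I * f m)‖ ≤ ((b - a : ℕ) : ℝ) := by
  refine (norm_sum_le _ _).trans ?_
  simp_rw [norm_cexp_two_pi]
  simp

theorem norm_sum_cexp_le_of_gap {f : ℕ → ℝ} {a b : ℕ} (hab : a ≤ b) {i : ℤ} {g δ : ℝ} (hg : 0 < g)
    (hδ : 0 < δ)
    (hgap : ∀ m, a ≤ m → m + 1 < b → g ≤ (f (m + 1) - f m) - (f (m + 2) - f (m + 1)))
    (hmem : ∀ m, a ≤ m → m < b → i ≤ f (m + 1) - f m ∧ f (m + 1) - f m ≤ i + 1) :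
    ‖∑ m ∈ Finset.Ico a b, Complex.exp (2 * Real.pi * I * f m)‖ ≤
      2 * (δ / g + 1) + (1 + 1 / δ) := by
  let Δ : ℕ → ℝ := fun m => f (m + 1) - f m
  have hanti : ∀ m, a ≤ m → m + 1 < b → Δ (m + 1) ≤ Δ m := fun m h1 h2 => by
    have := hgap m h1 h2
    simp only [Δ]
    linarith
  obtain ⟨c₁, h1, h2, h3, h4⟩ := exists_threshold_of_antitone hab hanti (i + 1 - δ)
  obtain ⟨c₂, h5, h6, h7, h8⟩ := exists_threshold_of_antitone h2
    (fun m h h' => hanti m (h1.trans h) h') (i + δ)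
  rw [← Finset.sum_Ico_consecutive _ h1 h2, ← Finset.sum_Ico_consecutive _ h5 h6]
  have e1 := card_le_of_gap (Δ := Δ) (a := a) (c := c₁) (y := i + 1 - δ) hg hδ.le
    (fun m h h' => hgap m h (by omega)) (fun m h h' => ⟨(h3 m h h').le, by
      have := (hmem m h (by omega)).2
      simp only [Δ]; linarith⟩)
  have e2 := card_le_of_gap (Δ := Δ) (a := c₂) (c := b) (y := i) hg hδ.le
    (fun m h h' => hgap m (by omega) (by omega)) (fun m h h' =>
      ⟨(hmem m (by omega) (by omega)).1, h8 m h h'⟩)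
  have e3 := norm_sum_cexp_le_of_sub_mem h5 hδ (f := f) (i := i)
    (fun m h h' => hanti m (by omega) (by omega))
    (fun m h h' => ⟨(h7 m h h').le, h4 m h (by omega)⟩)
  have e4 := norm_sum_cexp_le_card f a c₁
  have e5 := norm_sum_cexp_le_card f c₂ b
  refine (norm_add_le _ _).trans ((add_le_add_right (norm_add_le _ _) _).trans ?_)
  linarith

theorem norm_sum_cexp_le_of_le {f : ℕ → ℝ} {g δ : ℝ} (hg : 0 < g) (hδ : 0 < δ) {b : ℕ} (W : ℕ) :
    ∀ a ≤ b, (∀ m, a ≤ m → m + 1 < b → g ≤ (f (m + 1) - f m) - (f (m + 2) - f (m + 1))) →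
    (∀ m, a ≤ m → m < b → 0 ≤ f (m + 1) - f m ∧ f (m + 1) - f m ≤ W + 1) →
    ‖∑ m ∈ Finset.Ico a b, Complex.exp (2 * Real.pi * I * f m)‖ ≤
      (W + 1) * (2 * (δ / g + 1) + (1 + 1 / δ)) := by
  induction W with
  | zero =>
    intro a hab hgap hmem
    have := norm_sum_cexp_le_of_gap (i := 0) hab hg hδ hgap (fun m h h' => by
      simpa using hmem m h h')
    simpa using this
  | succ W ih =>
    intro a hab hgap hmem
    obtain ⟨c, h1, h2, h3, h4⟩ := exists_threshold_of_antitone (Δ := fun m => f (m + 1) - f m) hab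
      (fun m h h' => by
        have := hgap m h h'
        linarith) (W + 1)
    rw [← Finset.sum_Ico_consecutive _ h1 h2]
    have e1 := norm_sum_cexp_le_of_gap (f := f) (i := (W + 1 : ℕ)) h1 hg hδ
      (fun m h h' => hgap m h (by omega)) (fun m h h' => by
        have h5 := (hmem m h (by omega)).2
        have h6 := h3 m h h'
        push_cast at h5 h6 ⊢
        exact ⟨by linarith, h5⟩)
    have e2 := ih c h2 (fun m h h' => hgap m (by omega) h') (fun m h h' =>
      ⟨(hmem m (by omega) h').1, h4 m h h'⟩)
    refine (norm_add_le _ _).trans ((add_le_add e1 e2).trans (le_of_eq ?_))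
    push_cast
    ring

theorem norm_sum_cexp_log_le {Λ : ℝ} (hΛ : 0 < Λ) {a b : ℕ} (ha : 1 ≤ a) (hab : a ≤ b) :
    ‖∑ m ∈ Finset.Ico a b, Complex.exp (2 * Real.pi * I * (Λ * Real.log m : ℝ))‖ ≤
      (Λ / a + 1) * (3 * (b / Real.sqrt Λ) + 3) := by
  have hb0 : (0 : ℝ) < b := by exact_mod_cast ha.trans hab
  have ha0 : (0 : ℝ) < a := by exact_mod_cast ha
  have hs : 0 < Real.sqrt Λ := Real.sqrt_pos.mpr hΛ
  have hsq : Real.sqrt Λ ^ 2 = Λ := Real.sq_sqrt hΛ.le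
  have key := norm_sum_cexp_le_of_le (f := fun m => Λ * Real.log m) (g := Λ / b ^ 2)
    (δ := Real.sqrt Λ / b) (b := b) (by positivity) (by positivity) ⌊Λ / a⌋₊ a hab ?_ ?_
  · refine key.trans ?_
    have h1 : Real.sqrt Λ / b / (Λ / b ^ 2) = b / Real.sqrt Λ := by
      nth_rewrite 2 [← hsq]
      field_simp
    have h2 : 1 / (Real.sqrt Λ / b) = b / Real.sqrt Λ := one_div_div _ _
    rw [h1, h2]
    have h3 : (⌊Λ / a⌋₊ : ℝ) ≤ Λ / a := Nat.floor_le (by positivity)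
    have h4 : 2 * (b / Real.sqrt Λ + 1) + (1 + b / Real.sqrt Λ) =
        3 * (b / Real.sqrt Λ) + 3 := by ring
    rw [h4]
    gcongr
  · intro m h1 h2
    have hm : (0 : ℝ) < m := by exact_mod_cast (by omega : 0 < m)
    have hmb : (m : ℝ) + 1 ≤ b := by exact_mod_cast h2.le
    push_cast
    have h3 : Λ * Real.log (m + 1) - Λ * Real.log m -
        (Λ * Real.log (m + 2) - Λ * Real.log (m + 1)) =
        Λ * -Real.log (m * (m + 2) / (m + 1) ^ 2) := by
      rw [Real.log_div (by positivity) (by positivity),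
          Real.log_mul (by positivity) (by positivity),
        Real.log_pow]
      push_cast
      ring
    rw [h3, div_eq_mul_one_div]
    have h4 := Real.log_le_sub_one_of_pos (by positivity : (0 : ℝ) < m * (m + 2) / (m + 1) ^ 2)
    have h5 : m * ((m : ℝ) + 2) / (m + 1) ^ 2 - 1 = -(1 / ((m : ℝ) + 1) ^ 2) := by
      field_simp
      ring
    have h6 : 1 / (b : ℝ) ^ 2 ≤ 1 / ((m : ℝ) + 1) ^ 2 := by gcongr
    gcongr
    linarith
  · intro m h1 h2
    have hm : (0 : ℝ) < m := by exact_mod_cast (by omega : 0 < m)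
    have ham : (a : ℝ) ≤ m := by exact_mod_cast h1
    push_cast
    rw [← mul_sub, ← Real.log_div (by positivity) (by positivity)]
    constructor
    · refine mul_nonneg hΛ.le (Real.log_nonneg ?_)
      rw [le_div_iff₀ hm]
      linarith
    · have h3 := Real.log_le_sub_one_of_pos (by positivity : (0 : ℝ) < (m + 1) / m)
      have h4 : ((m : ℝ) + 1) / m - 1 = 1 / m := by field_simp; ring
      have h5 : 1 / (m : ℝ) ≤ 1 / a := by gcongr
      have h6 := (Nat.lt_floor_add_one (Λ / a)).le
      refine le_trans ?_ h6
      rw [div_eq_mul_one_div Λ]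
      exact mul_le_mul_of_nonneg_left (by linarith) hΛ.le

end KuzminLandau

section NearZone

theorem abs_sawError_le_div (N : ℕ) {x : ℝ} (hx0 : 0 < x) (hx1 : x ≤ 1 / 2) :
    |sawError N x| ≤ 1 / ((2 * N + 1) * x) := by
  refine (abs_sawError_le N hx0 (by linarith)).trans ?_
  have h := two_mul_le_sin_pi hx0.le hx1
  rw [show 1 / ((2 * (N : ℝ) + 1) * x) = 2 / ((2 * N + 1) * (2 * x)) by field_simp]
  gcongr

theorem abs_sawError_sub_le (N : ℕ) {x y : ℝ} (hx0 : 0 < x) (hxy : x ≤ y) (hy : y ≤ 1 / 2) :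
    |sawError N x - sawError N y| ≤ Real.pi / (2 * x) * (y - x) := by
  have hd : ∀ z ∈ Set.Icc x y, HasDerivWithinAt (sawError N) _ (Set.Icc x y) z := fun z hz =>
    (hasDerivAt_sawError N (by
      have := two_mul_le_sin_pi (hx0.le.trans hz.1) (hz.2.trans hy)
      have := hz.1
      linarith)).hasDerivWithinAt
  have h := (convex_Icc x y).norm_image_sub_le_of_norm_hasDerivWithin_le
    (C := Real.pi / (2 * x)) hd (fun z hz => by
      have h1 := two_mul_le_sin_pi (hx0.le.trans hz.1) (hz.2.trans hy)
      have h2 := hz.1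
      have h3 : 0 < Real.sin (Real.pi * z) := by linarith
      rw [Real.norm_eq_abs, abs_div, abs_mul, abs_of_pos Real.pi_pos, abs_of_pos h3]
      have h4 := Real.abs_sin_le_one ((2 * N + 1) * (Real.pi * z))
      calc Real.pi * |Real.sin ((2 * N + 1) * (Real.pi * z))| / Real.sin (Real.pi * z)
          ≤ Real.pi * 1 / (2 * x) := by gcongr; linarith
        _ = Real.pi / (2 * x) := by ring) (Set.left_mem_Icc.2 hxy) (Set.right_mem_Icc.2 hxy)
  rw [abs_sub_comm]
  simpa [Real.norm_eq_abs, abs_of_nonneg (sub_nonneg.2 hxy)] using h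

theorem abs_sawError_sub_le_sqrt (N : ℕ) {x y s : ℝ} (hx0 : 0 < x) (hxy : x ≤ y) (hy : y ≤ 1 / 2)
    (hs : Real.pi * (y - x) ≤ s * x ^ 2) :
    |sawError N x - sawError N y| ≤ √(s / (2 * N + 1)) := by
  have h1 := abs_sawError_sub_le N hx0 hxy hy
  have h2 : |sawError N x - sawError N y| ≤ 2 / ((2 * N + 1) * x) := by
    have e1 := abs_sawError_le_div N hx0 (hxy.trans hy)
    have e2 := abs_sawError_le_div N (hx0.trans_le hxy) hy
    have e3 : 1 / ((2 * (N : ℝ) + 1) * y) ≤ 1 / ((2 * N + 1) * x) := by gcongr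
    have e4 := abs_sub (sawError N x) (sawError N y)
    calc _ ≤ _ := e4
      _ ≤ 1 / ((2 * (N : ℝ) + 1) * x) + 1 / ((2 * N + 1) * x) := by linarith
      _ = _ := by ring
  apply Real.le_sqrt_of_sq_le
  calc |sawError N x - sawError N y| ^ 2
      = |sawError N x - sawError N y| * |sawError N x - sawError N y| := sq _
    _ ≤ Real.pi / (2 * x) * (y - x) * (2 / ((2 * N + 1) * x)) := by gcongr
    _ = Real.pi * (y - x) / x ^ 2 / (2 * N + 1) := by field_simp
    _ ≤ s / (2 * N + 1) := by
        gcongr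
        rw [div_le_iff₀ (by positivity)]
        exact hs

theorem abs_sawError_neg_log_sub_le (N : ℕ) {c t : ℝ} (hc : 2 / 3 ≤ c) (ht0 : 0 < t)
    (ht : t ≤ 1 / 8) :
    |sawError N (-Real.log (1 - t) / c) - sawError N (t / c)| ≤ 4 * √(c / (2 * N + 1)) := by
  have hc0 : 0 < c := by linarith
  have h1 : t ≤ -Real.log (1 - t) := by
    have := Real.log_le_sub_one_of_pos (by linarith : 0 < 1 - t)
    linarith
  have h2 : -Real.log (1 - t) ≤ t + 2 * t ^ 2 := by
    have := Real.one_sub_inv_le_log_of_pos (by linarith : 0 < 1 - t)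
    have h3 : (1 - t)⁻¹ ≤ 1 + t + 2 * t ^ 2 := by
      rw [inv_le_iff_one_le_mul₀ (by linarith)]
      nlinarith [sq_nonneg t, mul_pos ht0 ht0]
    linarith
  have h5 := abs_sawError_sub_le_sqrt N (x := t / c) (y := -Real.log (1 - t) / c) (s := 4 ^ 2 * c)
    (by positivity) (by gcongr) (by
      rw [div_le_iff₀ hc0]
      nlinarith) (by
      rw [← sub_div]
      have h6 : 4 ^ 2 * c * (t / c) ^ 2 = 8 * (2 * t ^ 2) / c := by field_simp; ring
      rw [h6, ← mul_div_assoc]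
      have := Real.pi_le_four
      have := Real.pi_pos
      gcongr <;> nlinarith)
  rw [abs_sub_comm, mul_div_assoc, Real.sqrt_mul (by positivity), Real.sqrt_sq (by norm_num)] at h5
  exact h5

theorem abs_sawError_log_sub_le (N : ℕ) {c t : ℝ} (hc : 2 / 3 ≤ c) (ht0 : 0 < t)
    (ht : t ≤ 1 / 8) :
    |sawError N (Real.log (1 + t) / c) - sawError N (t / c)| ≤ 4 * √(c / (2 * N + 1)) := by
  have hc0 : 0 < c := by linarith
  have h1 : Real.log (1 + t) ≤ t := by
    have := Real.log_le_sub_one_of_pos (by linarith : 0 < 1 + t)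
    linarith
  have h2 : t - t ^ 2 ≤ Real.log (1 + t) := by
    have := Real.one_sub_inv_le_log_of_pos (by linarith : 0 < 1 + t)
    have h3 : (1 + t)⁻¹ ≤ 1 - t + t ^ 2 := by
      rw [inv_le_iff_one_le_mul₀ (by linarith)]
      nlinarith [sq_nonneg t, mul_pos ht0 ht0, mul_pos ht0 (mul_pos ht0 ht0)]
    linarith
  have h3 : t / 2 ≤ Real.log (1 + t) := by nlinarith
  have h5 := abs_sawError_sub_le_sqrt N (x := Real.log (1 + t) / c) (y := t / c) (s := 4 ^ 2 * c)
    (div_pos (by linarith) hc0) (by gcongr) (by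
      rw [div_le_iff₀ hc0]
      nlinarith) (by
      rw [← sub_div]
      have h6 : 4 ^ 2 * c * (Real.log (1 + t) / c) ^ 2 = 16 * Real.log (1 + t) ^ 2 / c := by
        field_simp; ring
      rw [h6, ← mul_div_assoc]
      have := Real.pi_le_four
      have := Real.pi_pos
      have h7 : (t / 2) ^ 2 ≤ Real.log (1 + t) ^ 2 := by gcongr
      refine div_le_div_of_nonneg_right ?_ hc0.le
      have h8 : Real.pi * (t - Real.log (1 + t)) ≤ 4 * t ^ 2 := by
        gcongr
        nlinarith
      linarith)
  rw [mul_div_assoc, Real.sqrt_mul (by positivity), Real.sqrt_sq (by norm_num)] at h5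
  exact h5

theorem abs_one_div_sin_sub_le {x : ℝ} (hx0 : 0 < x) (hx1 : x ≤ 1) :
    |1 / Real.sin x - 1 / x| ≤ 1 := by
  have h1 := Real.sin_gt_sub_cube hx0
  have h2 := Real.sin_lt hx0
  have h3 : 3 / 4 * x ≤ Real.sin x := by
    nlinarith [mul_pos hx0 hx0, mul_nonneg hx0.le (sub_nonneg.2 hx1),
      mul_nonneg (mul_pos hx0 hx0).le (sub_nonneg.2 hx1)]
  have h4 : 0 < Real.sin x := by linarith
  rw [div_sub_div _ _ h4.ne' hx0.ne', abs_div, abs_of_pos (mul_pos h4 hx0),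
      div_le_one (mul_pos h4 hx0),
    abs_of_nonneg (by linarith)]
  nlinarith [mul_pos hx0 hx0, mul_nonneg (mul_pos hx0 hx0).le (sub_nonneg.2 hx1)]

theorem abs_sawError_add_cos_le (N : ℕ) {b y w j : ℝ} (hb : 0 < b) (hj : 0 < j) (hy : j / b ≤ y)
    (hw : j / b ≤ w) (hyw : |y - w| ≤ 1 / (2 * b)) (hy1 : y ≤ 3 / 10) :
    |sawError N y + Real.cos ((2 * N + 1) * (Real.pi * y)) / ((2 * N + 1) * (Real.pi * w))| ≤
      ((b / (2 * N + 1)) ^ 2 + b / (2 * N + 1)) / (2 * j ^ 2) + 1 / (2 * N + 1) := by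
  have hjb : 0 < j / b := by positivity
  have hy0 : 0 < y := by linarith
  have hw0 : 0 < w := by linarith
  have hs := two_mul_le_sin_pi hy0.le (by linarith)
  have hs0 : 0 < Real.sin (Real.pi * y) := by linarith
  have h1 := (sawError_bounds N hy0 (by linarith)).2
  have hM : 0 < 2 * (N : ℝ) + 1 := by positivity
  set M := 2 * (N : ℝ) + 1
  have hpi := Real.pi_gt_three
  have h2 : 2 / (M ^ 2 * Real.sin (Real.pi * y) ^ 2) ≤ (b / M) ^ 2 / (2 * j ^ 2) := by
    calc 2 / (M ^ 2 * Real.sin (Real.pi * y) ^ 2) ≤ 2 / (M ^ 2 * (2 * (j / b)) ^ 2) := by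
          gcongr; linarith
      _ = _ := by field_simp
  have h3 : |1 / y - 1 / w| ≤ b / (2 * j ^ 2) := by
    rw [div_sub_div _ _ hy0.ne' hw0.ne', abs_div, abs_of_pos (mul_pos hy0 hw0), one_mul, mul_one,
      abs_sub_comm]
    calc |y - w| / (y * w) ≤ 1 / (2 * b) / (j / b * (j / b)) := by gcongr
      _ = _ := by field_simp
  have h4 := abs_one_div_sin_sub_le (x := Real.pi * y) (by positivity)
    (by nlinarith [Real.pi_lt_d2])
  have h5 : |1 / (Real.pi * y) - 1 / (Real.pi * w)| ≤ b / (2 * j ^ 2) := by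
    have : 1 / (Real.pi * y) - 1 / (Real.pi * w) = (1 / y - 1 / w) / Real.pi := by field_simp
    rw [this, abs_div, abs_of_pos Real.pi_pos, div_le_iff₀ Real.pi_pos]
    have : 0 ≤ b / (2 * j ^ 2) := by positivity
    nlinarith
  have h6 : |1 / Real.sin (Real.pi * y) - 1 / (Real.pi * w)| ≤ 1 + b / (2 * j ^ 2) := by
    have := abs_sub_le (1 / Real.sin (Real.pi * y)) (1 / (Real.pi * y)) (1 / (Real.pi * w))
    linarith
  have h7 := Real.abs_cos_le_one (M * (Real.pi * y))
  set C := Real.cos (M * (Real.pi * y))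
  have h8 : sawError N y + C / (M * (Real.pi * w)) =
      (sawError N y + C / (M * Real.sin (Real.pi * y))) -
        C * (1 / Real.sin (Real.pi * y) - 1 / (Real.pi * w)) / M := by
    field_simp
    ring
  have h9 : |C * (1 / Real.sin (Real.pi * y) - 1 / (Real.pi * w)) / M| ≤
      1 * (1 + b / (2 * j ^ 2)) / M := by
    rw [abs_div, abs_mul, abs_of_pos hM]
    gcongr
  rw [h8]
  calc _ ≤ _ := abs_sub _ _
    _ ≤ (b / M) ^ 2 / (2 * j ^ 2) + 1 * (1 + b / (2 * j ^ 2)) / M := add_le_add (h1.trans h2) h9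
    _ = _ := by field_simp; ring

theorem abs_sum_near_main_le (R : ℕ) (C θ : ℝ) :
    |∑ j ∈ Finset.range R, (Real.cos (C * (j + 2 - θ)) - Real.cos (C * (j + 1 + θ))) / (j + 3 / 2)|
      ≤ 76 := by
  have h1 : ∀ j ∈ Finset.range R,
      (Real.cos (C * (j + 2 - θ)) - Real.cos (C * (j + 1 + θ))) / ((j : ℝ) + 3 / 2) =
      -2 * Real.sin (C * (1 / 2 - θ)) *
        (Real.sin (C * (((j + 1 : ℕ) : ℝ) + 1 / 2)) / (((j + 1 : ℕ) : ℝ) + 1 / 2)) := fun j _ => by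
    rw [Real.cos_sub_cos]
    push_cast
    rw [show (C * ((j : ℝ) + 2 - θ) + C * (j + 1 + θ)) / 2 = C * (j + 1 + 1 / 2) by ring,
      show (C * ((j : ℝ) + 2 - θ) - C * (j + 1 + θ)) / 2 = C * (1 / 2 - θ) by ring,
      show (j : ℝ) + 3 / 2 = j + 1 + 1 / 2 by ring]
    ring
  rw [Finset.sum_congr rfl h1, ← Finset.mul_sum]
  have h2 := abs_sum_sin_half_div_le (R + 1) C
  rw [Finset.sum_range_succ'] at h2
  have h3 := Real.abs_sin_le_one (C * (1 / 2 - θ))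
  have h4 := Real.abs_sin_le_one (C * (1 / 2))
  generalize ∑ j ∈ Finset.range R,
    Real.sin (C * (((j + 1 : ℕ) : ℝ) + 1 / 2)) / (((j + 1 : ℕ) : ℝ) + 1 / 2) = X at h2 ⊢
  have h5 : |X| ≤ 38 := by
    push_cast at h2
    rw [zero_add] at h2
    rw [abs_le] at h2 h4 ⊢
    constructor <;> linarith [h2.1, h2.2, h4.1, h4.2]
  rw [abs_mul, abs_mul, abs_neg, abs_two]
  calc 2 * |Real.sin (C * (1 / 2 - θ))| * |X| ≤ 2 * 1 * 38 := by gcongr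
    _ = 76 := by norm_num

theorem abs_sum_sawError_near_le (N R : ℕ) {c κ θ : ℝ} (hc : 2 / 3 ≤ c) (hθ0 : 0 ≤ θ)
    (hθ1 : θ ≤ 1) (hκ : 0 < κ) (hR : (R : ℝ) + 1 ≤ κ / 8) :
    |∑ j ∈ Finset.range R, (sawError N (-Real.log (1 - (j + 1 + θ) / κ) / c) -
        sawError N (Real.log (1 + (j + 2 - θ) / κ) / c))| ≤
      8 * (R * √(c / (2 * N + 1))) + 2 * (c * κ / (2 * N + 1)) ^ 2 + 28 * (c * κ / (2 * N + 1)) +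
        2 * (R / (2 * N + 1)) := by
  have hc0 : 0 < c := by linarith
  have hpi := Real.pi_gt_three
  set S := sawError N with hS
  obtain ⟨M, hM⟩ : ∃ M, M = 2 * (N : ℝ) + 1 := ⟨_, rfl⟩
  have hM0 : 0 < M := by rw [hM]; positivity
  obtain ⟨b, hb⟩ : ∃ b, b = c * κ := ⟨_, rfl⟩
  have hb0 : 0 < b := by rw [hb]; positivity
  have hsplit : ∀ j ∈ Finset.range R, |S (-Real.log (1 - (j + 1 + θ) / κ) / c) -
        S (Real.log (1 + (j + 2 - θ) / κ) / c) - b / (M * Real.pi) *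
        ((Real.cos (M * Real.pi / b * (j + 2 - θ)) - Real.cos (M * Real.pi / b * (j + 1 + θ))) /
          (j + 3 / 2))| ≤ 8 * √(c / M) + 2 * (1 / M) +
            ((b / M) ^ 2 + b / M) * (1 / ((j : ℝ) + 1) ^ 2) := by
    intro j hj
    have hjR : (j : ℝ) + 1 ≤ R := by exact_mod_cast Finset.mem_range.1 hj
    have hj0 : (0 : ℝ) ≤ j := j.cast_nonneg
    have t1 : 0 < (j + 1 + θ) / κ := by positivity
    have t2 : (j + 1 + θ) / κ ≤ 1 / 8 := by rw [div_le_iff₀ hκ]; linarith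
    have t3 : 0 < (j + 2 - θ) / κ := div_pos (by linarith) hκ
    have t4 : (j + 2 - θ) / κ ≤ 1 / 8 := by rw [div_le_iff₀ hκ]; linarith
    have e1 := abs_sawError_neg_log_sub_le N hc t1 t2
    have e2 := abs_sawError_log_sub_le N hc t3 t4
    have y1 : (j + 1 + θ) / κ / c = (j + 1 + θ) / b := by rw [hb]; field_simp
    have y2 : (j + 2 - θ) / κ / c = (j + 2 - θ) / b := by rw [hb]; field_simp
    have y3 : (j + 1 + θ) / κ / c ≤ 3 / 10 := by rw [div_le_iff₀ hc0]; linarith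
    have y4 : (j + 2 - θ) / κ / c ≤ 3 / 10 := by rw [div_le_iff₀ hc0]; linarith
    have hw : ((j : ℝ) + 1) / b ≤ (j + 3 / 2) / b := by gcongr; norm_num
    have hd1 : |(j + 1 + θ) / b - (j + 3 / 2) / b| ≤ 1 / (2 * b) := by
      rw [← sub_div, abs_div, abs_of_pos hb0, ← div_div]
      gcongr
      rw [abs_le]; constructor <;> linarith
    have hd2 : |(j + 2 - θ) / b - (j + 3 / 2) / b| ≤ 1 / (2 * b) := by
      rw [← sub_div, abs_div, abs_of_pos hb0, ← div_div]
      gcongr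
      rw [abs_le]; constructor <;> linarith
    have e3 := abs_sawError_add_cos_le N (j := j + 1) hb0 (by positivity)
      (div_le_div_of_nonneg_right (by linarith) hb0.le) hw hd1 (y1 ▸ y3)
    have e4 := abs_sawError_add_cos_le N (j := j + 1) hb0 (by positivity)
      (div_le_div_of_nonneg_right (by linarith) hb0.le) hw hd2 (y2 ▸ y4)
    rw [y1] at e1
    rw [y2] at e2
    rw [← hM] at e1 e2 e3 e4
    rw [← hS] at e1 e2 e3 e4
    have c1 : Real.cos (M * (Real.pi * ((j + 1 + θ) / b))) / (M * (Real.pi * ((j + 3 / 2) / b))) =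
        b / (M * Real.pi) * (Real.cos (M * Real.pi / b * (j + 1 + θ)) / (j + 3 / 2)) := by
      rw [show M * (Real.pi * ((j + 1 + θ) / b)) = M * Real.pi / b * (j + 1 + θ) by ring]
      field_simp
    have c2 : Real.cos (M * (Real.pi * ((j + 2 - θ) / b))) / (M * (Real.pi * ((j + 3 / 2) / b))) =
        b / (M * Real.pi) * (Real.cos (M * Real.pi / b * (j + 2 - θ)) / (j + 3 / 2)) := by
      rw [show M * (Real.pi * ((j + 2 - θ) / b)) = M * Real.pi / b * (j + 2 - θ) by ring]
      field_simp
    rw [c1] at e3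
    rw [c2] at e4
    rw [sub_div (Real.cos _), mul_sub]
    have c3 : ((b / M) ^ 2 + b / M) * (1 / ((j : ℝ) + 1) ^ 2) =
        2 * (((b / M) ^ 2 + b / M) / (2 * ((j : ℝ) + 1) ^ 2)) := by field_simp
    rw [c3]
    rw [abs_le] at *
    constructor <;> linarith [e1.1, e1.2, e2.1, e2.2, e3.1, e3.2, e4.1, e4.2]
  have h1 := Finset.abs_sum_le_sum_abs (fun j : ℕ => S (-Real.log (1 - (j + 1 + θ) / κ) / c) -
        S (Real.log (1 + (j + 2 - θ) / κ) / c) - b / (M * Real.pi) *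
        ((Real.cos (M * Real.pi / b * (j + 2 - θ)) - Real.cos (M * Real.pi / b * (j + 1 + θ))) /
          (j + 3 / 2))) (Finset.range R)
  have h2 := h1.trans (Finset.sum_le_sum hsplit)
  rw [Finset.sum_sub_distrib, ← Finset.mul_sum, Finset.sum_add_distrib, ← Finset.mul_sum,
    Finset.sum_const, Finset.card_range, nsmul_eq_mul] at h2
  have h3 := abs_sum_near_main_le R (M * Real.pi / b) θ
  have h4 := sum_range_one_div_sq_le R
  have h5 : |b / (M * Real.pi) * ∑ j ∈ Finset.range R,
      (Real.cos (M * Real.pi / b * (j + 2 - θ)) - Real.cos (M * Real.pi / b * (j + 1 + θ))) /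
        ((j : ℝ) + 3 / 2)| ≤ 26 * (b / M) := by
    rw [abs_mul, abs_of_pos (by positivity)]
    calc _ ≤ b / (M * Real.pi) * 76 := by gcongr
      _ ≤ b / (M * 3) * 76 := by gcongr
      _ ≤ _ := by
        rw [← div_div]
        have : 0 < b / M := by positivity
        linarith
  have h6 : ((b / M) ^ 2 + b / M) * ∑ n ∈ Finset.range R, 1 / ((n : ℝ) + 1) ^ 2 ≤
      ((b / M) ^ 2 + b / M) * 2 := by gcongr
  rw [← hM, ← hb]
  have h7 : (R : ℝ) * (8 * √(c / M) + 2 * (1 / M)) = 8 * (R * √(c / M)) + 2 * (R / M) := by ring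
  rw [h7] at h2
  rw [abs_le] at *
  constructor <;> linarith [h2.1, h2.2, h5.1, h5.2]

end NearZone

section FarZone

theorem tan_half_add_tan_half {x : ℝ} (hx0 : 0 < x) (hx1 : x < 1) :
    Real.tan (Real.pi / 2 * x) + Real.tan (Real.pi / 2 * (1 - x)) = 2 / Real.sin (Real.pi * x) := by
  have hpi := Real.pi_pos
  have h1 : 0 < Real.sin (Real.pi / 2 * x) :=
    Real.sin_pos_of_pos_of_lt_pi (by positivity) (by nlinarith)
  have h2 : 0 < Real.cos (Real.pi / 2 * x) :=
    Real.cos_pos_of_mem_Ioo ⟨by nlinarith, by nlinarith⟩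
  rw [show Real.pi / 2 * (1 - x) = Real.pi / 2 - Real.pi / 2 * x by ring,
    Real.tan_pi_div_two_sub, show Real.pi * x = 2 * (Real.pi / 2 * x) by ring, Real.sin_two_mul,
    Real.tan_eq_sin_div_cos, inv_div]
  generalize Real.pi / 2 * x = z at *
  field_simp
  exact Real.sin_sq_add_cos_sq _

theorem tan_half_nonneg {x : ℝ} (hx0 : 0 < x) (hx1 : x < 1) : 0 ≤ Real.tan (Real.pi / 2 * x) := by
  have hpi := Real.pi_pos
  exact Real.tan_nonneg_of_nonneg_of_le_pi_div_two (by positivity) (by nlinarith)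

theorem tan_half_le_tan_half {x y : ℝ} (hx0 : 0 < x) (hxy : x ≤ y) (hy : y < 1) :
    Real.tan (Real.pi / 2 * x) ≤ Real.tan (Real.pi / 2 * y) := by
  have hpi := Real.pi_pos
  exact Real.strictMonoOn_tan.monotoneOn ⟨by nlinarith, by nlinarith⟩ ⟨by nlinarith, by nlinarith⟩
    (by gcongr)

theorem abs_sum_cos_div_sin_le {a b : ℕ} {x : ℕ → ℝ} {z : ℕ → ℂ} {H B M : ℝ} (hM : 0 < M)
    (hx0 : ∀ m, a ≤ m → m < b → 0 < x m) (hx1 : ∀ m, a ≤ m → m < b → x m < 1)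
    (hanti : ∀ m, a ≤ m → m + 1 < b → x (m + 1) ≤ x m)
    (hH : ∀ m, a ≤ m → m < b → 2 / Real.sin (Real.pi * x m) ≤ H)
    (hre : ∀ m, a ≤ m → m < b → (z m).re = Real.cos (M * (Real.pi * x m)))
    (hz : ∀ m, a ≤ m → m ≤ b → ‖∑ j ∈ Finset.Ico a m, z j‖ ≤ B) (hB : 0 ≤ B) (hH0 : 0 ≤ H) :
    |∑ m ∈ Finset.Ico a b, Real.cos (M * (Real.pi * x m)) / (M * Real.sin (Real.pi * x m))| ≤
      4 * H * B / M := by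
  have h1 := norm_sum_mul_le_of_antitone (g := fun m => Real.tan (Real.pi / 2 * x m)) (z := z)
    (H := H) (B := B) (fun m h h' => tan_half_le_tan_half (hx0 _ (by omega) h') (hanti m h h')
      (hx1 m h (by omega))) (fun m h h' => by
        rw [abs_of_nonneg (tan_half_nonneg (hx0 m h h') (hx1 m h h'))]
        have e1 := tan_half_add_tan_half (hx0 m h h') (hx1 m h h')
        have e2 := tan_half_nonneg (x := 1 - x m) (by linarith [hx1 m h h'])
            (by linarith [hx0 m h h'])
        linarith [hH m h h']) hz hB hH0
  have h2 := norm_sum_mul_le_of_monotone (g := fun m => Real.tan (Real.pi / 2 * (1 - x m))) (z := z)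
    (H := H) (B := B) (fun m h h' => tan_half_le_tan_half
      (by linarith [hx1 m h (by omega)]) (by linarith [hanti m h h'])
      (by linarith [hx0 (m + 1) (by omega) h'])) (fun m h h' => by
        have e2 := tan_half_nonneg (x := 1 - x m) (by linarith [hx1 m h h'])
            (by linarith [hx0 m h h'])
        rw [abs_of_nonneg e2]
        have e1 := tan_half_add_tan_half (hx0 m h h') (hx1 m h h')
        have e3 := tan_half_nonneg (hx0 m h h') (hx1 m h h')
        linarith [hH m h h']) hz hB hH0
  have h3 : ∑ m ∈ Finset.Ico a b, Real.cos (M * (Real.pi * x m)) / (M * Real.sin (Real.pi * x m)) =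
      (∑ m ∈ Finset.Ico a b, ((Real.tan (Real.pi / 2 * x m) : ℝ) : ℂ) * z m +
        ∑ m ∈ Finset.Ico a b, ((Real.tan (Real.pi / 2 * (1 - x m)) : ℝ) : ℂ) * z m).re /
            (2 * M) := by
    rw [← Finset.sum_add_distrib, Complex.re_sum, Finset.sum_div]
    refine Finset.sum_congr rfl fun m hm => ?_
    obtain ⟨h, h'⟩ := Finset.mem_Ico.1 hm
    rw [← add_mul, ← Complex.ofReal_add, tan_half_add_tan_half (hx0 m h h') (hx1 m h h'),
      Complex.re_ofReal_mul, hre m h h']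
    field_simp
  rw [h3, abs_div, abs_of_pos (by positivity : (0 : ℝ) < 2 * M), div_le_div_iff₀ (by positivity) hM]
  have h4 := (Complex.abs_re_le_norm _).trans ((norm_add_le _ _).trans (add_le_add h1 h2))
  nlinarith

theorem abs_sum_sawError_far_le (N : ℕ) {a b : ℕ} {k κ R : ℝ} (hk : 1 < k) (hκ : 0 < κ) (hR : 0 < R)
    (ha : 1 ≤ a) (hab : a ≤ b)
    (h : ∀ m : ℕ, a ≤ m → m < b → κ + R ≤ m ∧ m + R ≤ k * κ) :
    |∑ m ∈ Finset.Ico a b, sawError N (Real.log (k * κ / m) / Real.log k)| ≤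
      b * (Real.log k * k * κ / ((2 * N + 1) * R)) ^ 2 +
        4 * (Real.log k * k * κ / ((2 * N + 1) * R)) *
          (((2 * N + 1) / (2 * Real.log k) / a + 1) *
            (3 * (b / √((2 * N + 1) / (2 * Real.log k))) + 3)) := by
  have hk0 : 0 < k := by linarith
  obtain ⟨c, hc⟩ : ∃ c, c = Real.log k := ⟨_, rfl⟩
  have hc0 : 0 < c := by rw [hc]; exact Real.log_pos hk
  obtain ⟨M, hM⟩ : ∃ M, M = 2 * (N : ℝ) + 1 := ⟨_, rfl⟩
  have hM0 : 0 < M := by rw [hM]; positivity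
  rw [← hM, ← hc]
  set x : ℕ → ℝ := fun m => Real.log (k * κ / m) / c with hx
  obtain ⟨y, hy⟩ : ∃ y, y = R / (c * k * κ) := ⟨_, rfl⟩
  have hy0 : 0 < y := by rw [hy]; positivity
  have hxl : ∀ m : ℕ, a ≤ m → m < b → y ≤ x m ∧ y ≤ 1 - x m := by
    intro m h1 h2
    have hm : (0 : ℝ) < m := by exact_mod_cast (by omega : 0 < m)
    obtain ⟨h3, h4⟩ := h m h1 h2
    constructor
    · rw [hy, show R / (c * k * κ) = R / (k * κ) / c by field_simp, hx]
      refine div_le_div_of_nonneg_right ?_ hc0.le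
      have := Real.one_sub_inv_le_log_of_pos (by positivity : 0 < k * κ / m)
      rw [inv_div] at this
      have h5 : R / (k * κ) ≤ 1 - m / (k * κ) := by
        rw [le_sub_iff_add_le, ← add_div, div_le_one (by positivity)]
        linarith
      linarith
    · have e1 : 1 - x m = Real.log (m / κ) / c := by
        rw [hx, eq_div_iff hc0.ne', sub_mul, div_mul_cancel₀ _ hc0.ne', one_mul, hc,
          ← Real.log_div hk0.ne' (by positivity)]
        congr 1
        field_simp
      rw [e1, hy, show R / (c * k * κ) = R / (k * κ) / c by field_simp]
      refine div_le_div_of_nonneg_right ?_ hc0.le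
      have := Real.one_sub_inv_le_log_of_pos (by positivity : 0 < m / κ)
      rw [inv_div] at this
      have h5 : R / (k * κ) ≤ R / m := by gcongr; linarith
      have h6 : R / m ≤ 1 - κ / m := by
        rw [le_sub_iff_add_le, ← add_div, div_le_one (by positivity)]
        linarith
      linarith
  have hx0 : ∀ m, a ≤ m → m < b → 0 < x m := fun m h1 h2 => hy0.trans_le (hxl m h1 h2).1
  have hx1 : ∀ m, a ≤ m → m < b → x m < 1 := fun m h1 h2 => by linarith [(hxl m h1 h2).2]
  have hsin : ∀ m, a ≤ m → m < b → 2 * y ≤ Real.sin (Real.pi * x m) := fun m h1 h2 => by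
    have h3 := min_le_sin_pi (hx0 m h1 h2).le (hx1 m h1 h2).le
    have h4 : y ≤ min (x m) (1 - x m) := le_min (hxl m h1 h2).1 (hxl m h1 h2).2
    linarith
  set z : ℕ → ℂ := fun m => cexp (-(M * Real.pi * Real.log (k * κ) / c : ℝ) * I) *
    cexp (2 * Real.pi * I * (M / (2 * c) * Real.log m : ℝ)) with hz
  have hmain := abs_sum_cos_div_sin_le (a := a) (b := b) (x := x) (z := z) (H := 1 / y)
    (B := (M / (2 * c) / a + 1) * (3 * (b / √(M / (2 * c))) + 3)) hM0 hx0 hx1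
    (fun m h1 h2 => by
      have hm : (0 : ℝ) < m := by exact_mod_cast (by omega : 0 < m)
      rw [hx]
      refine div_le_div_of_nonneg_right (Real.log_le_log (by positivity) ?_) hc0.le
      gcongr
      linarith)
    (fun m h1 h2 => by
      have := hsin m h1 h2
      rw [div_le_div_iff₀ (by linarith) hy0]
      linarith)
    (fun m h1 h2 => by
      have hm : (0 : ℝ) < m := by exact_mod_cast (by omega : 0 < m)
      have e1 : z m = cexp ((-(M * (Real.pi * x m)) : ℝ) * I) := by
        rw [hz, hx]
        simp only
        rw [← Complex.exp_add, Real.log_div (by positivity) hm.ne']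
        congr 1
        push_cast
        have : (c : ℂ) ≠ 0 := by exact_mod_cast hc0.ne'
        field_simp
        ring
      rw [e1, Complex.exp_ofReal_mul_I_re, Real.cos_neg])
    (fun m h1 h2 => by
      rw [hz, ← Finset.mul_sum, norm_mul]
      have e1 : ‖cexp (-(M * Real.pi * Real.log (k * κ) / c : ℝ) * I)‖ = 1 := by
        rw [← Complex.ofReal_neg]
        exact Complex.norm_exp_ofReal_mul_I _
      rw [e1, one_mul]
      refine (norm_sum_cexp_log_le (Λ := M / (2 * c)) (by positivity) ha h1).trans ?_
      gcongr)
    (by positivity) (by positivity)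
  have hrem : ∀ m ∈ Finset.Ico a b, |sawError N (x m) + Real.cos (M * (Real.pi * x m)) /
      (M * Real.sin (Real.pi * x m))| ≤ (1 / (M * y)) ^ 2 := by
    intro m hm
    obtain ⟨h1, h2⟩ := Finset.mem_Ico.1 hm
    have h3 := (sawError_bounds N (hx0 m h1 h2) (hx1 m h1 h2)).2
    rw [← hM] at h3
    refine h3.trans ?_
    have h4 := hsin m h1 h2
    calc 2 / (M ^ 2 * Real.sin (Real.pi * x m) ^ 2) ≤ 2 / (M ^ 2 * (2 * y) ^ 2) := by gcongr
      _ = (1 / (M * y)) ^ 2 / 2 := by field_simp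
      _ ≤ _ := by linarith [sq_nonneg (1 / (M * y))]
  have hrem' := (Finset.abs_sum_le_sum_abs _ _).trans (Finset.sum_le_sum hrem)
  rw [Finset.sum_add_distrib, Finset.sum_const, Nat.card_Ico, nsmul_eq_mul] at hrem'
  have hy' : c * k * κ / (M * R) = 1 / (M * y) := by rw [hy]; field_simp
  have hcard : ((b - a : ℕ) : ℝ) * (1 / (M * y)) ^ 2 ≤ b * (1 / (M * y)) ^ 2 := by
    gcongr
    omega
  have h9 : 4 * (1 / y) * ((M / (2 * c) / a + 1) * (3 * (b / √(M / (2 * c))) + 3)) / M =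
      4 * (1 / (M * y)) * ((M / (2 * c) / a + 1) * (3 * (b / √(M / (2 * c))) + 3)) := by
    generalize (M / (2 * c) / a + 1) * (3 * (b / √(M / (2 * c))) + 3) = Q
    field_simp
  rw [h9] at hmain
  rw [hy']
  rw [abs_le] at *
  constructor <;> linarith [hmain.1, hmain.2, hrem'.1, hrem'.2]

end FarZone

section Window

theorem natSqrt_bounds {κ : ℝ} (hκ : 64 ≤ κ) :
    1 ≤ Nat.sqrt ⌊κ⌋₊ ∧ (Nat.sqrt ⌊κ⌋₊ : ℝ) ≤ √κ ∧ √κ ≤ 2 * (Nat.sqrt ⌊κ⌋₊ : ℝ) ∧ √κ ≤ κ / 8 := by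
  have h8 : (8 : ℝ) ≤ √κ := Real.le_sqrt_of_sq_le (by linarith)
  have hsq : √κ ^ 2 = κ := Real.sq_sqrt (by linarith)
  have h1 : (Nat.sqrt ⌊κ⌋₊ : ℝ) ≤ √κ := by
    apply Real.le_sqrt_of_sq_le
    refine le_trans ?_ (Nat.floor_le (by linarith))
    exact_mod_cast Nat.sqrt_le' ⌊κ⌋₊
  have h2 : √κ ≤ (Nat.sqrt ⌊κ⌋₊ : ℝ) + 1 := by
    rw [Real.sqrt_le_left (by positivity)]
    refine (Nat.lt_floor_add_one κ).le.trans ?_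
    exact_mod_cast Nat.lt_succ_sqrt' ⌊κ⌋₊
  refine ⟨?_, h1, by linarith, by nlinarith⟩
  have h3 : (7 : ℝ) ≤ (Nat.sqrt ⌊κ⌋₊ : ℝ) := by linarith
  have : 7 ≤ Nat.sqrt ⌊κ⌋₊ := by exact_mod_cast h3
  omega

theorem sum_Ico_symm {M : Type*} [AddCommMonoid M] (f : ℕ → M) {F R : ℕ} (h : R ≤ F + 1) :
    ∑ m ∈ Finset.Ico (F + 1 - R) (F + 1 + R), f m =
      ∑ j ∈ Finset.range R, (f (F - j) + f (F + 1 + j)) := by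
  rw [← Finset.sum_Ico_consecutive f (by omega : F + 1 - R ≤ F + 1) (by omega),
    Finset.sum_add_distrib]
  congr 1
  · have h1 := Finset.sum_Ico_reflect f 0 h
    rw [Nat.sub_zero, Nat.Ico_zero_eq_range] at h1
    exact h1.symm
  · rw [Finset.sum_Ico_eq_sum_range]
    simp

/-- The contribution of the integers within `√κ` of `κ`, the two nearest ones excepted. -/
theorem abs_sum_window_sub_le (N : ℕ) {k : ℝ} (hk : 2 ≤ k) {T : ℕ → ℝ} {κ : ℝ} (hκ : 64 ≤ κ)
    (hT1 : ∀ m : ℕ, 0 < m → m ≤ κ → κ < k * m →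
      T m = sawError N (Real.log (κ / m) / Real.log k))
    (hT2 : ∀ m : ℕ, κ < m → m ≤ k * κ → T m = -sawError N (Real.log (m / κ) / Real.log k)) :
    |∑ m ∈ Finset.Ico (⌊κ⌋₊ + 1 - Nat.sqrt ⌊κ⌋₊) (⌊κ⌋₊ + 1 + Nat.sqrt ⌊κ⌋₊), T m -
        (T ⌊κ⌋₊ + T (⌊κ⌋₊ + 1))| ≤
      8 * (√(Real.log k) * √(κ / (2 * N + 1))) + 2 * (Real.log k * (κ / (2 * N + 1))) ^ 2 +
        28 * (Real.log k * (κ / (2 * N + 1))) + 2 * (κ / (2 * N + 1)) := by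
  obtain ⟨hR1, hR2, hR3, hR4⟩ := natSqrt_bounds hκ
  have hκ0 : 0 < κ := by linarith
  have hRF : Nat.sqrt ⌊κ⌋₊ ≤ ⌊κ⌋₊ := Nat.sqrt_le_self _
  have hF1 := Nat.floor_le hκ0.le
  have hF2 := Nat.lt_floor_add_one κ
  have hc : 2 / 3 ≤ Real.log k := by
    have := Real.log_two_gt_d9
    have := Real.log_le_log (by norm_num) hk
    linarith
  rw [sum_Ico_symm T (by omega)]
  set F := ⌊κ⌋₊
  obtain ⟨R, hR⟩ : ∃ R, Nat.sqrt F = R + 1 := ⟨Nat.sqrt F - 1, by omega⟩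
  rw [hR] at hR1 hR2 hR3 hRF ⊢
  rw [Finset.sum_range_succ']
  simp only [Nat.sub_zero, Nat.add_zero]
  rw [add_sub_cancel_right]
  push_cast at hR2
  have hnear := abs_sum_sawError_near_le N R (θ := κ - F) hc (by linarith) (by linarith) hκ0
    (by linarith)
  have hsum : ∑ j ∈ Finset.range R, (T (F - (j + 1)) + T (F + 1 + (j + 1))) =
      ∑ j ∈ Finset.range R, (sawError N (-Real.log (1 - (j + 1 + (κ - F)) / κ) / Real.log k) -
        sawError N (Real.log (1 + (j + 2 - (κ - F)) / κ) / Real.log k)) := by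
    refine Finset.sum_congr rfl fun j hj => ?_
    have hj' := Finset.mem_range.1 hj
    have hjR : (j : ℝ) + 1 ≤ R := by exact_mod_cast hj'
    have c1 : ((F - (j + 1) : ℕ) : ℝ) = F - (j + 1) := by
      rw [Nat.cast_sub (by omega)]; push_cast; ring
    rw [hT1 (F - (j + 1)) (by omega) (by rw [c1]; linarith) (by rw [c1]; nlinarith),
      hT2 (F + 1 + (j + 1)) (by push_cast; linarith) (by push_cast; nlinarith),
          ← sub_eq_add_neg, c1,
      ← Real.log_inv]
    congr 3
    · congr 1
      rw [show 1 - ((j : ℝ) + 1 + (κ - F)) / κ = (F - (j + 1)) / κ by field_simp; ring, inv_div]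
    · congr 1
      push_cast
      field_simp
      ring
  rw [hsum]
  refine hnear.trans ?_
  obtain ⟨M, hM⟩ : ∃ M, M = 2 * (N : ℝ) + 1 := ⟨_, rfl⟩
  have hM0 : 0 < M := by rw [hM]; positivity
  rw [← hM]
  have h1 : R * √(Real.log k / M) ≤ √(Real.log k) * √(κ / M) := by
    rw [Real.sqrt_div (by linarith), Real.sqrt_div (by linarith), ← mul_div_assoc, ← mul_div_assoc,
      mul_comm]
    gcongr
    linarith
  have h2 : (R : ℝ) / M ≤ κ / M := by gcongr; linarith
  rw [mul_div_assoc]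
  linarith

set_option maxHeartbeats 1000000 in
theorem abs_sum_between_le (N : ℕ) {k : ℝ} (hk : 2 ≤ k) {κ : ℝ} (hκ : 64 ≤ κ) {a b : ℕ}
    (ha : a = ⌊κ⌋₊ + 1 + Nat.sqrt ⌊κ⌋₊) (hb : b = ⌊k * κ⌋₊ + 1 - Nat.sqrt ⌊k * κ⌋₊) :
    a ≤ b ∧ |∑ m ∈ Finset.Ico a b, sawError N (Real.log (k * κ / m) / Real.log k)| ≤
      8 * Real.log k ^ 2 * k ^ 3 * (κ / (2 * N + 1)) ^ 2 +
        8 * Real.log k * k * (1 + κ / (2 * N + 1)) *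
          (6 * k * √(2 * Real.log k) * √(κ / (2 * N + 1)) + 3 / √κ) := by
  obtain ⟨hR1, hR2, hR3, hR4⟩ := natSqrt_bounds hκ
  have hκ0 : 0 < κ := by linarith
  have hkκ : 2 * κ ≤ k * κ := by gcongr
  obtain ⟨hR1', hR2', hR3', hR4'⟩ := natSqrt_bounds (κ := k * κ) (by linarith)
  have hF1 := Nat.floor_le hκ0.le
  have hF2 := Nat.lt_floor_add_one κ
  have hF1' := Nat.floor_le (a := k * κ) (by linarith)
  have hF2' := Nat.lt_floor_add_one (k * κ)
  have hRF' : Nat.sqrt ⌊k * κ⌋₊ ≤ ⌊k * κ⌋₊ := Nat.sqrt_le_self _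
  have hRR : Nat.sqrt ⌊κ⌋₊ ≤ Nat.sqrt ⌊k * κ⌋₊ := Nat.sqrt_le_sqrt (Nat.floor_mono (by linarith))
  have hRR' : (Nat.sqrt ⌊κ⌋₊ : ℝ) ≤ Nat.sqrt ⌊k * κ⌋₊ := by exact_mod_cast hRR
  have hR1c : (1 : ℝ) ≤ Nat.sqrt ⌊κ⌋₊ := by exact_mod_cast hR1
  have hac : (a : ℝ) = ⌊κ⌋₊ + 1 + Nat.sqrt ⌊κ⌋₊ := by rw [ha]; push_cast; ring
  have hbc : (b : ℝ) = ⌊k * κ⌋₊ + 1 - Nat.sqrt ⌊k * κ⌋₊ := by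
    rw [hb, Nat.cast_sub (by omega)]; push_cast; ring
  have hab : a ≤ b := by
    have : (a : ℝ) ≤ b := by rw [hac, hbc]; linarith
    exact_mod_cast this
  refine ⟨hab, ?_⟩
  have hc0 : 0 < Real.log k := Real.log_pos (by linarith)
  have hc : 1 / 2 ≤ Real.log k := by
    have := Real.log_two_gt_d9
    have := Real.log_le_log (by norm_num) hk
    linarith
  refine (abs_sum_sawError_far_le N (k := k) (κ := κ) (R := Nat.sqrt ⌊κ⌋₊) (by linarith) hκ0
    (by linarith) (by omega) hab ?_).trans ?_
  · intro m h1 h2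
    have h1' : (a : ℝ) ≤ m := by exact_mod_cast h1
    have h2' : (m : ℝ) + 1 ≤ b := by exact_mod_cast h2
    constructor <;> linarith
  generalize (Nat.sqrt ⌊κ⌋₊ : ℝ) = R at *
  obtain ⟨M, hM⟩ : ∃ M, M = 2 * (N : ℝ) + 1 := ⟨_, rfl⟩
  have hM0 : 0 < M := by rw [hM]; positivity
  rw [← hM]
  generalize Real.log k = c at *
  obtain ⟨s, hs⟩ : ∃ s, s = √κ := ⟨_, rfl⟩
  have hs0 : 0 < s := by rw [hs]; positivity
  have hsq : κ = s ^ 2 := by rw [hs, Real.sq_sqrt hκ0.le]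
  have hk0 : 0 < k := by linarith
  have ha1 : κ ≤ a := by linarith
  have hb1 : (b : ℝ) ≤ 2 * k * κ := by linarith
  rw [← hs] at hR3 ⊢
  have hR0 : 0 < R := by linarith
  have e1 : c * k * κ / (M * R) ≤ 2 * c * k * s / M := by
    rw [div_le_div_iff₀ (mul_pos hM0 hR0) hM0, hsq]
    have : s ^ 2 ≤ s * (2 * R) := by rw [sq]; gcongr
    calc c * k * s ^ 2 * M ≤ c * k * (s * (2 * R)) * M := by gcongr
      _ = _ := by ring
  have e2 : b * (c * k * κ / (M * R)) ^ 2 ≤ 8 * c ^ 2 * k ^ 3 * (κ / M) ^ 2 := by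
    calc b * (c * k * κ / (M * R)) ^ 2 ≤ (2 * k * κ) * (2 * c * k * s / M) ^ 2 := by gcongr
      _ = _ := by rw [hsq]; ring
  have e3 : M / (2 * c) / a + 1 ≤ M / κ * (1 + κ / M) := by
    calc M / (2 * c) / a + 1 ≤ M / 1 / κ + 1 := by gcongr; linarith
      _ = _ := by field_simp
  have e4 : b / √(M / (2 * c)) ≤ 2 * k * κ * √(2 * c) / √M := by
    rw [Real.sqrt_div hM0.le, div_div_eq_mul_div]
    gcongr
  refine add_le_add e2 ?_
  have hsM : √(κ / M) = s / √M := by rw [Real.sqrt_div hκ0.le, ← hs]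
  calc 4 * (c * k * κ / (M * R)) * ((M / (2 * c) / a + 1) * (3 * (b / √(M / (2 * c))) + 3))
      ≤ 4 * (2 * c * k * s / M) * ((M / κ * (1 + κ / M)) *
          (3 * (2 * k * κ * √(2 * c) / √M) + 3)) := by
        gcongr
    _ = 8 * c * k * (1 + κ / M) * (6 * k * √(2 * c) * √(κ / M) + 3 / s) := by
        rw [hsM, hsq]
        generalize √(2 * c) = u
        have : 0 < √M := by positivity
        generalize √M = v at *
        field_simp
        ring

end Window

section LogSaw

theorem fract_sub_log_of_le {k α κ : ℝ} {d m : ℕ} (hk : 1 < k) (hκ : κ = k ^ ((d : ℝ) + α))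
    (hm0 : 0 < m) (hm : m ≤ κ) (hm' : κ < k * m) :
    Int.fract (α - Real.log m / Real.log k) = Real.log (κ / m) / Real.log k := by
  have hc0 : 0 < Real.log k := Real.log_pos hk
  have hm0' : (0 : ℝ) < m := by exact_mod_cast hm0
  have hκ0 : 0 < κ := hm0'.trans_le hm
  rw [Int.fract_eq_iff]
  refine ⟨div_nonneg (Real.log_nonneg ((one_le_div hm0').2 hm)) hc0.le, ?_, -(d : ℤ), ?_⟩
  · rw [div_lt_one hc0]
    refine Real.log_lt_log (by positivity) ?_
    rwa [div_lt_iff₀ hm0']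
  · rw [Real.log_div hκ0.ne' hm0'.ne', hκ, Real.log_rpow (by linarith)]
    push_cast
    field_simp
    ring

theorem sawError_fract_of_lt {k α κ : ℝ} {d m : ℕ} (N : ℕ) (hk : 1 < k)
    (hκ : κ = k ^ ((d : ℝ) + α)) (hm : κ < m) (hm' : m ≤ k * κ) :
    sawError N (Int.fract (α - Real.log m / Real.log k)) =
      -sawError N (Real.log (m / κ) / Real.log k) := by
  have hκ0 : 0 < κ := by rw [hκ]; exact Real.rpow_pos_of_pos (by linarith) _
  have hc0 : 0 < Real.log k := Real.log_pos hk
  have hm0' : (0 : ℝ) < m := hκ0.trans hm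
  have h := fract_sub_log_of_le (d := d + 1) (α := α) (κ := k * κ) (m := m) hk (by
    rw [hκ]
    push_cast
    rw [show (d : ℝ) + 1 + α = 1 + (d + α) by ring, Real.rpow_add (by linarith) 1,
      Real.rpow_one])
    (by exact_mod_cast hm0') hm' (by gcongr)
  rw [h, ← sawError_one_sub, Real.log_div (by positivity) hm0'.ne',
      Real.log_mul (by linarith) hκ0.ne',
    Real.log_div hm0'.ne' hκ0.ne']
  congr 1
  field_simp
  ring

theorem abs_add_sawError_neighbors_le (N : ℕ) {k : ℝ} (hk : 2 ≤ k) {T : ℕ → ℝ} {κ δ : ℝ}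
    (hκ : 64 ≤ κ)
    (hT1 : ∀ m : ℕ, 0 < m → m ≤ κ → κ < k * m →
      T m = sawError N (Real.log (κ / m) / Real.log k))
    (hT2 : ∀ m : ℕ, κ < m → m ≤ k * κ → T m = -sawError N (Real.log (m / κ) / Real.log k))
    (hδ0 : 0 < δ) (hδ : ∀ a : ℤ, δ ≤ |κ - a|) :
    |T ⌊κ⌋₊ + T (⌊κ⌋₊ + 1)| ≤ 3 * Real.log k * κ / ((2 * N + 1) * δ) := by
  have hκ0 : 0 < κ := by linarith
  have hF1 := Nat.floor_le hκ0.le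
  have hF2 := Nat.lt_floor_add_one κ
  have hc : 2 / 3 ≤ Real.log k := by
    have := Real.log_two_gt_d9
    have := Real.log_le_log (by norm_num) hk
    linarith
  have hc0 : 0 < Real.log k := by linarith
  have hδ1 := hδ ⌊κ⌋₊
  have hδ2 := hδ (⌊κ⌋₊ + 1)
  set F := ⌊κ⌋₊
  have hF0 : (0 : ℝ) < F := by linarith
  push_cast at hδ1 hδ2
  rw [abs_of_nonneg (by linarith)] at hδ1
  rw [abs_sub_comm, abs_of_nonneg (by linarith)] at hδ2
  rw [hT1 F (by exact_mod_cast hF0) hF1 (by nlinarith),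
    hT2 (F + 1) (by push_cast; exact hF2) (by push_cast; nlinarith)]
  push_cast
  obtain ⟨M, hM⟩ : ∃ M, M = 2 * (N : ℝ) + 1 := ⟨_, rfl⟩
  have hM0 : 0 < M := by rw [hM]; positivity
  have x1 : δ / (Real.log k * κ) ≤ Real.log (κ / F) / Real.log k := by
    rw [mul_comm, ← div_div]
    gcongr
    have h := Real.one_sub_inv_le_log_of_pos (by positivity : 0 < κ / F)
    rw [inv_div] at h
    have : δ / κ ≤ 1 - F / κ := by
      rw [le_sub_iff_add_le, ← add_div, div_le_one hκ0]
      linarith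
    linarith
  have x2 : Real.log (κ / F) / Real.log k ≤ 1 / 2 := by
    rw [div_le_iff₀ hc0]
    have h := Real.log_le_sub_one_of_pos (by positivity : 0 < κ / F)
    have : κ / F ≤ 4 / 3 := by rw [div_le_iff₀ hF0]; linarith
    linarith
  have y1 : δ / (2 * Real.log k * κ) ≤ Real.log ((F + 1) / κ) / Real.log k := by
    rw [show δ / (2 * Real.log k * κ) = δ / (2 * κ) / Real.log k by field_simp]
    gcongr
    have h := Real.one_sub_inv_le_log_of_pos (by positivity : 0 < (F + 1) / κ)
    rw [inv_div] at h
    have h2 : δ / (F + 1) ≤ 1 - κ / (F + 1) := by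
      rw [le_sub_iff_add_le, ← add_div, div_le_one (by positivity)]
      linarith
    have h3 : δ / (2 * κ) ≤ δ / (F + 1) := by gcongr; linarith
    linarith
  have y2 : Real.log ((F + 1) / κ) / Real.log k ≤ 1 / 2 := by
    rw [div_le_iff₀ hc0]
    have h := Real.log_le_sub_one_of_pos (by positivity : 0 < (F + 1) / κ)
    have : (F + 1) / κ ≤ 4 / 3 := by rw [div_le_iff₀ hκ0]; linarith
    linarith
  have z1 : 0 < δ / (Real.log k * κ) := by positivity
  have z2 : 0 < δ / (2 * Real.log k * κ) := by positivity
  have b1 := abs_sawError_le_div N (z1.trans_le x1) x2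
  have b2 := abs_sawError_le_div N (z2.trans_le y1) y2
  rw [← hM] at b1 b2 ⊢
  have b1' := b1.trans (by gcongr : _ ≤ 1 / (M * (δ / (Real.log k * κ))))
  have b2' := b2.trans (by gcongr : _ ≤ 1 / (M * (δ / (2 * Real.log k * κ))))
  rw [← abs_neg] at b2'
  calc _ ≤ _ := abs_add_le _ _
    _ ≤ _ := add_le_add b1' b2'
    _ = _ := by field_simp; norm_num

theorem sum_Ico_le_of_ratio {s : ℕ → ℝ} (hs0 : ∀ d, 0 < s d) (hs : ∀ d, 4 / 3 * s d ≤ s (d + 1))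
    {a b : ℕ} (hab : a ≤ b) : ∑ d ∈ Finset.Ico a b, s d ≤ 3 * s b := by
  induction b, hab using Nat.le_induction with
  | base => simpa using (hs0 a).le
  | succ b hab ih =>
    rw [Finset.sum_Ico_succ_top hab]
    linarith [hs b]

theorem sum_Ico_one_div_le_of_ratio {s : ℕ → ℝ} (hs0 : ∀ d, 0 < s d)
    (hs : ∀ d, 4 / 3 * s d ≤ s (d + 1)) {a b : ℕ} (hab : a ≤ b) :
    ∑ d ∈ Finset.Ico a b, 1 / s d ≤ 4 / s a := by
  suffices h : ∑ d ∈ Finset.Ico a b, 1 / s d ≤ 4 / s a - 4 / s b from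
    h.trans (sub_le_self _ (div_nonneg (by norm_num) (hs0 b).le))
  induction b, hab using Nat.le_induction with
  | base => simp
  | succ b hab ih =>
    rw [Finset.sum_Ico_succ_top hab]
    have h1 : 4 / s (b + 1) ≤ 3 / s b := by
      rw [div_le_div_iff₀ (hs0 _) (hs0 _)]
      linarith [hs b]
    have h2 : 4 / s b = 3 / s b + 1 / s b := by rw [← add_div]; norm_num
    linarith

theorem exists_block_bound {k D : ℝ} (hk : 2 ≤ k) (hD : 1 ≤ D) : ∃ C : ℝ, 0 ≤ C ∧
    ∀ ρ s : ℝ, 0 ≤ ρ → ρ ≤ D → 0 < s →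
    (8 * (√(Real.log k) * √ρ) + 2 * (Real.log k * ρ) ^ 2 + 28 * (Real.log k * ρ) + 2 * ρ) +
      (8 * Real.log k ^ 2 * k ^ 3 * ρ ^ 2 + 8 * Real.log k * k * (1 + ρ) *
          (6 * k * √(2 * Real.log k) * √ρ + 3 / s)) ≤ C * (√ρ + 1 / s) := by
  have hc0 : 0 < Real.log k := Real.log_pos (by linarith)
  have hk0 : 0 < k := by linarith
  generalize Real.log k = c at *
  refine ⟨8 * √c + 2 * c ^ 2 * D ^ 2 + 28 * c * D + 2 * D + 8 * c ^ 2 * k ^ 3 * D ^ 2 +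
    8 * c * k * (1 + D) * (6 * k * √(2 * c)) + 8 * c * k * (1 + D) * 3, by positivity, ?_⟩
  intro ρ s hρ0 hρ hs
  have hr1 : √ρ ≤ D := (Real.sqrt_le_left (by linarith)).2 (by nlinarith)
  have hr : ρ ≤ D * √ρ := by
    calc ρ = √ρ * √ρ := (Real.mul_self_sqrt hρ0).symm
      _ ≤ _ := by gcongr
  have hr2 : ρ ^ 2 ≤ D ^ 2 * √ρ := by
    calc ρ ^ 2 = ρ * ρ := sq ρ
      _ ≤ D * (D * √ρ) := by gcongr
      _ = _ := by ring
  have hr0 : 0 ≤ √ρ := Real.sqrt_nonneg _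
  have hs' : 0 < 1 / s := by positivity
  have h3s : 3 / s = 3 * (1 / s) := by ring
  rw [h3s]
  generalize 1 / s = t at *
  calc _ = 8 * √c * √ρ + 2 * c ^ 2 * ρ ^ 2 + 28 * c * ρ + 2 * ρ + 8 * c ^ 2 * k ^ 3 * ρ ^ 2 +
      8 * c * k * (1 + ρ) * (6 * k * √(2 * c)) * √ρ + 8 * c * k * (1 + ρ) * 3 * t := by ring
    _ ≤ 8 * √c * √ρ + 2 * c ^ 2 * (D ^ 2 * √ρ) + 28 * c * (D * √ρ) + 2 * (D * √ρ) +
      8 * c ^ 2 * k ^ 3 * (D ^ 2 * √ρ) + 8 * c * k * (1 + D) * (6 * k * √(2 * c)) * √ρ +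
      8 * c * k * (1 + D) * 3 * t := by gcongr
    _ = (8 * √c + 2 * c ^ 2 * D ^ 2 + 28 * c * D + 2 * D + 8 * c ^ 2 * k ^ 3 * D ^ 2 +
      8 * c * k * (1 + D) * (6 * k * √(2 * c))) * √ρ + 8 * c * k * (1 + D) * 3 * t := by ring
    _ ≤ _ := by
      have e1 : 0 ≤ (8 * √c + 2 * c ^ 2 * D ^ 2 + 28 * c * D + 2 * D + 8 * c ^ 2 * k ^ 3 * D ^ 2 +
        8 * c * k * (1 + D) * (6 * k * √(2 * c))) * t := by positivity
      have e2 : 0 ≤ 8 * c * k * (1 + D) * 3 * √ρ := by positivity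
      linarith

end LogSaw

section Blocks

/-- The first integer of the window around `k ^ (d + α)`. -/
noncomputable def windowStart (k α : ℝ) (d : ℕ) : ℕ :=
  ⌊k ^ ((d : ℝ) + α)⌋₊ + 1 - Nat.sqrt ⌊k ^ ((d : ℝ) + α)⌋₊

theorem rpow_succ_add {k : ℝ} (hk : 0 < k) (α : ℝ) (d : ℕ) :
    k ^ (((d + 1 : ℕ) : ℝ) + α) = k * k ^ ((d : ℝ) + α) := by
  push_cast
  rw [show (d : ℝ) + 1 + α = 1 + (d + α) by ring, Real.rpow_add hk 1, Real.rpow_one]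

theorem exists_abs_sum_block_sub_le {k α D : ℝ} (hk : 2 ≤ k) (hD : 1 ≤ D) : ∃ C : ℝ, 0 ≤ C ∧
    ∀ N d : ℕ, 64 ≤ k ^ ((d : ℝ) + α) → k ^ ((d : ℝ) + α) / (2 * N + 1) ≤ D →
    windowStart k α d ≤ windowStart k α (d + 1) ∧
    |∑ m ∈ Finset.Ico (windowStart k α d) (windowStart k α (d + 1)),
        sawError N (Int.fract (α - Real.log m / Real.log k)) -
      (sawError N (Int.fract (α - Real.log ⌊k ^ ((d : ℝ) + α)⌋₊ / Real.log k)) +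
        sawError N (Int.fract (α - Real.log (⌊k ^ ((d : ℝ) + α)⌋₊ + 1 : ℕ) / Real.log k)))| ≤
      C * (√(k ^ ((d : ℝ) + α) / (2 * N + 1)) + 1 / √(k ^ ((d : ℝ) + α))) := by
  obtain ⟨C, hC, h⟩ := exists_block_bound hk hD
  refine ⟨C, hC, fun N d h64 hρ => ?_⟩
  have hk0 : 0 < k := by linarith
  have hws : windowStart k α (d + 1) = ⌊k * k ^ ((d : ℝ) + α)⌋₊ + 1 -
      Nat.sqrt ⌊k * k ^ ((d : ℝ) + α)⌋₊ := by rw [windowStart, rpow_succ_add hk0]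
  rw [hws, windowStart]
  obtain ⟨κ, hκ⟩ : ∃ κ, κ = k ^ ((d : ℝ) + α) := ⟨_, rfl⟩
  rw [← hκ] at h64 hρ ⊢
  have hκ0 : 0 < κ := by linarith
  obtain ⟨h1, h2⟩ := abs_sum_between_le N hk h64 rfl rfl
  have h3 := abs_sum_window_sub_le N hk
    (T := fun m : ℕ => sawError N (Int.fract (α - Real.log m / Real.log k))) h64
    (fun m e1 e2 e3 => by
      rw [fract_sub_log_of_le (by linarith) hκ e1 e2 e3])
    (fun m e1 e2 => sawError_fract_of_lt N (by linarith) hκ e1 e2)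
  have h4 : ∑ m ∈ Finset.Ico (⌊κ⌋₊ + 1 + Nat.sqrt ⌊κ⌋₊) (⌊k * κ⌋₊ + 1 - Nat.sqrt ⌊k * κ⌋₊),
        sawError N (Int.fract (α - Real.log m / Real.log k)) =
      ∑ m ∈ Finset.Ico (⌊κ⌋₊ + 1 + Nat.sqrt ⌊κ⌋₊) (⌊k * κ⌋₊ + 1 - Nat.sqrt ⌊k * κ⌋₊),
        sawError N (Real.log (k * κ / m) / Real.log k) := by
    refine Finset.sum_congr rfl fun m hm => ?_
    obtain ⟨e1, e2⟩ := Finset.mem_Ico.1 hm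
    have e3 := (natSqrt_bounds (κ := k * κ) (by nlinarith)).1
    have e4 : κ < m := (Nat.lt_floor_add_one κ).trans_le (by exact_mod_cast (by omega))
    have e5 : (m : ℝ) ≤ k * κ := (Nat.le_floor_iff (by positivity)).1 (by omega)
    rw [fract_sub_log_of_le (d := d + 1) (κ := k * κ) (by linarith)
      (by rw [rpow_succ_add hk0, hκ]) (by exact_mod_cast hκ0.trans e4) e5 (by gcongr)]
  have h5 := h (κ / (2 * N + 1)) (√κ) (by positivity) hρ (by positivity)
  refine ⟨by omega, ?_⟩
  rw [← Finset.sum_Ico_consecutive _ (by omega : ⌊κ⌋₊ + 1 - Nat.sqrt ⌊κ⌋₊ ≤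
    ⌊κ⌋₊ + 1 + Nat.sqrt ⌊κ⌋₊) h1, h4, add_sub_right_comm]
  exact (abs_add_le _ _).trans ((add_le_add h3 h2).trans h5)

theorem abs_sum_Ico_blocks_le {T E U : ℕ → ℝ} {w : ℕ → ℕ} {a b : ℕ} (hab : a ≤ b)
    (hw : ∀ d, a ≤ d → d < b → w d ≤ w (d + 1))
    (h : ∀ d, a ≤ d → d < b → |∑ m ∈ Finset.Ico (w d) (w (d + 1)), T m - E d| ≤ U d) :
    w a ≤ w b ∧ |∑ m ∈ Finset.Ico (w a) (w b), T m| ≤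
      ∑ d ∈ Finset.Ico a b, U d + ∑ d ∈ Finset.Ico a b, |E d| := by
  induction b, hab using Nat.le_induction with
  | base => simp
  | succ b hab ih =>
    obtain ⟨h1, h2⟩ := ih (fun d e e' => hw d e (by omega)) (fun d e e' => h d e (by omega))
    have h3 := hw b hab (by omega)
    refine ⟨h1.trans h3, ?_⟩
    rw [← Finset.sum_Ico_consecutive _ h1 h3, Finset.sum_Ico_succ_top hab,
      Finset.sum_Ico_succ_top hab]
    have h4 := h b hab (by omega)
    have h5 := abs_add_le (∑ m ∈ Finset.Ico (w a) (w b), T m)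
      (∑ m ∈ Finset.Ico (w b) (w (b + 1)), T m)
    have h6 := abs_add_le (∑ m ∈ Finset.Ico (w b) (w (b + 1)), T m - E b) (E b)
    rw [sub_add_cancel] at h6
    linarith

/-- A geometric bound on the initial terms, and a uniform one on the remaining terms. -/
theorem sum_Ico_le_of_geometric {k η X B₀ : ℝ} {L : ℕ} {e : ℕ → ℝ} {a b : ℕ} (hk : 2 ≤ k)
    (hη : 0 < η) (hX : 0 ≤ X) (hB : 0 ≤ B₀)
    (h1 : ∀ d, a ≤ d → d < b → e d ≤ X * k ^ ((1 + η) * d - L))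
    (h2 : ∀ d, a ≤ d → d < b → e d ≤ B₀) (hab : a ≤ b) (hL : L ≤ b) :
    ∑ d ∈ Finset.Ico a b, e d ≤ 3 * X + B₀ * (b - L + η * L + 1) := by
  have hk0 : 0 < k := by linarith
  obtain ⟨c, hc⟩ : ∃ c, c = ⌊(L : ℝ) / (1 + η)⌋₊ := ⟨_, rfl⟩
  have hc1 : (c : ℝ) ≤ L / (1 + η) := by rw [hc]; exact Nat.floor_le (by positivity)
  have hc2 : (L : ℝ) / (1 + η) < c + 1 := by rw [hc]; exact Nat.lt_floor_add_one _
  have hL1 : (L : ℝ) - η * L ≤ L / (1 + η) := by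
    rw [le_div_iff₀ (by positivity)]
    have : 0 ≤ η ^ 2 * L := by positivity
    nlinarith
  have hc3 : (1 + η) * c ≤ L := by
    rw [le_div_iff₀ (by positivity)] at hc1
    linarith
  have hcb : c ≤ b := by
    have : (c : ℝ) ≤ L := by
      have : 0 ≤ η * c := by positivity
      linarith
    exact (by exact_mod_cast this : c ≤ L).trans hL
  have htail : ∀ a', a ≤ a' → c ≤ a' → a' ≤ b → ∑ d ∈ Finset.Ico a' b, e d ≤
      B₀ * (b - L + η * L + 1) := by
    intro a' e1 e2 e3
    calc ∑ d ∈ Finset.Ico a' b, e d ≤ ∑ d ∈ Finset.Ico a' b, B₀ :=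
          Finset.sum_le_sum fun d hd => h2 d (e1.trans (Finset.mem_Ico.1 hd).1)
              (Finset.mem_Ico.1 hd).2
      _ = B₀ * (b - a') := by
          rw [Finset.sum_const, Nat.card_Ico, nsmul_eq_mul, Nat.cast_sub e3, mul_comm]
      _ ≤ _ := by
          have : (c : ℝ) ≤ a' := by exact_mod_cast e2
          gcongr
          linarith
  by_cases hac : c ≤ a
  · linarith [htail a le_rfl hac hab]
  · rw [← Finset.sum_Ico_consecutive _ (by omega : a ≤ c) hcb]
    refine add_le_add ?_ (htail c (by omega) le_rfl hcb)
    have h3 := sum_Ico_le_of_ratio (s := fun d : ℕ => k ^ ((1 + η) * (d : ℝ) - L))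
      (fun d => Real.rpow_pos_of_pos hk0 _) (fun d => by
        push_cast
        rw [show (1 + η) * ((d : ℝ) + 1) - L = (1 + η) + ((1 + η) * d - L) by ring,
          Real.rpow_add hk0 (1 + η)]
        have : k ^ (1 : ℝ) ≤ k ^ (1 + η) := Real.rpow_le_rpow_of_exponent_le (by linarith)
          (by linarith)
        rw [Real.rpow_one] at this
        gcongr
        linarith) (by omega : a ≤ c)
    have h4 : k ^ ((1 + η) * (c : ℝ) - L) ≤ 1 :=
      Real.rpow_le_one_of_one_le_of_nonpos (by linarith) (by linarith)
    calc ∑ d ∈ Finset.Ico a c, e d ≤ ∑ d ∈ Finset.Ico a c, X * k ^ ((1 + η) * (d : ℝ) - L) :=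
          Finset.sum_le_sum fun d hd => h1 d (Finset.mem_Ico.1 hd).1
            ((Finset.mem_Ico.1 hd).2.trans_le hcb)
      _ = X * ∑ d ∈ Finset.Ico a c, k ^ ((1 + η) * (d : ℝ) - L) := by rw [Finset.mul_sum]
      _ ≤ X * (3 * 1) := by gcongr; linarith
      _ = _ := by ring

end Blocks

section SawTotal

theorem exists_abs_sum_sawError_le {k α η : ℝ} (hk : 2 ≤ k) (hα0 : 0 ≤ α) (hα1 : α < 1)
    (hη : 0 < η) {d₀ : ℕ}
    (hd₀ : ∀ d ≥ d₀, ∀ a : ℤ, k ^ (-(η * d)) ≤ |k ^ ((d : ℝ) + α) - a|) :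
    ∃ C : ℝ, ∃ L₀ : ℕ, ∀ L ≥ L₀, ∀ N : ℕ, k ^ L ≤ N →
      |∑ m ∈ Finset.Ico 1 (windowStart k α (L + 6)),
        sawError N (Int.fract (α - Real.log m / Real.log k))| ≤ C + 20 * η * L := by
  have hk0 : 0 < k := by linarith
  have hk1 : 1 ≤ k := by linarith
  have hc0 : 0 < Real.log k := Real.log_pos (by linarith)
  obtain ⟨C, hC, hblock⟩ := exists_abs_sum_block_sub_le (α := α) hk
    (one_le_pow₀ (n := 7) hk1 : 1 ≤ k ^ 7)
  obtain ⟨D, hD6, hD0⟩ : ∃ D, 6 ≤ D ∧ d₀ ≤ D := ⟨max 6 d₀, le_max_left _ _, le_max_right _ _⟩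
  refine ⟨10 * windowStart k α D + C * (3 * √(k ^ 7) + 4) + 9 * Real.log k * k + 140, D,
    fun L hL N hN => ?_⟩
  set T : ℕ → ℝ := fun m => sawError N (Int.fract (α - Real.log m / Real.log k)) with hT
  have hT10 : ∀ m, |T m| ≤ 10 := fun m =>
    abs_sawError_le_const N (Int.fract_nonneg _) (Int.fract_lt_one _).le
  obtain ⟨M, hM⟩ : ∃ M, M = 2 * (N : ℝ) + 1 := ⟨_, rfl⟩
  have hLM : k ^ L ≤ M := by
    have : (0 : ℝ) ≤ N := N.cast_nonneg
    linarith
  have hM0 : 0 < M := (by positivity : 0 < k ^ L).trans_le hLM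
  have h64 : ∀ d, D ≤ d → 64 ≤ k ^ ((d : ℝ) + α) := by
    intro d hd
    have e1 : (6 : ℝ) ≤ d := by exact_mod_cast hD6.trans hd
    calc (64 : ℝ) = 2 ^ (6 : ℝ) := by norm_num
      _ ≤ k ^ (6 : ℝ) := by gcongr
      _ ≤ _ := Real.rpow_le_rpow_of_exponent_le hk1 (by linarith)
  have hup : ∀ d : ℕ, d ≤ L + 6 → k ^ ((d : ℝ) + α) / M ≤ k ^ 7 := by
    intro d hd
    rw [div_le_iff₀ hM0]
    have e1 : (d : ℝ) ≤ L + 6 := by exact_mod_cast hd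
    calc k ^ ((d : ℝ) + α) ≤ k ^ (((7 + L : ℕ) : ℝ)) :=
          Real.rpow_le_rpow_of_exponent_le hk1 (by push_cast; linarith)
      _ = k ^ 7 * k ^ L := by rw [Real.rpow_natCast, pow_add]
      _ ≤ _ := by gcongr
  have hratio : ∀ d : ℕ, 4 / 3 * √(k ^ ((d : ℝ) + α)) ≤ √(k ^ (((d + 1 : ℕ) : ℝ) + α)) := by
    intro d
    rw [rpow_succ_add hk0, Real.sqrt_mul hk0.le]
    gcongr
    exact Real.le_sqrt_of_sq_le (by linarith)
  have hbl : ∀ d, D ≤ d → d < L + 6 → _ := fun d e1 e2 =>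
    hblock N d (h64 d e1) (by rw [← hM]; exact hup d e2.le)
  rw [← hM] at hbl
  obtain ⟨hw, hmain⟩ := abs_sum_Ico_blocks_le (T := T) (w := windowStart k α)
    (E := fun d => T ⌊k ^ ((d : ℝ) + α)⌋₊ + T (⌊k ^ ((d : ℝ) + α)⌋₊ + 1))
    (U := fun d => C * (√(k ^ ((d : ℝ) + α) / M) + 1 / √(k ^ ((d : ℝ) + α))))
    (by omega : D ≤ L + 6) (fun d e1 e2 => (hbl d e1 e2).1) (fun d e1 e2 => (hbl d e1 e2).2)
  have hU : ∑ d ∈ Finset.Ico D (L + 6), C * (√(k ^ ((d : ℝ) + α) / M) + 1 / √(k ^ ((d : ℝ) + α))) ≤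
      C * (3 * √(k ^ 7) + 4) := by
    rw [← Finset.mul_sum, Finset.sum_add_distrib]
    have e1 := sum_Ico_le_of_ratio (s := fun d : ℕ => √(k ^ ((d : ℝ) + α) / M))
      (fun d => by positivity) (fun d => by
        rw [Real.sqrt_div (by positivity), Real.sqrt_div (by positivity), ← mul_div_assoc]
        gcongr
        exact hratio d) (by omega : D ≤ L + 6)
    have e2 := sum_Ico_one_div_le_of_ratio (s := fun d : ℕ => √(k ^ ((d : ℝ) + α)))
      (fun d => by positivity) hratio (by omega : D ≤ L + 6)
    have e3 : √(k ^ (((L + 6 : ℕ) : ℝ) + α) / M) ≤ √(k ^ 7) := Real.sqrt_le_sqrt (hup _ le_rfl)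
    have e4 : 4 / √(k ^ ((D : ℝ) + α)) ≤ 4 := by
      refine div_le_self (by norm_num) (Real.le_sqrt_of_sq_le ?_)
      linarith [h64 D le_rfl]
    gcongr
    · linarith
    · linarith
  have hE := sum_Ico_le_of_geometric (e := fun d => |T ⌊k ^ ((d : ℝ) + α)⌋₊ +
    T (⌊k ^ ((d : ℝ) + α)⌋₊ + 1)|) (X := 3 * Real.log k * k) (B₀ := 20) (L := L) (η := η)
    (a := D) (b := L + 6) hk hη (by positivity) (by norm_num) (fun d e1 e2 => by
      have e3 := abs_add_sawError_neighbors_le N hk (T := T) (h64 d e1)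
        (fun m f1 f2 f3 => by
          rw [hT]
          simp only
          rw [fract_sub_log_of_le (by linarith) rfl f1 f2 f3])
        (fun m f1 f2 => sawError_fract_of_lt N (by linarith) rfl f1 f2)
        (Real.rpow_pos_of_pos hk0 (-(η * d))) (hd₀ d (hD0.trans e1))
      refine e3.trans ?_
      rw [← hM]
      calc 3 * Real.log k * k ^ ((d : ℝ) + α) / (M * k ^ (-(η * d)))
          ≤ 3 * Real.log k * k ^ ((d : ℝ) + 1) / (k ^ L * k ^ (-(η * d))) := by gcongr
        _ = 3 * Real.log k * k * k ^ ((1 + η) * d - L) := by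
          rw [Real.rpow_sub hk0, Real.rpow_natCast, Real.rpow_neg hk0.le, Real.rpow_add hk0,
            Real.rpow_one, add_mul, one_mul, Real.rpow_add hk0]
          field_simp) (fun d e1 e2 => by
      have := abs_add_le (T ⌊k ^ ((d : ℝ) + α)⌋₊) (T (⌊k ^ ((d : ℝ) + α)⌋₊ + 1))
      linarith [hT10 ⌊k ^ ((d : ℝ) + α)⌋₊, hT10 (⌊k ^ ((d : ℝ) + α)⌋₊ + 1)])
    (by omega) (by omega)
  have hw1 : 1 ≤ windowStart k α D := by
    rw [windowStart]
    have := Nat.sqrt_le_self ⌊k ^ ((D : ℝ) + α)⌋₊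
    omega
  rw [← Finset.sum_Ico_consecutive _ hw1 hw]
  have hfirst : |∑ m ∈ Finset.Ico 1 (windowStart k α D), T m| ≤ 10 * windowStart k α D := by
    calc _ ≤ ∑ m ∈ Finset.Ico 1 (windowStart k α D), |T m| := Finset.abs_sum_le_sum_abs _ _
      _ ≤ ∑ m ∈ Finset.Ico 1 (windowStart k α D), (10 : ℝ) := Finset.sum_le_sum fun m _ => hT10 m
      _ ≤ _ := by
        rw [Finset.sum_const, Nat.card_Ico, nsmul_eq_mul, mul_comm]
        gcongr
        omega
  have h9 := abs_add_le (∑ m ∈ Finset.Ico 1 (windowStart k α D), T m)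
    (∑ m ∈ Finset.Ico (windowStart k α D) (windowStart k α (L + 6)), T m)
  push_cast at hE
  linarith

end SawTotal

section Assembly

theorem windowStart_bounds {k α : ℝ} {J : ℕ} (h64 : 64 ≤ k ^ ((J : ℝ) + α)) :
    7 / 8 * k ^ ((J : ℝ) + α) ≤ windowStart k α J ∧ (windowStart k α J : ℝ) ≤
        k ^ ((J : ℝ) + α) := by
  obtain ⟨h1, h2, -, h4⟩ := natSqrt_bounds h64
  obtain ⟨κ, hκ⟩ : ∃ κ, κ = k ^ ((J : ℝ) + α) := ⟨_, rfl⟩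
  rw [windowStart]
  rw [← hκ] at h64 h1 h2 h4 ⊢
  have hF1 := Nat.floor_le (show 0 ≤ κ by linarith)
  have hF2 := Nat.lt_floor_add_one κ
  have hle : Nat.sqrt ⌊κ⌋₊ ≤ ⌊κ⌋₊ := Nat.sqrt_le_self _
  have h1c : (1 : ℝ) ≤ Nat.sqrt ⌊κ⌋₊ := by exact_mod_cast h1
  rw [Nat.cast_sub (by omega)]
  push_cast
  constructor <;> linarith

theorem lt_iff_rpow_lt_windowStart {k α : ℝ} (hk : 2 ≤ k) {J : ℕ}
    (h64 : 64 ≤ k ^ ((J : ℝ) + α)) (d : ℕ) :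
    d < J ↔ k ^ ((d : ℝ) + α) < windowStart k α J := by
  obtain ⟨h1, h2⟩ := windowStart_bounds h64
  constructor
  · intro hd
    have h3 : k ^ (((d + 1 : ℕ) : ℝ) + α) ≤ k ^ ((J : ℝ) + α) :=
      Real.rpow_le_rpow_of_exponent_le (by linarith) (by gcongr; exact hd)
    rw [rpow_succ_add (by linarith)] at h3
    have h4 : 0 < k ^ ((d : ℝ) + α) := Real.rpow_pos_of_pos (by linarith) _
    nlinarith
  · intro hd
    by_contra! hJ
    have h3 : k ^ ((J : ℝ) + α) ≤ k ^ ((d : ℝ) + α) :=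
      Real.rpow_le_rpow_of_exponent_le (by linarith) (by gcongr)
    linarith

theorem exists_norm_sum_zetaTerm_add_le {k : ℕ} {α η : ℝ} (hk : 2 ≤ k) (hα0 : 0 ≤ α) (hα1 : α < 1)
    (hη : 0 < η) {d₀ : ℕ}
    (hd₀ : ∀ d ≥ d₀, ∀ a : ℤ, (k : ℝ) ^ (-(η * d)) ≤ |(k : ℝ) ^ ((d : ℝ) + α) - a|) :
    ∃ C : ℝ, ∃ L₀ : ℕ, ∀ L ≥ L₀, ∀ N : ℕ, k ^ L ≤ N → N ≤ k ^ (L + 1) →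
      ‖∑ n ∈ Finset.range N,
          (zetaTerm (Real.log k) α (n + 1) + zetaTerm (Real.log k) α (-(n + 1))) +
        2 * Real.pi * I *
          (∑ d ∈ Finset.range (L + 6), (Int.fract ((k : ℝ) ^ (d + α)) - 1 / 2) : ℝ)‖ ≤
        C + 40 * η * L := by
  have hkR : (2 : ℝ) ≤ k := by exact_mod_cast hk
  obtain ⟨C, L₀, hC⟩ := exists_abs_sum_sawError_le hkR hα0 hα1 hη hd₀
  refine ⟨40 + (4 + (k : ℝ) ^ 7) * Real.log k + 7 / Real.log k + 2 * C, L₀, fun L hL N h1 h2 => ?_⟩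
  have h1R : (k : ℝ) ^ L ≤ N := by exact_mod_cast h1
  have h2R : (N : ℝ) ≤ (k : ℝ) ^ (L + 1) := by exact_mod_cast h2
  have hsaw := hC L hL N h1R
  have hlog : 2 / 3 ≤ Real.log k := by
    have := Real.log_two_gt_d9
    have := Real.log_le_log (by norm_num) hkR
    linarith
  have hκ1 : (k : ℝ) ^ (L + 6) ≤ (k : ℝ) ^ (((L + 6 : ℕ) : ℝ) + α) := by
    rw [← Real.rpow_natCast]
    exact Real.rpow_le_rpow_of_exponent_le (by linarith) (by linarith)
  have hκ2 : (k : ℝ) ^ (((L + 6 : ℕ) : ℝ) + α) ≤ (k : ℝ) ^ (L + 7) := by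
    rw [← Real.rpow_natCast]
    refine Real.rpow_le_rpow_of_exponent_le (by linarith) ?_
    push_cast
    linarith
  have h64 : 64 ≤ (k : ℝ) ^ (((L + 6 : ℕ) : ℝ) + α) := by
    refine le_trans ?_ hκ1
    calc (64 : ℝ) = 2 ^ 6 := by norm_num
      _ ≤ 2 ^ (L + 6) := pow_le_pow_right₀ (by norm_num) (by omega)
      _ ≤ _ := by gcongr
  obtain ⟨hw1, hw2⟩ := windowStart_bounds h64
  have hJ := lt_iff_rpow_lt_windowStart hkR h64
  obtain ⟨a, ha⟩ : ∃ a, windowStart k α (L + 6) = a + 1 := by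
    refine Nat.exists_eq_add_one.2 ?_
    have : (0 : ℝ) < windowStart k α (L + 6) := by linarith
    exact_mod_cast this
  rw [ha] at hw1 hw2 hJ hsaw
  push_cast at hw1 hw2 hJ
  have hN : 1 ≤ N := (Nat.one_le_pow _ _ (by omega)).trans h1
  have hN0 : (0 : ℝ) ≤ N := by positivity
  have hB : (a : ℝ) + 1 ≤ (k : ℝ) ^ 7 * N := by
    have h3 : (k : ℝ) ^ (L + 7) = k ^ 7 * k ^ L := by rw [pow_add, mul_comm]
    have h4 : (k : ℝ) ^ 7 * k ^ L ≤ k ^ 7 * N := by gcongr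
    push_cast at hκ2
    linarith
  have haN : 2 * Real.pi * N / Real.log k ≤ a + 1 := by
    rw [div_le_iff₀ (by linarith)]
    have h3 : (k : ℝ) ^ (L + 6) = k ^ 5 * k ^ (L + 1) := by rw [← pow_add]; congr 1; ring
    have h4 : (32 : ℝ) * N ≤ k ^ 5 * k ^ (L + 1) := by
      have : (32 : ℝ) ≤ k ^ 5 := by
        calc (32 : ℝ) = 2 ^ 5 := by norm_num
          _ ≤ _ := by gcongr
      gcongr
    push_cast at hκ1
    have h5 : 28 * (N : ℝ) ≤ a + 1 := by linarith
    have hpi := Real.pi_lt_four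
    have h6 : 28 * (N : ℝ) * (2 / 3) ≤ (a + 1) * Real.log k := by gcongr
    nlinarith
  have hmain := norm_sum_zetaTerm_sub_le hk hα0 hα1 hN hJ haN hB
  rw [Finset.sum_Ico_eq_sum_range, Nat.add_sub_cancel] at hsaw
  simp only [Nat.cast_add, Nat.cast_one, add_comm (1 : ℝ)] at hsaw
  generalize (∑ m ∈ Finset.range a,
    sawError N (Int.fract (α - Real.log ((m : ℝ) + 1) / Real.log k))) = S at hmain hsaw
  have h7 := norm_add_le_of_le hmain
    (show ‖2 * I * (S : ℂ)‖ ≤ 2 * (C + 20 * η * L) by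
      simpa [Complex.norm_real] using hsaw)
  rw [sub_add_cancel] at h7
  linarith

theorem sum_Icc_erase_zero_eq {M : Type*} [AddCommMonoid M] (f : ℤ → M) (N : ℕ) :
    ∑ n ∈ (Finset.Icc (-(N : ℤ)) N).erase 0, f n =
      ∑ n ∈ Finset.range N, (f (n + 1) + f (-(n + 1))) := by
  induction N with
  | zero => simp
  | succ N ih =>
    have h : (Finset.Icc (-((N + 1 : ℕ) : ℤ)) (N + 1 : ℕ)).erase 0 =
        insert ((N : ℤ) + 1) (insert (-((N : ℤ) + 1)) ((Finset.Icc (-(N : ℤ)) N).erase 0)) := by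
      ext n
      simp only [Finset.mem_erase, Finset.mem_Icc, Finset.mem_insert]
      omega
    rw [h, Finset.sum_insert (by simp; omega), Finset.sum_insert (by simp), ih,
      Finset.sum_range_succ, ← add_assoc, add_comm]

theorem abs_sum_fract_sub_le (f : ℕ → ℝ) (m n : ℕ) :
    |∑ d ∈ Finset.range (m + n), Int.fract (f d) - ∑ d ∈ Finset.range m, Int.fract (f d)| ≤ n := by
  rw [Finset.sum_range_add, add_sub_cancel_left]
  refine (Finset.abs_sum_le_sum_abs _ _).trans ?_
  refine (Finset.sum_le_card_nsmul _ _ 1 fun d _ => ?_).trans (by simp)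
  rw [abs_of_nonneg (Int.fract_nonneg _)]
  exact (Int.fract_lt_one _).le

theorem exists_rpow_neg_le_abs_rpow_sub {k p q : ℕ} (hk : 2 ≤ k) (hcop : Nat.Coprime p q)
    (hq : 0 < q) (hpow : ¬∃ m : ℕ, k = m ^ q) {η : ℝ} (hη : 0 < η) (hη1 : η ≤ 1) :
    ∃ d₀ : ℕ, ∀ d ≥ d₀, ∀ a : ℤ,
      (k : ℝ) ^ (-(η * d)) ≤ |(k : ℝ) ^ ((d : ℝ) + (p : ℝ) / q) - a| := by
  have hk0 : (0 : ℝ) < k := by positivity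
  obtain ⟨d₀, h⟩ := exists_rpow_neg_le_abs_sub hk hq (K := k ^ p) (Nat.one_le_pow _ _ (by omega))
    (ξ := (k : ℝ) ^ ((p : ℝ) / q)) (by positivity)
    (by rw [← Real.rpow_mul_natCast hk0.le, div_mul_cancel₀ _ (by positivity), Real.rpow_natCast]
        push_cast; rfl)
    (fun x hx => hpow (exists_nat_pow_eq_of_rat_pow_eq (by omega) hq hcop
      (by rw [hx]; push_cast; rfl))) hη hη1
  refine ⟨d₀, fun d hd a => ?_⟩
  rw [Real.rpow_add hk0, Real.rpow_natCast]
  exact h d hd a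

end Assembly

/-- for coprime `1 ≤ p < q` and `k ≥ 2` not a `q`-th power,
`∑_{0 ≤ d ≤ l} {k^{d+p/q}} = l/2 - (1/(2πi)) ∑_{0<|n|≤k^l} ζ(2nπi/log k) e^{2nπi p/q}/n + o(l)`
as `l → ∞` over positive reals. -/
theorem stmt_17 (k p q : ℕ) (hk : 2 ≤ k) (hcop : Nat.Coprime p q)
    (hp : 1 ≤ p) (hpq : p < q) (hpow : ¬∃ m : ℕ, k = m ^ q) :
    (fun l : ℝ =>
        ((∑ d ∈ Finset.range (⌊l⌋₊ + 1),
            Int.fract ((k : ℝ) ^ ((d : ℝ) + (p : ℝ) / (q : ℝ))) : ℝ) : ℂ) -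
          ((l / 2 : ℝ) -
            (1 / (2 * (Real.pi : ℂ) * I)) *
              ∑ n ∈ (Finset.Icc (-⌊(k : ℝ) ^ l⌋) ⌊(k : ℝ) ^ l⌋).erase 0,
                riemannZeta (2 * (n : ℂ) * (Real.pi : ℂ) * I / (Real.log k : ℂ)) *
                  Complex.exp (2 * (n : ℂ) * (Real.pi : ℂ) * I * (p : ℂ) / (q : ℂ)) /
                  (n : ℂ)))
      =o[atTop] (fun l : ℝ => l) := by
  have hq : 0 < q := by omega
  have hqR : (0 : ℝ) < q := by positivity
  have hkR : (2 : ℝ) ≤ k := by exact_mod_cast hk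
  rw [isLittleO_iff]
  intro ε hε
  obtain ⟨η, hη, hη1, hηε⟩ : ∃ η : ℝ, 0 < η ∧ η ≤ 1 ∧ 40 * η ≤ ε / 2 :=
    ⟨min 1 (ε / 80), by positivity, min_le_left _ _, by
      have := min_le_right 1 (ε / 80); linarith⟩
  obtain ⟨d₀, hd₀⟩ := exists_rpow_neg_le_abs_rpow_sub hk hcop hq hpow hη hη1
  obtain ⟨C, L₀, hC⟩ := exists_norm_sum_zetaTerm_add_le (α := (p : ℝ) / q) hk (by positivity)
    (by rw [div_lt_one hqR]; exact_mod_cast hpq) hη hd₀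
  filter_upwards [eventually_ge_atTop (L₀ : ℝ), eventually_ge_atTop (0 : ℝ),
    eventually_ge_atTop ((|C| + 8) / (ε / 2))] with l hl hl0 hlC
  have hL : L₀ ≤ ⌊l⌋₊ := Nat.le_floor hl
  have hL1 := Nat.floor_le hl0
  have hL2 := Nat.lt_floor_add_one l
  have hlow : (k : ℝ) ^ ⌊l⌋₊ ≤ (k : ℝ) ^ l := by
    rw [← Real.rpow_natCast]
    exact Real.rpow_le_rpow_of_exponent_le (by linarith) hL1
  have hupp : (k : ℝ) ^ l ≤ (k : ℝ) ^ (⌊l⌋₊ + 1) := by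
    rw [← Real.rpow_natCast]
    refine Real.rpow_le_rpow_of_exponent_le (by linarith) ?_
    push_cast
    exact hL2.le
  have hpos : (0 : ℝ) ≤ (k : ℝ) ^ l := by positivity
  obtain ⟨N, hN⟩ : ∃ N, N = ⌊(k : ℝ) ^ l⌋₊ := ⟨_, rfl⟩
  have hNZ : ⌊(k : ℝ) ^ l⌋ = (N : ℤ) := by rw [hN, Int.natCast_floor_eq_floor hpos]
  have hN1 : k ^ ⌊l⌋₊ ≤ N := by rw [hN]; exact Nat.le_floor (by push_cast; exact hlow)
  have hN2 : N ≤ k ^ (⌊l⌋₊ + 1) := by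
    have : (N : ℝ) ≤ (k : ℝ) ^ (⌊l⌋₊ + 1) := hN ▸ (Nat.floor_le hpos).trans hupp
    exact_mod_cast this
  have hmain := hC _ hL N hN1 hN2
  have hfr := abs_sum_fract_sub_le (fun d : ℕ => (k : ℝ) ^ ((d : ℝ) + (p : ℝ) / q)) (⌊l⌋₊ + 1) 5
  have hterm : ∀ n : ℤ, riemannZeta (2 * (n : ℂ) * (Real.pi : ℂ) * I / (Real.log k : ℂ)) *
      Complex.exp (2 * (n : ℂ) * (Real.pi : ℂ) * I * (p : ℂ) / (q : ℂ)) / (n : ℂ) =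
      zetaTerm (Real.log k) ((p : ℝ) / q) n := by
    intro n
    rw [zetaTerm]
    push_cast
    congr 3 <;> ring
  simp only [hterm]
  rw [hNZ, sum_Icc_erase_zero_eq, Real.norm_of_nonneg hl0]
  rw [Finset.sum_sub_distrib, Finset.sum_const, Finset.card_range] at hmain
  rw [add_assoc] at hfr
  norm_num only at hfr
  generalize (∑ n ∈ Finset.range N, (zetaTerm (Real.log k) ((p : ℝ) / q) (n + 1) +
    zetaTerm (Real.log k) ((p : ℝ) / q) (-(n + 1)))) = Z at hmain ⊢
  generalize (∑ d ∈ Finset.range (⌊l⌋₊ + 6), Int.fract ((k : ℝ) ^ ((d : ℝ) + (p : ℝ) / q))) = S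
    at hmain hfr
  generalize (∑ d ∈ Finset.range (⌊l⌋₊ + 1), Int.fract ((k : ℝ) ^ ((d : ℝ) + (p : ℝ) / q))) = T
    at hfr ⊢
  obtain ⟨L, hLdef⟩ : ∃ L : ℕ, L = ⌊l⌋₊ := ⟨_, rfl⟩
  rw [← hLdef] at hmain hL1 hL2
  have hpi : (Real.pi : ℂ) ≠ 0 := by exact_mod_cast Real.pi_ne_zero
  have hsplit : (T : ℂ) - ((l / 2 : ℝ) - 1 / (2 * (Real.pi : ℂ) * I) * Z) =
      1 / (2 * (Real.pi : ℂ) * I) *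
        (Z + 2 * Real.pi * I * ((S - (L + 6) • (1 / 2 : ℝ) : ℝ) : ℂ)) +
      ((T - S + (L + 6 - l) / 2 : ℝ) : ℂ) := by
    push_cast [nsmul_eq_mul]
    field_simp
    ring
  rw [hsplit]
  have hb1 : ‖1 / (2 * (Real.pi : ℂ) * I) *
      (Z + 2 * Real.pi * I * ((S - (L + 6) • (1 / 2 : ℝ) : ℝ) : ℂ))‖ ≤ C + 40 * η * L := by
    rw [norm_mul]
    refine (mul_le_of_le_one_left (norm_nonneg _) ?_).trans hmain
    have h3 := Real.pi_gt_three
    rw [norm_div, norm_mul, norm_mul, norm_I, norm_one, Complex.norm_real,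
      Real.norm_of_nonneg (by linarith), Complex.norm_ofNat, mul_one, div_le_one (by linarith)]
    linarith
  have hb2 : ‖((T - S + (L + 6 - l) / 2 : ℝ) : ℂ)‖ ≤ 8 := by
    rw [Complex.norm_real, Real.norm_eq_abs, abs_le]
    rw [abs_le] at hfr
    constructor <;> linarith [hfr.1, hfr.2]
  refine (norm_add_le_of_le hb1 hb2).trans ?_
  rw [div_le_iff₀ (by linarith)] at hlC
  have hCa := le_abs_self C
  have hηL : 40 * η * L ≤ ε / 2 * l := by gcongr
  linarith
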